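/- There exists a real constant A₂ such that for every ε > 0 there is a constant C(ε) with the following property: for all real x ≥ 2 and all real Q with 1 ≤ Q ≤ x, V(x,Q) = Q Σ_{n ≤ x} r₃(n)² − A₁ Q x + A₂ Q^{5/3} x^{1/3} + E, where |E| ≤ C(ε) ( x^{10/9+ε} (Σ_{n ≤ x} r₃(n)²)^{2/3} + Q² (x/Q)^{ε} ), and A₁ = Γ(4/3)⁶ Σ_{q=1}^∞ q^{−6} Σ_{1 ≤ a ≤ q, gcd(a,q)=1} |S₃(q,a)|⁶ with S₃(q,a) = Σ_{u=1}^{q} e^{2πi a u³ / q}. -/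

import Mathlib

open Classical Finset

/-- `r₃(n) = #{(l₁,l₂,l₃) ∈ ℕ³, l_i ≥ 1 : l₁³ + l₂³ + l₃³ = n}`. -/
noncomputable def rthree (n : ℕ) : ℕ :=
  Nat.card {t : ℕ × ℕ × ℕ //
    1 ≤ t.1 ∧ 1 ≤ t.2.1 ∧ 1 ≤ t.2.2 ∧ t.1 ^ 3 + t.2.1 ^ 3 + t.2.2 ^ 3 = n}

/-- `ρ(q,a) = #{(l₁,l₂,l₃) ∈ (ℤ/q)³ : l₁³ + l₂³ + l₃³ ≡ a (mod q)}`. -/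
noncomputable def rhothree (q a : ℕ) : ℕ :=
  Nat.card {t : ZMod q × ZMod q × ZMod q //
    t.1 ^ 3 + t.2.1 ^ 3 + t.2.2 ^ 3 = (a : ZMod q)}

/-- `A(x;q,a) = Σ_{n ≤ x, n ≡ a (mod q)} r₃(n)`. -/
noncomputable def Athree (x : ℝ) (q a : ℕ) : ℝ :=
  ∑ n ∈ (Finset.Icc 1 ⌊x⌋₊).filter (fun n => n % q = a % q), (rthree n : ℝ)

/-- `V(x,Q) = Σ_{q ≤ Q} Σ_{a=1}^{q} |A(x;q,a) − Γ(4/3)³ x ρ(q,a) q^{-3}|²`. -/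
noncomputable def Vthree (x Q : ℝ) : ℝ :=
  ∑ q ∈ Finset.Icc 1 ⌊Q⌋₊, ∑ a ∈ Finset.Icc 1 q,
    (Athree x q a - Real.Gamma (4 / 3) ^ 3 * x * (rhothree q a : ℝ) / (q : ℝ) ^ 3) ^ 2

/-- The cubic Weyl sum `S₃(q,a) = Σ_{u=1}^{q} e(au³/q)`. -/
noncomputable def Sthree (q a : ℕ) : ℂ :=
  ∑ u ∈ Finset.Icc 1 q, Complex.exp (2 * Real.pi * Complex.I * a * u ^ 3 / q)

/-- `A₁ = Γ(4/3)⁶ Σ_{q ≥ 1} q^{-6} Σ_{1 ≤ a ≤ q, (a,q)=1} |S₃(q,a)|⁶`. -/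
noncomputable def Aone : ℝ :=
  Real.Gamma (4 / 3) ^ 6 * ∑' q : ℕ, (q : ℝ) ^ (-(6 : ℤ)) *
    ∑ a ∈ (Finset.Icc 1 q).filter (fun a => Nat.gcd a q = 1), ‖Sthree q a‖ ^ 6

namespace ThreeCubes

/-- The additive character `e(t) = exp(2πit)`. -/
noncomputable def ex (t : ℝ) : ℂ := Complex.exp (2 * Real.pi * Complex.I * t)

lemma ex_add (s t : ℝ) : ex (s + t) = ex s * ex t := by
  simp only [ex, ← Complex.exp_add]; congr 1; push_cast; ring

lemma ex_zero : ex 0 = 1 := by simp [ex]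

lemma ex_intCast (n : ℤ) : ex n = 1 := by
  rw [ex, Complex.exp_eq_one_iff]; exact ⟨n, by push_cast; ring⟩

lemma norm_ex (t : ℝ) : ‖ex t‖ = 1 := by
  rw [ex, show 2 * Real.pi * Complex.I * t = ((2 * Real.pi * t : ℝ) : ℂ) * Complex.I by
    push_cast; ring]
  exact Complex.norm_exp_ofReal_mul_I _

lemma conj_ex (t : ℝ) : (starRingEnd ℂ) (ex t) = ex (-t) := by
  rw [ex, ex, ← Complex.exp_conj]; congr 1
  simp only [map_mul, Complex.conj_I, Complex.conj_ofReal, Complex.conj_ofNat]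
  push_cast; ring

lemma ex_nat_mul (n : ℕ) (t : ℝ) : ex (n * t) = ex t ^ n := by
  rw [ex, ex, ← Complex.exp_nat_mul]; congr 1; push_cast; ring

lemma ex_add_intCast (t : ℝ) (n : ℤ) : ex (t + n) = ex t := by
  rw [ex_add, ex_intCast, mul_one]

lemma ex_eq_of_sub_eq_int {s t : ℝ} (n : ℤ) (h : s - t = n) : ex s = ex t := by
  rw [show s = t + n by linarith, ex_add_intCast]

lemma ex_eq_one_iff (t : ℝ) : ex t = 1 ↔ ∃ n : ℤ, t = n := by
  constructor
  · intro h
    rw [ex, Complex.exp_eq_one_iff] at h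
    obtain ⟨n, hn⟩ := h
    refine ⟨n, ?_⟩
    have h2 : (2 * Real.pi * Complex.I : ℂ) ≠ 0 := by simp [Real.pi_ne_zero]
    have : (t : ℂ) = n := by
      apply mul_left_cancel₀ h2; rw [hn]; ring
    exact_mod_cast this
  · rintro ⟨n, rfl⟩; exact ex_intCast n

/-- Orthogonality of additive characters modulo `q`. -/
lemma sum_ex {q : ℕ} (hq : 0 < q) (m : ℤ) :
    ∑ b ∈ Icc 1 q, ex (b * m / q) = if (q : ℤ) ∣ m then (q : ℂ) else 0 := by
  have hq' : (q : ℝ) ≠ 0 := by positivity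
  split_ifs with h
  · obtain ⟨k, rfl⟩ := h
    rw [Finset.sum_congr rfl (g := fun _ => (1 : ℂ))]
    · simp
    · intro b _
      rw [ex_eq_one_iff]
      exact ⟨b * k, by push_cast; field_simp⟩
  · set z := ex (m / q) with hz
    have hz1 : z ≠ 1 := by
      rw [hz, Ne, ex_eq_one_iff]
      rintro ⟨n, hn⟩
      apply h
      refine ⟨n, ?_⟩
      have : (m : ℝ) = q * n := by rw [← hn]; field_simp
      exact_mod_cast this
    have hzq : z ^ q = 1 := by
      rw [hz, ← ex_nat_mul, ex_eq_one_iff]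
      exact ⟨m, by field_simp⟩
    have h1 : ∑ b ∈ Icc 1 q, ex (b * m / q) = ∑ b ∈ Icc 1 q, z ^ b := by
      refine Finset.sum_congr rfl fun b _ => ?_
      rw [hz, ← ex_nat_mul]; congr 1; ring
    rw [h1, ← Finset.Ico_add_one_right_eq_Icc, Finset.sum_Ico_eq_sum_range]
    simp only [pow_add, pow_one, ← Finset.mul_sum, Nat.add_sub_cancel]
    rw [geom_sum_eq hz1, hzq]; simp

lemma int_dvd_sub_iff {q a b : ℕ} (ha : a ∈ Icc 1 q) (hb : b ∈ Icc 1 q) :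
    (q : ℤ) ∣ (a : ℤ) - b ↔ b = a := by
  rw [Finset.mem_Icc] at ha hb
  constructor
  · intro h
    have := Int.eq_zero_of_abs_lt_dvd h (by rw [abs_lt]; omega)
    omega
  · rintro rfl; simp

/-- Parseval's identity modulo `q`, bilinear form. -/
lemma sum_hat_mul_conj_hat {q : ℕ} (hq : 0 < q) (F G : ℕ → ℝ) :
    ∑ b ∈ Icc 1 q, (∑ a ∈ Icc 1 q, (F a : ℂ) * ex (b * a / q)) *
      (starRingEnd ℂ) (∑ a ∈ Icc 1 q, (G a : ℂ) * ex (b * a / q)) =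
    q * ∑ a ∈ Icc 1 q, (F a : ℂ) * G a := by
  have h1 : ∀ b ∈ Icc 1 q, (∑ a ∈ Icc 1 q, (F a : ℂ) * ex (b * a / q)) *
      (starRingEnd ℂ) (∑ a ∈ Icc 1 q, (G a : ℂ) * ex (b * a / q)) =
      ∑ a ∈ Icc 1 q, ∑ a' ∈ Icc 1 q, (F a : ℂ) * G a' *
        ex (b * ((a : ℤ) - (a' : ℤ) : ℤ) / q) := by
    intro b _
    rw [map_sum, Finset.sum_mul_sum]
    refine Finset.sum_congr rfl fun a _ => Finset.sum_congr rfl fun a' _ => ?_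
    rw [map_mul, conj_ex, Complex.conj_ofReal]
    rw [show ((b : ℝ) * (((a : ℤ) - (a' : ℤ) : ℤ) : ℝ) / q) = b * a / q + -(b * a' / q) by
      push_cast; ring, ex_add]
    ring
  rw [Finset.sum_congr rfl h1, Finset.sum_comm, Finset.mul_sum]
  refine Finset.sum_congr rfl fun a ha => ?_
  rw [Finset.sum_comm]
  simp only [← Finset.mul_sum]
  rw [Finset.sum_congr rfl (g := fun a' => if a' = a then (F a : ℂ) * G a' * q else 0)]
  · rw [Finset.sum_ite_eq' _ a, if_pos ha]; ring
  · intro a' ha'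
    rw [sum_ex hq]
    simp only [int_dvd_sub_iff ha ha', mul_ite, mul_zero]

lemma sum_norm_hat_sq {q : ℕ} (hq : 0 < q) (F : ℕ → ℝ) :
    ∑ b ∈ Icc 1 q, ‖∑ a ∈ Icc 1 q, (F a : ℂ) * ex (b * a / q)‖ ^ 2 =
    q * ∑ a ∈ Icc 1 q, F a ^ 2 := by
  have h := sum_hat_mul_conj_hat hq F F
  simp only [Complex.mul_conj, Complex.normSq_eq_norm_sq] at h
  have h2 : ((∑ b ∈ Icc 1 q, ‖∑ a ∈ Icc 1 q, (F a : ℂ) * ex (b * a / q)‖ ^ 2 : ℝ) : ℂ) =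
      ((q * ∑ a ∈ Icc 1 q, F a ^ 2 : ℝ) : ℂ) := by
    push_cast
    push_cast at h
    rw [h]
    simp only [sq]
  exact_mod_cast h2

/-- Splitting a sum according to residues modulo `q`. -/
lemma sum_residue {M : Type*} [AddCommMonoid M] {q : ℕ} (hq : 0 < q) (s : Finset ℕ)
    (g : ℕ → M) :
    ∑ n ∈ s, g n = ∑ a ∈ Icc 1 q, ∑ n ∈ s.filter (fun n => n % q = a % q), g n := by
  simp only [Finset.sum_filter]
  rw [Finset.sum_comm]
  refine Finset.sum_congr rfl fun n _ => ?_
  set a₀ := if n % q = 0 then q else n % q with ha₀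
  have hlt := Nat.mod_lt n hq
  rw [Finset.sum_eq_single a₀]
  · rw [if_pos]
    rw [ha₀]; split_ifs with h
    · simp [h]
    · rw [Nat.mod_mod]
  · intro b hb hne
    rw [if_neg]
    intro h
    apply hne
    rw [Finset.mem_Icc] at hb
    rcases hb.2.lt_or_eq with hb2 | hb2
    · rw [Nat.mod_eq_of_lt hb2] at h
      rw [ha₀, h, if_neg (by omega)]
    · subst hb2
      simp at h
      simp [ha₀, h]
  · intro h
    exfalso; apply h
    rw [Finset.mem_Icc, ha₀]; split_ifs <;> omega

lemma sum_mul_periodic {q : ℕ} (hq : 0 < q) (s : Finset ℕ) (r : ℕ → ℂ) (p : ℕ → ℂ)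
    (hp : ∀ m n, m % q = n % q → p m = p n) :
    ∑ n ∈ s, r n * p n =
      ∑ a ∈ Icc 1 q, (∑ n ∈ s.filter (fun n => n % q = a % q), r n) * p a := by
  rw [sum_residue hq]
  refine Finset.sum_congr rfl fun a _ => ?_
  rw [Finset.sum_mul]
  refine Finset.sum_congr rfl fun n hn => ?_
  rw [hp n a (Finset.mem_filter.1 hn).2]

lemma sum_mul_periodic_real {q : ℕ} (hq : 0 < q) (s : Finset ℕ) (r : ℕ → ℝ) (p : ℕ → ℝ)
    (hp : ∀ m n, m % q = n % q → p m = p n) :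
    ∑ n ∈ s, r n * p n =
      ∑ a ∈ Icc 1 q, (∑ n ∈ s.filter (fun n => n % q = a % q), r n) * p a := by
  rw [sum_residue hq]
  refine Finset.sum_congr rfl fun a _ => ?_
  rw [Finset.sum_mul]
  refine Finset.sum_congr rfl fun n hn => ?_
  rw [hp n a (Finset.mem_filter.1 hn).2]

lemma ex_periodic {q : ℕ} (hq : 0 < q) (b : ℕ) (m n : ℕ) (h : m % q = n % q) :
    ex (b * m / q) = ex (b * n / q) := by
  have hd : (q : ℤ) ∣ (m : ℤ) - n := (Nat.modEq_iff_dvd.1 (show n ≡ m [MOD q] from h.symm))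
  obtain ⟨k, hk⟩ := hd
  have hk' : (m : ℝ) - n = q * k := by exact_mod_cast hk
  have hq' : (q : ℝ) ≠ 0 := by positivity
  refine ex_eq_of_sub_eq_int (b * k) ?_
  push_cast
  rw [← sub_div, ← mul_sub, hk']; field_simp

/-- Sums over fractions `b/k` split according to the reduced denominator. -/
lemma sum_fractions {M : Type*} [AddCommMonoid M] (Θ : ℕ → ℕ → M)
    (hΘ : ∀ g q b, 0 < g → 0 < q → Θ (g * q) (g * b) = Θ q b) {k : ℕ} (hk : 0 < k) :
    ∑ b ∈ Icc 1 k, Θ k b =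
      ∑ d ∈ k.divisors, ∑ b ∈ (Icc 1 d).filter (fun b => Nat.gcd b d = 1), Θ d b := by
  rw [Finset.sum_sigma']
  refine Finset.sum_bij' (fun b _ => ⟨k / Nat.gcd b k, b / Nat.gcd b k⟩)
    (fun x _ => k / x.1 * x.2) ?_ ?_ ?_ ?_ ?_
  · intro b hb
    rw [Finset.mem_Icc] at hb
    have hg : 0 < Nat.gcd b k := Nat.gcd_pos_of_pos_right _ hk
    simp only [Finset.mem_sigma, Nat.mem_divisors, Finset.mem_filter, Finset.mem_Icc]
    refine ⟨⟨Nat.div_dvd_of_dvd (Nat.gcd_dvd_right _ _), hk.ne'⟩, ⟨?_, ?_⟩, ?_⟩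
    · exact Nat.div_pos (Nat.le_of_dvd hb.1 (Nat.gcd_dvd_left _ _)) hg
    · exact Nat.div_le_div_right hb.2
    · exact Nat.coprime_div_gcd_div_gcd hg
  · rintro ⟨d, b⟩ hx
    simp only [Finset.mem_sigma, Nat.mem_divisors, Finset.mem_filter, Finset.mem_Icc] at hx
    obtain ⟨⟨⟨g, rfl⟩, _⟩, ⟨h1, h2⟩, h3⟩ := hx
    have hd : 0 < d := by omega
    have hg : 0 < g := by
      rcases Nat.eq_zero_or_pos g with rfl | h
      · simp at hk
      · exact h
    simp only [Nat.mul_div_cancel_left g hd, Finset.mem_Icc]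
    exact ⟨Nat.mul_pos hg h1, by rw [mul_comm d g]; exact Nat.mul_le_mul_left g h2⟩
  · intro b hb
    rw [Finset.mem_Icc] at hb
    have hg : 0 < Nat.gcd b k := Nat.gcd_pos_of_pos_right _ hk
    simp only
    rw [Nat.div_div_self (Nat.gcd_dvd_right _ _) hk.ne', Nat.mul_div_cancel' (Nat.gcd_dvd_left _ _)]
  · rintro ⟨d, b⟩ hx
    simp only [Finset.mem_sigma, Nat.mem_divisors, Finset.mem_filter, Finset.mem_Icc] at hx
    obtain ⟨⟨⟨g, rfl⟩, _⟩, ⟨h1, h2⟩, h3⟩ := hx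
    have hd : 0 < d := by omega
    have hg : 0 < g := by
      rcases Nat.eq_zero_or_pos g with rfl | h
      · simp at hk
      · exact h
    simp only [Nat.mul_div_cancel_left g hd]
    rw [mul_comm d g, Nat.gcd_mul_left, h3, mul_one, Nat.mul_div_cancel_left _ hg,
      Nat.mul_div_cancel_left _ hg]
  · intro b hb
    rw [Finset.mem_Icc] at hb
    have hg : 0 < Nat.gcd b k := Nat.gcd_pos_of_pos_right _ hk
    simp only
    conv_lhs => rw [← Nat.mul_div_cancel' (Nat.gcd_dvd_right b k)]
    conv_lhs => arg 2; rw [← Nat.mul_div_cancel' (Nat.gcd_dvd_left b k)]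
    exact hΘ _ _ _ hg (Nat.div_pos (Nat.le_of_dvd hk (Nat.gcd_dvd_right _ _)) hg)

/-- The density `Γ(4/3)³`. -/
noncomputable def cG : ℝ := Real.Gamma (4 / 3) ^ 3

lemma cG_pos : 0 < cG := pow_pos (Real.Gamma_pos_of_pos (by norm_num)) 3

/-- The exponential sum `Σ_{n ≤ y} r₃(n) e(bn/q)`. -/
noncomputable def fsum (y : ℝ) (q b : ℕ) : ℂ :=
  ∑ n ∈ Icc 1 ⌊y⌋₊, (rthree n : ℂ) * ex (b * n / q)

/-- The normalised cubic Gauss sum `S₃(q,b)/q`. -/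
noncomputable def sg (q b : ℕ) : ℂ := Sthree q b / q

/-- `H(q) = Σ_{b mod q} |S₃(q,b)/q|⁶`. -/
noncomputable def Hq (q : ℕ) : ℝ := ∑ b ∈ Icc 1 q, ‖sg q b‖ ^ 6

/-- `J(d) = Σ_{b mod d, (b,d)=1} |S₃(d,b)/d|⁶`. -/
noncomputable def Jd (d : ℕ) : ℝ :=
  ∑ b ∈ (Icc 1 d).filter (fun b => Nat.gcd b d = 1), ‖sg d b‖ ^ 6

/-- The deviation of the exponential sum from its expected value. -/
noncomputable def Dl (y : ℝ) (q b : ℕ) : ℂ := fsum y q b - (cG * y : ℝ) * sg q b ^ 3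

noncomputable def Wq (y : ℝ) (q : ℕ) : ℝ := ∑ b ∈ Icc 1 q, ‖Dl y q b‖ ^ 2

noncomputable def Wc (y : ℝ) (d : ℕ) : ℝ :=
  ∑ b ∈ (Icc 1 d).filter (fun b => Nat.gcd b d = 1), ‖Dl y d b‖ ^ 2

/-- The expected value of `r₃` on the class of `n` modulo `k`. -/
noncomputable def sk (k n : ℕ) : ℝ := cG * rhothree k n / k ^ 2

lemma Hq_nonneg (q : ℕ) : 0 ≤ Hq q := Finset.sum_nonneg fun _ _ => by positivity
lemma Jd_nonneg (q : ℕ) : 0 ≤ Jd q := Finset.sum_nonneg fun _ _ => by positivity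
lemma Wq_nonneg (y : ℝ) (q : ℕ) : 0 ≤ Wq y q := Finset.sum_nonneg fun _ _ => by positivity
lemma Wc_nonneg (y : ℝ) (q : ℕ) : 0 ≤ Wc y q := Finset.sum_nonneg fun _ _ => by positivity
lemma sk_nonneg (k n : ℕ) : 0 ≤ sk k n := by have := cG_pos; unfold sk; positivity

lemma Wc_le_Wq (y : ℝ) (d : ℕ) : Wc y d ≤ Wq y d :=
  Finset.sum_le_sum_of_subset_of_nonneg (Finset.filter_subset _ _) fun _ _ _ => by positivity

lemma Sthree_eq (q a : ℕ) : Sthree q a = ∑ u ∈ Icc 1 q, ex (a * (u ^ 3 : ℕ) / q) := by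
  refine Finset.sum_congr rfl fun u _ => ?_
  rw [ex]; congr 1; push_cast; ring

/-- Residues modulo `q` are represented by `1, …, q`. -/
noncomputable def iccZMod (q : ℕ) [NeZero q] : {u : ℕ // u ∈ Icc 1 q} ≃ ZMod q :=
  Equiv.ofBijective (fun u => (u.1 : ZMod q)) <| by
    rw [Fintype.bijective_iff_injective_and_card]
    refine ⟨?_, by simp [ZMod.card]⟩
    rintro ⟨a, ha⟩ ⟨b, hb⟩ h
    simp only at h
    rw [ZMod.natCast_eq_natCast_iff, Nat.modEq_iff_dvd, int_dvd_sub_iff hb ha] at h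
    exact Subtype.ext h

lemma rhothree_eq {q : ℕ} (hq : 0 < q) (a : ℕ) :
    rhothree q a = #((Icc 1 q ×ˢ Icc 1 q ×ˢ Icc 1 q).filter
      (fun u => (u.1 ^ 3 + u.2.1 ^ 3 + u.2.2 ^ 3) % q = a % q)) := by
  have : NeZero q := ⟨hq.ne'⟩
  rw [rhothree, Nat.card_eq_fintype_card, Fintype.card_subtype]
  symm
  refine Finset.card_bij (fun u _ => ((u.1 : ZMod q), (u.2.1 : ZMod q), (u.2.2 : ZMod q))) ?_ ?_ ?_
  · rintro ⟨u, v, w⟩ h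
    simp only [Finset.mem_filter, Finset.mem_univ, true_and] at h ⊢
    exact_mod_cast (ZMod.natCast_eq_natCast_iff _ _ q).2 h.2
  · rintro ⟨u, v, w⟩ h ⟨u', v', w'⟩ h'
    simp only [Finset.mem_filter, Finset.mem_product, Prod.mk.injEq] at h h' ⊢
    rintro ⟨h1, h2, h3⟩
    refine ⟨?_, ?_, ?_⟩
    · exact congrArg Subtype.val
        ((iccZMod q).injective (a₁ := ⟨u, h.1.1⟩) (a₂ := ⟨u', h'.1.1⟩) h1)
    · exact congrArg Subtype.val
        ((iccZMod q).injective (a₁ := ⟨v, h.1.2.1⟩) (a₂ := ⟨v', h'.1.2.1⟩) h2)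
    · exact congrArg Subtype.val
        ((iccZMod q).injective (a₁ := ⟨w, h.1.2.2⟩) (a₂ := ⟨w', h'.1.2.2⟩) h3)
  · rintro ⟨x, y, z⟩ h
    simp only [Finset.mem_filter, Finset.mem_univ, true_and] at h
    obtain ⟨⟨u, hu⟩, rfl⟩ := (iccZMod q).surjective x
    obtain ⟨⟨v, hv⟩, rfl⟩ := (iccZMod q).surjective y
    obtain ⟨⟨w, hw⟩, rfl⟩ := (iccZMod q).surjective z
    refine ⟨(u, v, w), ?_, rfl⟩
    simp only [Finset.mem_filter, Finset.mem_product]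
    refine ⟨⟨hu, hv, hw⟩, ?_⟩
    apply (ZMod.natCast_eq_natCast_iff _ _ q).1
    push_cast
    exact h

lemma rhothree_congr {q m n : ℕ} (h : m % q = n % q) : rhothree q m = rhothree q n := by
  unfold rhothree
  rw [(ZMod.natCast_eq_natCast_iff m n q).2 h]

lemma sk_congr {q m n : ℕ} (h : m % q = n % q) : sk q m = sk q n := by
  unfold sk; rw [rhothree_congr h]

lemma sum_rhothree_ex {q : ℕ} (hq : 0 < q) (b : ℕ) :
    ∑ a ∈ Icc 1 q, (rhothree q a : ℂ) * ex (b * a / q) = Sthree q b ^ 3 := by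
  have h1 : Sthree q b ^ 3 = ∑ u ∈ Icc 1 q ×ˢ Icc 1 q ×ˢ Icc 1 q,
      ex (b * (u.1 ^ 3 + u.2.1 ^ 3 + u.2.2 ^ 3 : ℕ) / q) := by
    rw [Finset.sum_product]
    simp only [Finset.sum_product]
    rw [pow_succ, sq, Sthree_eq, mul_assoc, Finset.sum_mul]
    refine Finset.sum_congr rfl fun u _ => ?_
    rw [Finset.sum_mul_sum, Finset.mul_sum]
    refine Finset.sum_congr rfl fun v _ => ?_
    rw [Finset.mul_sum]
    refine Finset.sum_congr rfl fun w _ => ?_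
    rw [← ex_add, ← ex_add]; congr 1; push_cast; ring
  rw [h1]
  have h2 : ∀ a ∈ Icc 1 q, (rhothree q a : ℂ) * ex (b * a / q) =
      ∑ u ∈ (Icc 1 q ×ˢ Icc 1 q ×ˢ Icc 1 q).filter
        (fun u => (u.1 ^ 3 + u.2.1 ^ 3 + u.2.2 ^ 3) % q = a % q),
        ex (b * (u.1 ^ 3 + u.2.1 ^ 3 + u.2.2 ^ 3 : ℕ) / q) := by
    intro a _
    rw [rhothree_eq hq, ← nsmul_eq_mul, ← Finset.sum_const]
    refine Finset.sum_congr rfl fun u hu => ?_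
    exact (ex_periodic hq b _ _ (Finset.mem_filter.1 hu).2).symm
  rw [Finset.sum_congr rfl h2]
  simp only [Finset.sum_filter]
  rw [Finset.sum_comm]
  refine Finset.sum_congr rfl fun u _ => ?_
  have := sum_residue hq {u.1 ^ 3 + u.2.1 ^ 3 + u.2.2 ^ 3} (fun n => ex (b * n / q))
  simp only [Finset.sum_filter, Finset.sum_singleton] at this
  exact this.symm

lemma fsum_eq {q : ℕ} (hq : 0 < q) (y : ℝ) (b : ℕ) :
    fsum y q b = ∑ a ∈ Icc 1 q, (Athree y q a : ℂ) * ex (b * a / q) := by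
  rw [fsum, sum_mul_periodic hq _ _ (fun n => ex (b * n / q)) (fun m n h => ex_periodic hq b m n h)]
  refine Finset.sum_congr rfl fun a _ => ?_
  rw [Athree]; push_cast; rfl

lemma Dl_eq {q : ℕ} (hq : 0 < q) (y : ℝ) (b : ℕ) :
    Dl y q b = ∑ a ∈ Icc 1 q,
      ((Athree y q a - cG * y * rhothree q a / q ^ 3 : ℝ) : ℂ) * ex (b * a / q) := by
  rw [Dl, fsum_eq hq, sg, div_pow, ← sum_rhothree_ex hq, mul_div_assoc', Finset.mul_sum,
    Finset.sum_div, ← Finset.sum_sub_distrib]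
  refine Finset.sum_congr rfl fun a _ => ?_
  push_cast; ring

lemma Wq_eq {q : ℕ} (hq : 0 < q) (y : ℝ) :
    Wq y q = q * ∑ a ∈ Icc 1 q, (Athree y q a - cG * y * rhothree q a / q ^ 3) ^ 2 := by
  rw [Wq, ← sum_norm_hat_sq hq]
  refine Finset.sum_congr rfl fun b _ => ?_
  rw [Dl_eq hq]

lemma sum_rhothree_sq {q : ℕ} (hq : 0 < q) :
    ∑ a ∈ Icc 1 q, (rhothree q a : ℝ) ^ 2 = q ^ 5 * Hq q := by
  have hq' : (q : ℝ) ≠ 0 := by positivity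
  have h := sum_norm_hat_sq hq (fun a => (rhothree q a : ℝ))
  have h2 : ∑ b ∈ Icc 1 q, ‖∑ a ∈ Icc 1 q, (((rhothree q a : ℝ)) : ℂ) * ex (b * a / q)‖ ^ 2 =
      q ^ 6 * Hq q := by
    rw [Hq, Finset.mul_sum]
    refine Finset.sum_congr rfl fun b _ => ?_
    have := sum_rhothree_ex hq b
    push_cast
    rw [this, sg, norm_div, norm_pow, Complex.norm_natCast]
    field_simp
  rw [h2] at h
  apply mul_left_cancel₀ hq'
  rw [← h]; ring

lemma sum_sk_sq {q : ℕ} (hq : 0 < q) :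
    ∑ a ∈ Icc 1 q, sk q a ^ 2 = cG ^ 2 * q * Hq q := by
  have hq' : (q : ℝ) ≠ 0 := by positivity
  have : ∀ a ∈ Icc 1 q, sk q a ^ 2 = cG ^ 2 / q ^ 4 * (rhothree q a : ℝ) ^ 2 := by
    intro a _; rw [sk]; field_simp
  rw [Finset.sum_congr rfl this, ← Finset.mul_sum, sum_rhothree_sq hq]
  field_simp

lemma Sthree_scale (g q b : ℕ) (hg : 0 < g) (hq : 0 < q) :
    Sthree (g * q) (g * b) = g * Sthree q b := by
  have hg' : (g : ℝ) ≠ 0 := by positivity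
  have hq' : (q : ℝ) ≠ 0 := by positivity
  rw [Sthree_eq, Sthree_eq]
  have h1 : ∀ u ∈ Icc 1 (g * q), ex (((g * b : ℕ) : ℝ) * (u ^ 3 : ℕ) / ((g * q : ℕ) : ℝ)) =
      ex (b * (u ^ 3 : ℕ) / q) := by
    intro u _; congr 1; push_cast; field_simp
  rw [Finset.sum_congr rfl h1, sum_residue hq, Finset.mul_sum]
  refine Finset.sum_congr rfl fun a ha => ?_
  rw [Finset.sum_congr rfl (g := fun _ => ex (b * (a ^ 3 : ℕ) / q))]
  · rw [Finset.sum_const, nsmul_eq_mul]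
    congr 2
    have h3 : #((Icc 1 (g * q)).filter (fun n => n % q = a % q)) =
        #((Ioc 0 (g * q)).filter (fun n => n ≡ a [MOD q])) := rfl
    rw [h3]
    have h4 := Nat.Ioc_filter_modEq_card 0 (g * q) hq a
    have h5 : ((#((Ioc 0 (g * q)).filter (fun n => n ≡ a [MOD q])) : ℕ) : ℤ) = g := by
      rw [h4]
      have e1 : (((g * q : ℕ) : ℚ) - a) / q = (-(a : ℚ) / q) + (g : ℤ) := by
        have : (q : ℚ) ≠ 0 := by positivity
        push_cast; field_simp; ring
      rw [e1, Int.floor_add_intCast]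
      simp
    exact_mod_cast h5
  · intro n hn
    refine ex_periodic hq b _ _ ?_
    exact (Nat.ModEq.pow 3 (Finset.mem_filter.1 hn).2)

lemma sg_scale (g q b : ℕ) (hg : 0 < g) (hq : 0 < q) : sg (g * q) (g * b) = sg q b := by
  have hg' : (g : ℂ) ≠ 0 := by exact_mod_cast hg.ne'
  rw [sg, sg, Sthree_scale g q b hg hq]; push_cast
  rw [mul_div_mul_left _ _ hg']

lemma fsum_scale (y : ℝ) (g q b : ℕ) (hg : 0 < g) : fsum y (g * q) (g * b) = fsum y q b := by
  have hg' : (g : ℝ) ≠ 0 := by positivity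
  refine Finset.sum_congr rfl fun n _ => ?_
  congr 2; push_cast
  rw [mul_assoc, mul_div_mul_left _ _ hg']

lemma Dl_scale (y : ℝ) (g q b : ℕ) (hg : 0 < g) (hq : 0 < q) :
    Dl y (g * q) (g * b) = Dl y q b := by
  rw [Dl, Dl, fsum_scale y g q b hg, sg_scale g q b hg hq]

lemma Hq_eq_sum_divisors {k : ℕ} (hk : 0 < k) : Hq k = ∑ d ∈ k.divisors, Jd d :=
  sum_fractions (fun q b => ‖sg q b‖ ^ 6)
    (fun g q b hg hq => by simp only [sg_scale g q b hg hq]) hk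

lemma Wq_eq_sum_divisors (y : ℝ) {k : ℕ} (hk : 0 < k) : Wq y k = ∑ d ∈ k.divisors, Wc y d :=
  sum_fractions (fun q b => ‖Dl y q b‖ ^ 2)
    (fun g q b hg hq => by simp only [Dl_scale y g q b hg hq]) hk

lemma Vthree_eq (x Q : ℝ) : Vthree x Q = ∑ q ∈ Icc 1 ⌊Q⌋₊, Wq x q / q := by
  refine Finset.sum_congr rfl fun q hq => ?_
  have hq1 : 0 < q := (Finset.mem_Icc.1 hq).1
  have hq' : (q : ℝ) ≠ 0 := by positivity
  rw [Wq_eq hq1, mul_div_cancel_left₀ _ hq']; rfl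

lemma Aone_eq : Aone = cG ^ 2 * ∑' d, Jd d := by
  rw [Aone, cG, ← pow_mul]
  congr 2
  funext q
  rw [Jd, Finset.mul_sum]
  refine Finset.sum_congr rfl fun a _ => ?_
  rw [sg, norm_div, Complex.norm_natCast, div_pow, zpow_neg, div_eq_inv_mul]
  norm_cast

/-- The correlation of `r₃` with its expected value modulo `k`. -/
lemma abs_sum_rthree_mul_sk_sub_le {k : ℕ} (hk : 0 < k) (y : ℝ) :
    |∑ n ∈ Icc 1 ⌊y⌋₊, (rthree n : ℝ) * sk k n - cG ^ 2 * y * Hq k| ≤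
      cG * ∑ d ∈ k.divisors, √(Jd d) * √(Wc y d) := by
  have hk' : (k : ℝ) ≠ 0 := by positivity
  have hc := cG_pos
  set F : ℕ → ℝ := fun a => Athree y k a - cG * y * rhothree k a / k ^ 3 with hF
  have h1 : ∑ n ∈ Icc 1 ⌊y⌋₊, (rthree n : ℝ) * sk k n - cG ^ 2 * y * Hq k =
      ∑ a ∈ Icc 1 k, F a * sk k a := by
    rw [sum_mul_periodic_real hk _ _ _ (fun m n h => sk_congr h)]
    have : ∀ a ∈ Icc 1 k, F a * sk k a = Athree y k a * sk k a - y / k * sk k a ^ 2 := by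
      intro a _; simp only [hF, sk]; field_simp
    rw [Finset.sum_congr rfl this, Finset.sum_sub_distrib, ← Finset.mul_sum, sum_sk_sq hk]
    congr 1
    field_simp
  have h2 : ((∑ a ∈ Icc 1 k, F a * sk k a : ℝ) : ℂ) =
      cG * ∑ b ∈ Icc 1 k, Dl y k b * (starRingEnd ℂ) (sg k b ^ 3) := by
    have h := sum_hat_mul_conj_hat hk F (fun a => (rhothree k a : ℝ))
    have h3 : ∀ b ∈ Icc 1 k, (∑ a ∈ Icc 1 k, (F a : ℂ) * ex (b * a / k)) *
      (starRingEnd ℂ) (∑ a ∈ Icc 1 k, (((rhothree k a : ℝ)) : ℂ) * ex (b * a / k)) =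
        k ^ 3 * (Dl y k b * (starRingEnd ℂ) (sg k b ^ 3)) := by
      intro b _
      have := sum_rhothree_ex hk b
      push_cast
      rw [this, Dl_eq hk, sg, div_pow, map_div₀]
      simp only [map_pow, Complex.conj_natCast]
      change (∑ a ∈ Icc 1 k, (F a : ℂ) * ex (b * a / k)) * _ =
        _ * ((∑ a ∈ Icc 1 k, (F a : ℂ) * ex (b * a / k)) * _)
      generalize ∑ a ∈ Icc 1 k, (F a : ℂ) * ex (b * a / k) = T
      have hkc : (k : ℂ) ≠ 0 := by exact_mod_cast hk.ne'
      field_simp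
    rw [Finset.sum_congr rfl h3, ← Finset.mul_sum] at h
    have hkc : (k : ℂ) ≠ 0 := by exact_mod_cast hk.ne'
    have h4 : ((∑ a ∈ Icc 1 k, F a * sk k a : ℝ) : ℂ) =
        cG / k ^ 3 * (k * ∑ a ∈ Icc 1 k, (F a : ℂ) * ((rhothree k a : ℝ) : ℂ)) := by
      push_cast
      rw [Finset.mul_sum, Finset.mul_sum]
      refine Finset.sum_congr rfl fun a _ => ?_
      simp only [sk]; push_cast; field_simp
    rw [h4, ← h]; field_simp
  have h3 : ∑ b ∈ Icc 1 k, ‖Dl y k b‖ * ‖sg k b‖ ^ 3 ≤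
      ∑ d ∈ k.divisors, √(Jd d) * √(Wc y d) := by
    rw [sum_fractions (fun q b => ‖Dl y q b‖ * ‖sg q b‖ ^ 3)
      (fun g q b hg hq => by simp only [sg_scale g q b hg hq, Dl_scale y g q b hg hq]) hk]
    refine Finset.sum_le_sum fun d _ => ?_
    rw [mul_comm (√(Jd d)), ← Real.sqrt_mul (Wc_nonneg y d)]
    apply Real.le_sqrt_of_sq_le
    have := Finset.sum_mul_sq_le_sq_mul_sq ((Icc 1 d).filter (fun b => Nat.gcd b d = 1))
      (fun b => ‖Dl y d b‖) (fun b => ‖sg d b‖ ^ 3)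
    simpa only [← pow_mul, Wc, Jd] using this
  rw [h1, ← Real.norm_eq_abs, ← Complex.norm_real, h2, norm_mul, Complex.norm_real,
    Real.norm_of_nonneg hc.le]
  refine mul_le_mul_of_nonneg_left (le_trans ?_ h3) hc.le
  refine (norm_sum_le _ _).trans (le_of_eq (Finset.sum_congr rfl fun b _ => ?_))
  rw [norm_mul, RCLike.norm_conj, norm_pow]

/-- Lattice points of the nonnegative octant in the cubic ball `v₁³ + v₂³ + v₃³ ≤ M`. -/
noncomputable def octant (M : ℕ) : Finset (ℕ × ℕ × ℕ) :=
  (range (M + 1) ×ˢ range (M + 1) ×ˢ range (M + 1)).filter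
    (fun v => v.1 ^ 3 + v.2.1 ^ 3 + v.2.2 ^ 3 ≤ M)

/-- Lattice points `v` whose upper corner `v + 1` lies in the cubic ball. -/
noncomputable def octantIn (M : ℕ) : Finset (ℕ × ℕ × ℕ) :=
  (range (M + 1) ×ˢ range (M + 1) ×ˢ range (M + 1)).filter
    (fun v => (v.1 + 1) ^ 3 + (v.2.1 + 1) ^ 3 + (v.2.2 + 1) ^ 3 ≤ M)

lemma mem_octant {M : ℕ} {v : ℕ × ℕ × ℕ} :
    v ∈ octant M ↔ v.1 ^ 3 + v.2.1 ^ 3 + v.2.2 ^ 3 ≤ M := by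
  simp only [octant, Finset.mem_filter, Finset.mem_product, Finset.mem_range,
    and_iff_right_iff_imp]
  intro h
  have h1 := Nat.le_self_pow (n := 3) (by norm_num) v.1
  have h2 := Nat.le_self_pow (n := 3) (by norm_num) v.2.1
  have h3 := Nat.le_self_pow (n := 3) (by norm_num) v.2.2
  omega

lemma mem_octantIn {M : ℕ} {v : ℕ × ℕ × ℕ} :
    v ∈ octantIn M ↔ (v.1 + 1) ^ 3 + (v.2.1 + 1) ^ 3 + (v.2.2 + 1) ^ 3 ≤ M := by
  simp only [octantIn, Finset.mem_filter, Finset.mem_product, Finset.mem_range,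
    and_iff_right_iff_imp]
  intro h
  have h1 := Nat.le_self_pow (n := 3) (by norm_num) (v.1 + 1)
  have h2 := Nat.le_self_pow (n := 3) (by norm_num) (v.2.1 + 1)
  have h3 := Nat.le_self_pow (n := 3) (by norm_num) (v.2.2 + 1)
  omega

/-- The cubic ball of volume `8 Γ(4/3)³ z`. -/
def cball (z : ℝ) : Set (Fin 3 → ℝ) := {w | |w 0| ^ 3 + |w 1| ^ 3 + |w 2| ^ 3 ≤ z}

lemma volume_cball {z : ℝ} (hz : 0 ≤ z) :
    MeasureTheory.volume (cball z) = ENNReal.ofReal (8 * (cG * z)) := by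
  have h := MeasureTheory.volume_sum_rpow_le (Fin 3) (p := 3) (by norm_num) (z ^ (1 / 3 : ℝ))
  have e : {x : Fin 3 → ℝ | (∑ i, |x i| ^ (3 : ℝ)) ^ (1 / 3 : ℝ) ≤ z ^ (1 / 3 : ℝ)} = cball z := by
    ext w
    simp only [Set.mem_ofPred_eq, cball, Fin.sum_univ_three]
    rw [Real.rpow_le_rpow_iff (by positivity) hz (by norm_num)]
    norm_cast
  rw [e] at h
  rw [h, ← ENNReal.ofReal_pow (by positivity), ← ENNReal.ofReal_mul (by positivity)]
  congr 1
  rw [Fintype.card_fin, ← Real.rpow_natCast, ← Real.rpow_mul hz, cG]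
  norm_num
  ring

lemma card_octantIn_le {z : ℝ} (hz : 0 ≤ z) : (#(octantIn ⌊z⌋₊) : ℝ) ≤ cG * z := by
  set I : ℕ → Set ℝ := fun n => {t | (n : ℝ) < |t| ∧ |t| < n + 1} with hI
  have hIo : ∀ n, IsOpen (I n) := fun n =>
    (isOpen_lt continuous_const continuous_abs).inter (isOpen_lt continuous_abs continuous_const)
  have hIv : ∀ n, ENNReal.ofReal 2 ≤ MeasureTheory.volume (I n) := by
    intro n
    have hd : Disjoint (Set.Ioo (n : ℝ) (n + 1)) (Set.Ioo (-(n + 1) : ℝ) (-n)) := by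
      rw [Set.disjoint_left]
      rintro t ⟨h1, h2⟩ ⟨h3, h4⟩
      have : (0 : ℝ) ≤ n := Nat.cast_nonneg n
      linarith
    have hs : Set.Ioo (n : ℝ) (n + 1) ∪ Set.Ioo (-(n + 1) : ℝ) (-n) ⊆ I n := by
      have : (0 : ℝ) ≤ n := Nat.cast_nonneg n
      rintro t (⟨h1, h2⟩ | ⟨h1, h2⟩)
      · rw [hI, Set.mem_ofPred_eq, abs_of_pos (by linarith)]; exact ⟨h1, h2⟩
      · rw [hI, Set.mem_ofPred_eq, abs_of_neg (by linarith)]; constructor <;> linarith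
    refine le_trans ?_ (MeasureTheory.measure_mono hs)
    rw [MeasureTheory.measure_union hd measurableSet_Ioo, Real.volume_Ioo, Real.volume_Ioo,
      ← ENNReal.ofReal_add (by linarith) (by linarith)]
    exact ENNReal.ofReal_le_ofReal (by linarith)
  set X : ℕ × ℕ × ℕ → Set (Fin 3 → ℝ) := fun v =>
    Set.pi Set.univ (fun i => I ((![v.1, v.2.1, v.2.2] : Fin 3 → ℕ) i)) with hX
  have hmem : ∀ v w, w ∈ X v → w 0 ∈ I v.1 ∧ w 1 ∈ I v.2.1 ∧ w 2 ∈ I v.2.2 := by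
    intro v w hw
    exact ⟨hw 0 (Set.mem_univ _), hw 1 (Set.mem_univ _), hw 2 (Set.mem_univ _)⟩
  have hIu : ∀ m n t, t ∈ I m → t ∈ I n → m = n := by
    rintro m n t ⟨h1, h2⟩ ⟨h3, h4⟩
    have h5 : (m : ℝ) < n + 1 := by linarith
    have h6 : (n : ℝ) < m + 1 := by linarith
    norm_cast at h5 h6; omega
  have hdis : Set.PairwiseDisjoint (octantIn ⌊z⌋₊ : Set (ℕ × ℕ × ℕ)) X := by
    intro v _ v' _ hne
    rw [Function.onFun, Set.disjoint_left]
    intro w h1 h2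
    obtain ⟨a1, a2, a3⟩ := hmem _ _ h1
    obtain ⟨b1, b2, b3⟩ := hmem _ _ h2
    exact hne (Prod.ext (hIu _ _ _ a1 b1) (Prod.ext (hIu _ _ _ a2 b2) (hIu _ _ _ a3 b3)))
  have hsub : (⋃ v ∈ octantIn ⌊z⌋₊, X v) ⊆ cball z := by
    intro w hw
    simp only [Set.mem_iUnion] at hw
    obtain ⟨v, hv, hw⟩ := hw
    rw [mem_octantIn, Nat.le_floor_iff hz] at hv
    push_cast at hv
    obtain ⟨a1, a2, a3⟩ := hmem _ _ hw
    refine le_trans ?_ hv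
    have := a1.2.le; have := a2.2.le; have := a3.2.le
    gcongr
  have h1 := MeasureTheory.measure_mono (μ := MeasureTheory.volume) hsub
  rw [MeasureTheory.measure_biUnion_finset hdis
    (fun v _ => MeasurableSet.univ_pi fun i => (hIo _).measurableSet), volume_cball hz] at h1
  have h2 : ∀ v ∈ octantIn ⌊z⌋₊, ENNReal.ofReal 8 ≤ MeasureTheory.volume (X v) := by
    intro v _
    rw [hX, MeasureTheory.volume_pi_pi, show (8 : ℝ) = 2 ^ 3 by norm_num,
      ENNReal.ofReal_pow (by norm_num)]
    simpa using Finset.pow_card_le_prod (s := (univ : Finset (Fin 3))) _ _ fun i _ => hIv _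
  have h3 := (Finset.sum_le_sum h2).trans h1
  rw [Finset.sum_const, nsmul_eq_mul, ← ENNReal.ofReal_natCast,
    ← ENNReal.ofReal_mul (by positivity), ENNReal.ofReal_le_ofReal_iff
      (by have := cG_pos; positivity)] at h3
  linarith

lemma le_card_octant {z : ℝ} (hz : 0 ≤ z) : cG * z ≤ #(octant ⌊z⌋₊) := by
  set I : ℕ → Set ℝ := fun n => {t | (n : ℝ) ≤ |t| ∧ |t| ≤ n + 1} with hI
  have hIv : ∀ n, MeasureTheory.volume (I n) ≤ ENNReal.ofReal 2 := by
    intro n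
    have hs : I n ⊆ Set.Icc (n : ℝ) (n + 1) ∪ Set.Icc (-(n + 1) : ℝ) (-n) := by
      rintro t ⟨h1, h2⟩
      rcases le_total 0 t with h | h
      · rw [abs_of_nonneg h] at h1 h2; exact Or.inl ⟨h1, h2⟩
      · rw [abs_of_nonpos h] at h1 h2
        exact Or.inr ⟨by linarith, by linarith⟩
    refine (MeasureTheory.measure_mono hs).trans ((MeasureTheory.measure_union_le _ _).trans ?_)
    rw [Real.volume_Icc, Real.volume_Icc, ← ENNReal.ofReal_add (by linarith) (by linarith)]
    exact ENNReal.ofReal_le_ofReal (by linarith)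
  set X : ℕ × ℕ × ℕ → Set (Fin 3 → ℝ) := fun v =>
    Set.pi Set.univ (fun i => I ((![v.1, v.2.1, v.2.2] : Fin 3 → ℕ) i)) with hX
  have hsub : cball z ⊆ ⋃ v ∈ octant ⌊z⌋₊, X v := by
    intro w hw
    simp only [Set.mem_iUnion]
    refine ⟨(⌊|w 0|⌋₊, ⌊|w 1|⌋₊, ⌊|w 2|⌋₊), ?_, ?_⟩
    · rw [mem_octant, Nat.le_floor_iff hz]
      push_cast
      refine le_trans ?_ hw
      have h0 := Nat.floor_le (abs_nonneg (w 0))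
      have h1 := Nat.floor_le (abs_nonneg (w 1))
      have h2 := Nat.floor_le (abs_nonneg (w 2))
      gcongr
    · have key : ∀ i, w i ∈ I ⌊|w i|⌋₊ := fun i =>
        ⟨Nat.floor_le (abs_nonneg _), (Nat.lt_floor_add_one _).le⟩
      intro i _
      fin_cases i
      · exact key 0
      · exact key 1
      · exact key 2
  have h1 := (MeasureTheory.measure_mono (μ := MeasureTheory.volume) hsub).trans
    (MeasureTheory.measure_biUnion_finset_le _ _)
  rw [volume_cball hz] at h1
  have h2 : ∀ v ∈ octant ⌊z⌋₊, MeasureTheory.volume (X v) ≤ ENNReal.ofReal 8 := by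
    intro v _
    rw [hX, MeasureTheory.volume_pi_pi, show (8 : ℝ) = 2 ^ 3 by norm_num,
      ENNReal.ofReal_pow (by norm_num)]
    simpa using Finset.prod_le_pow_card (s := (univ : Finset (Fin 3))) _ _ fun i _ => hIv _
  have h3 := h1.trans (Finset.sum_le_sum h2)
  rw [Finset.sum_const, nsmul_eq_mul, ← ENNReal.ofReal_natCast,
    ← ENNReal.ofReal_mul (by positivity), ENNReal.ofReal_le_ofReal_iff (by positivity)] at h3
  linarith

lemma card_octant_le {z : ℝ} (hz : 0 ≤ z) :
    (#(octant ⌊z⌋₊) : ℝ) ≤ #(octantIn ⌊z⌋₊) + 3 * (z ^ (1 / 3 : ℝ) + 1) ^ 2 := by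
  set M := ⌊z⌋₊
  set L := ⌊z ^ (1 / 3 : ℝ)⌋₊ with hL
  have hroot : ∀ n : ℕ, n ^ 3 ≤ M → n ∈ range (L + 1) := by
    intro n hn
    rw [Finset.mem_range, Nat.lt_succ_iff, hL, Nat.le_floor_iff (by positivity)]
    rw [Nat.le_floor_iff hz] at hn
    have := Real.rpow_le_rpow (z := 1 / 3) (by positivity) hn (by norm_num)
    push_cast at this
    rwa [← Real.rpow_natCast, ← Real.rpow_mul (by positivity),
      show ((3 : ℕ) : ℝ) * (1 / 3) = 1 by norm_num, Real.rpow_one] at this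
  have hsub : octant M ⊆ (octantIn M).image (fun v => (v.1 + 1, v.2.1 + 1, v.2.2 + 1)) ∪
      ((({0} : Finset ℕ) ×ˢ range (L + 1) ×ˢ range (L + 1)) ∪
      (range (L + 1) ×ˢ ({0} : Finset ℕ) ×ˢ range (L + 1)) ∪
      (range (L + 1) ×ˢ range (L + 1) ×ˢ ({0} : Finset ℕ))) := by
    rintro ⟨a, b, c⟩ h
    rw [mem_octant] at h
    simp only at h
    have ha := hroot a (by omega)
    have hb := hroot b (by omega)
    have hc := hroot c (by omega)
    simp only [Finset.mem_union, Finset.mem_product, Finset.mem_singleton, Finset.mem_image]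
    rcases Nat.eq_zero_or_pos a with h0 | h0
    · exact Or.inr (Or.inl (Or.inl ⟨h0, hb, hc⟩))
    rcases Nat.eq_zero_or_pos b with h1 | h1
    · exact Or.inr (Or.inl (Or.inr ⟨ha, h1, hc⟩))
    rcases Nat.eq_zero_or_pos c with h2 | h2
    · exact Or.inr (Or.inr ⟨ha, hb, h2⟩)
    refine Or.inl ⟨(a - 1, b - 1, c - 1), ?_, ?_⟩
    · rw [mem_octantIn]
      simp only [Nat.sub_add_cancel h0, Nat.sub_add_cancel h1, Nat.sub_add_cancel h2]
      exact h
    · simp only [Nat.sub_add_cancel h0, Nat.sub_add_cancel h1, Nat.sub_add_cancel h2]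
  have h1 : #(octant M) ≤ #(octantIn M) + 3 * (L + 1) ^ 2 := by
    refine (Finset.card_le_card hsub).trans ((Finset.card_union_le _ _).trans ?_)
    refine Nat.add_le_add Finset.card_image_le ?_
    refine (Finset.card_union_le _ _).trans ?_
    refine (Nat.add_le_add_right (Finset.card_union_le _ _) _).trans (le_of_eq ?_)
    simp only [Finset.card_product, Finset.card_singleton, Finset.card_range]
    ring
  have h2 : (L : ℝ) ≤ z ^ (1 / 3 : ℝ) := Nat.floor_le (by positivity)
  have h3 : (#(octant M) : ℝ) ≤ #(octantIn M) + 3 * (L + 1) ^ 2 := by exact_mod_cast h1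
  refine h3.trans ?_
  gcongr

lemma rthree_eq {B n : ℕ} (h : n ≤ B) : rthree n =
    #((Icc 1 B ×ˢ Icc 1 B ×ˢ Icc 1 B).filter (fun t => t.1 ^ 3 + t.2.1 ^ 3 + t.2.2 ^ 3 = n)) := by
  rw [rthree]
  apply Nat.subtype_card
  rintro ⟨a, b, c⟩
  simp only [Finset.mem_filter, Finset.mem_product, Finset.mem_Icc]
  constructor
  · tauto
  · rintro ⟨ha, hb, hc, e⟩
    have h1 := Nat.le_self_pow (n := 3) (by norm_num) a
    have h2 := Nat.le_self_pow (n := 3) (by norm_num) b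
    have h3 := Nat.le_self_pow (n := 3) (by norm_num) c
    refine ⟨⟨⟨ha, by omega⟩, ⟨hb, by omega⟩, hc, by omega⟩, e⟩

/-- Triples of positive integers counted by `A(y;k,a)`, with `B = ⌊y⌋`. -/
noncomputable def triples (B k a : ℕ) : Finset (ℕ × ℕ × ℕ) :=
  (Icc 1 B ×ˢ Icc 1 B ×ˢ Icc 1 B).filter (fun t => t.1 ^ 3 + t.2.1 ^ 3 + t.2.2 ^ 3 ≤ B ∧
    (t.1 ^ 3 + t.2.1 ^ 3 + t.2.2 ^ 3) % k = a % k)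

lemma Athree_eq_card (y : ℝ) (k a : ℕ) : Athree y k a = #(triples ⌊y⌋₊ k a) := by
  set B := ⌊y⌋₊
  have h1 : Athree y k a =
      ((∑ n ∈ (Icc 1 B).filter (fun n => n % k = a % k), rthree n : ℕ) : ℝ) := by
    rw [Athree]; push_cast; rfl
  rw [h1]; congr 1
  rw [Finset.card_eq_sum_card_fiberwise (f := fun t => t.1 ^ 3 + t.2.1 ^ 3 + t.2.2 ^ 3)
    (t := (Icc 1 B).filter (fun n => n % k = a % k))]
  · refine Finset.sum_congr rfl fun n hn => ?_
    rw [Finset.mem_filter, Finset.mem_Icc] at hn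
    rw [rthree_eq hn.1.2, triples, Finset.filter_filter]
    congr 1
    refine Finset.filter_congr fun t _ => ?_
    constructor
    · intro h; exact ⟨⟨by omega, by rw [h]; exact hn.2⟩, h⟩
    · exact fun h => h.2
  · intro t ht
    simp only [triples, Finset.coe_filter, Finset.mem_product, Finset.mem_Icc, Set.mem_ofPred_eq]
      at ht ⊢
    have h1 := Nat.one_le_pow 3 _ ht.1.1.1
    exact ⟨⟨by omega, ht.2.1⟩, ht.2.2⟩

lemma abs_Athree_sub_le {k : ℕ} (hk : 0 < k) {y : ℝ} (hy : 0 ≤ y) (a : ℕ) :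
    |Athree y k a - cG * y * rhothree k a / k ^ 3| ≤
      3 * rhothree k a * (y ^ (1 / 3 : ℝ) / k + 1) ^ 2 := by
  have hk' : (0 : ℝ) < k := by positivity
  set B := ⌊y⌋₊ with hB
  set z := y / k ^ 3 with hz
  have hz0 : 0 ≤ z := by positivity
  have hzr : z ^ (1 / 3 : ℝ) = y ^ (1 / 3 : ℝ) / k := by
    rw [hz, Real.div_rpow hy (by positivity), ← Real.rpow_natCast, ← Real.rpow_mul hk'.le]
    norm_num
  set U := (Icc 1 k ×ˢ Icc 1 k ×ˢ Icc 1 k).filter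
      (fun u => (u.1 ^ 3 + u.2.1 ^ 3 + u.2.2 ^ 3) % k = a % k) with hU
  set f : ℕ → ℕ := fun l => (l - 1) % k + 1 with hf
  set g : ℕ → ℕ := fun l => (l - 1) / k with hg
  have hfg : ∀ l, 1 ≤ l → f l + k * g l = l := by
    intro l hl
    have := Nat.mod_add_div (l - 1) k
    simp only [hf, hg]; omega
  have hfr : ∀ l, f l ∈ Icc 1 k := by
    intro l
    have := Nat.mod_lt (l - 1) hk
    simp only [hf, Finset.mem_Icc]; omega
  have hfm : ∀ l, 1 ≤ l → f l ≡ l [MOD k] := by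
    intro l hl
    conv_rhs => rw [← hfg l hl]
    simp [Nat.ModEq]
  have hfib : ∀ u ∈ U, |(#((triples B k a).filter (fun t => (f t.1, f t.2.1, f t.2.2) = u)) : ℝ)
      - cG * z| ≤ 3 * (y ^ (1 / 3 : ℝ) / k + 1) ^ 2 := by
    intro u hu
    rw [hU, Finset.mem_filter, Finset.mem_product, Finset.mem_product] at hu
    simp only [Finset.mem_Icc] at hu
    have hup : #((triples B k a).filter (fun t => (f t.1, f t.2.1, f t.2.2) = u)) ≤
        #(octant ⌊z⌋₊) := by
      refine Finset.card_le_card_of_injOn (fun t => (g t.1, g t.2.1, g t.2.2)) ?_ ?_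
      · intro t ht
        simp only [triples, Finset.coe_filter, Finset.mem_filter, Finset.mem_product,
          Finset.mem_Icc, Set.mem_ofPred_eq] at ht
        simp only [Finset.mem_coe]
        rw [mem_octant, Nat.le_floor_iff hz0, hz, le_div_iff₀ (by positivity)]
        have h1 : t.1 ^ 3 + t.2.1 ^ 3 + t.2.2 ^ 3 ≤ B := ht.1.2.1
        rw [hB, Nat.le_floor_iff hy] at h1
        refine le_trans ?_ h1
        have e : ∀ l : ℕ, 1 ≤ l → (g l * k) ≤ l := by
          intro l hl; have := hfg l hl; nlinarith
        have e1 := Nat.pow_le_pow_left (e t.1 ht.1.1.1.1) 3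
        have e2 := Nat.pow_le_pow_left (e t.2.1 ht.1.1.2.1.1) 3
        have e3 := Nat.pow_le_pow_left (e t.2.2 ht.1.1.2.2.1) 3
        rw [mul_pow] at e1 e2 e3
        norm_cast
        nlinarith
      · rintro t ht t' ht' h
        simp only [triples, Finset.coe_filter, Finset.mem_filter, Finset.mem_product,
          Finset.mem_Icc, Set.mem_ofPred_eq] at ht ht'
        have h2 := ht.2.trans ht'.2.symm
        simp only [Prod.mk.injEq] at h h2
        refine Prod.ext ?_ (Prod.ext ?_ ?_)
        · rw [← hfg t.1 ht.1.1.1.1, ← hfg t'.1 ht'.1.1.1.1, h2.1, h.1]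
        · rw [← hfg t.2.1 ht.1.1.2.1.1, ← hfg t'.2.1 ht'.1.1.2.1.1, h2.2.1, h.2.1]
        · rw [← hfg t.2.2 ht.1.1.2.2.1, ← hfg t'.2.2 ht'.1.1.2.2.1, h2.2.2, h.2.2]
    have hlo : #(octantIn ⌊z⌋₊) ≤
        #((triples B k a).filter (fun t => (f t.1, f t.2.1, f t.2.2) = u)) := by
      refine Finset.card_le_card_of_injOn
        (fun v => (u.1 + k * v.1, u.2.1 + k * v.2.1, u.2.2 + k * v.2.2)) ?_ ?_
      · intro v hv
        rw [Finset.mem_coe, mem_octantIn, Nat.le_floor_iff hz0, hz, le_div_iff₀ (by positivity)]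
          at hv
        have hv' : ((((v.1 + 1) ^ 3 + (v.2.1 + 1) ^ 3 + (v.2.2 + 1) ^ 3) * k ^ 3 : ℕ) : ℝ) ≤ y := by
          push_cast at hv ⊢; exact hv
        rw [← Nat.le_floor_iff hy, ← hB] at hv'
        have e : ∀ w l : ℕ, w ≤ k → w + k * l ≤ (l + 1) * k := by intro w l h; nlinarith
        have e1 := Nat.pow_le_pow_left (e u.1 v.1 hu.1.1.2) 3
        have e2 := Nat.pow_le_pow_left (e u.2.1 v.2.1 hu.1.2.1.2) 3
        have e3 := Nat.pow_le_pow_left (e u.2.2 v.2.2 hu.1.2.2.2) 3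
        rw [mul_pow] at e1 e2 e3
        have hs : (u.1 + k * v.1) ^ 3 + (u.2.1 + k * v.2.1) ^ 3 + (u.2.2 + k * v.2.2) ^ 3 ≤ B := by
          nlinarith
        have l1 := Nat.le_self_pow (n := 3) (by norm_num) (u.1 + k * v.1)
        have l2 := Nat.le_self_pow (n := 3) (by norm_num) (u.2.1 + k * v.2.1)
        have l3 := Nat.le_self_pow (n := 3) (by norm_num) (u.2.2 + k * v.2.2)
        have hfu : ∀ w l : ℕ, 1 ≤ w → w ≤ k → f (w + k * l) = w := by
          intro w l h1 h2
          simp only [hf]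
          rw [show w + k * l - 1 = (w - 1) + k * l by omega, Nat.add_mul_mod_self_left,
            Nat.mod_eq_of_lt (by omega)]
          omega
        simp only [triples, Finset.coe_filter, Finset.mem_filter, Finset.mem_product,
          Finset.mem_Icc, Set.mem_ofPred_eq]
        refine ⟨⟨⟨⟨by omega, by omega⟩, ⟨by omega, by omega⟩, by omega, by omega⟩, hs, ?_⟩, ?_⟩
        · rw [← hu.2]
          have m : ∀ w l : ℕ, (w + k * l) ^ 3 ≡ w ^ 3 [MOD k] := fun w l =>
            Nat.ModEq.pow 3 (by simp [Nat.ModEq])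
          exact ((m _ _).add (m _ _)).add (m _ _)
        · rw [hfu _ _ hu.1.1.1 hu.1.1.2, hfu _ _ hu.1.2.1.1 hu.1.2.1.2,
            hfu _ _ hu.1.2.2.1 hu.1.2.2.2]
      · rintro v _ v' _ h
        simp only [Prod.mk.injEq, Nat.add_left_cancel_iff, Nat.mul_right_inj hk.ne'] at h
        exact Prod.ext h.1 (Prod.ext h.2.1 h.2.2)
    have h1 := card_octantIn_le hz0
    have h2 := le_card_octant hz0
    have h3 := card_octant_le hz0
    rw [hzr] at h3
    have hup' : (#((triples B k a).filter (fun t => (f t.1, f t.2.1, f t.2.2) = u)) : ℝ) ≤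
      #(octant ⌊z⌋₊) := by exact_mod_cast hup
    have hlo' : (#(octantIn ⌊z⌋₊) : ℝ) ≤
      #((triples B k a).filter (fun t => (f t.1, f t.2.1, f t.2.2) = u)) := by exact_mod_cast hlo
    rw [abs_le]; constructor <;> linarith
  have hcard : (#(triples B k a) : ℝ) =
      ∑ u ∈ U, (#((triples B k a).filter (fun t => (f t.1, f t.2.1, f t.2.2) = u)) : ℝ) := by
    rw [← Nat.cast_sum, ← Finset.card_eq_sum_card_fiberwise]
    intro t ht
    simp only [triples, Finset.coe_filter, Finset.mem_product, Finset.mem_Icc,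
      Set.mem_ofPred_eq] at ht
    simp only [hU, Finset.coe_filter, Finset.mem_product, Set.mem_ofPred_eq]
    refine ⟨⟨hfr _, hfr _, hfr _⟩, ?_⟩
    rw [← ht.2.2]
    exact (((hfm _ ht.1.1.1).pow 3).add ((hfm _ ht.1.2.1.1).pow 3)).add ((hfm _ ht.1.2.2.1).pow 3)
  have hrho : (rhothree k a : ℝ) = #U := by rw [rhothree_eq hk]
  rw [Athree_eq_card, hcard, hrho]
  have e : cG * y * (#U : ℝ) / k ^ 3 = ∑ u ∈ U, cG * z := by
    rw [Finset.sum_const, nsmul_eq_mul, hz]; ring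
  rw [e, ← Finset.sum_sub_distrib]
  refine (Finset.abs_sum_le_sum_abs _ _).trans ((Finset.sum_le_sum hfib).trans (le_of_eq ?_))
  rw [Finset.sum_const, nsmul_eq_mul]; ring

/-- The pointwise lattice bound summed over residues. -/
lemma Wq_le_lattice {k : ℕ} (hk : 0 < k) {y : ℝ} (hy : 0 ≤ y) :
    Wq y k ≤ 9 * Hq k * k ^ 2 * (y ^ (1 / 3 : ℝ) + k) ^ 4 := by
  have hk' : (0 : ℝ) < k := by positivity
  rw [Wq_eq hk]
  have h1 : ∀ a ∈ Icc 1 k, (Athree y k a - cG * y * rhothree k a / k ^ 3) ^ 2 ≤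
      9 * (y ^ (1 / 3 : ℝ) / k + 1) ^ 4 * (rhothree k a : ℝ) ^ 2 := by
    intro a _
    refine (sq_le_sq' (abs_le.1 (abs_Athree_sub_le hk hy a)).1
      (abs_le.1 (abs_Athree_sub_le hk hy a)).2).trans (le_of_eq ?_)
    ring
  refine (mul_le_mul_of_nonneg_left (Finset.sum_le_sum h1) hk'.le).trans (le_of_eq ?_)
  rw [← Finset.mul_sum, sum_rhothree_sq hk]
  field_simp

/-- The divisor bound `d(n) ≪ n^ε`. -/
lemma card_divisors_le {ε : ℝ} (hε : 0 < ε) :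
    ∃ C : ℝ, 1 ≤ C ∧ ∀ n : ℕ, 0 < n → (#n.divisors : ℝ) ≤ C * (n : ℝ) ^ ε := by
  set P := ⌈(2 : ℝ) ^ (1 / ε)⌉₊ with hP
  set c := 1 + 1 / (ε * Real.log 2) with hc
  have hl2 : 0 < Real.log 2 := Real.log_pos (by norm_num)
  have hc1 : 1 ≤ c := by rw [hc]; have : 0 < 1 / (ε * Real.log 2) := by positivity
                         linarith
  refine ⟨c ^ P, one_le_pow₀ hc1, fun n hn => ?_⟩
  have key : ∀ p ∈ n.primeFactors, ((n.factorization p + 1 : ℕ) : ℝ) ≤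
      (if p < P then c else 1) * ((p ^ n.factorization p : ℕ) : ℝ) ^ ε := by
    intro p hp
    have hp2 : 2 ≤ p := (Nat.prime_of_mem_primeFactors hp).two_le
    have hp2' : (2 : ℝ) ≤ p := by exact_mod_cast hp2
    set a := n.factorization p
    have e1 : ((p ^ a : ℕ) : ℝ) ^ ε = ((p : ℝ) ^ ε) ^ a := by
      push_cast
      rw [← Real.rpow_natCast, ← Real.rpow_mul (by positivity), mul_comm, Real.rpow_mul
        (by positivity), Real.rpow_natCast]
    rw [e1]
    split_ifs with h
    · have h1 : 1 + a * (ε * Real.log 2) ≤ ((p : ℝ) ^ ε) ^ a := by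
        have h2 : Real.exp (a * (ε * Real.log 2)) = ((2 : ℝ) ^ ε) ^ a := by
          rw [Real.rpow_def_of_pos (by norm_num), ← Real.exp_nat_mul]; ring_nf
        have h3 := Real.add_one_le_exp (a * (ε * Real.log 2))
        have h4 : ((2 : ℝ) ^ ε) ^ a ≤ ((p : ℝ) ^ ε) ^ a := by gcongr
        linarith
      have h2 : ((a + 1 : ℕ) : ℝ) ≤ c * (1 + a * (ε * Real.log 2)) := by
        have e : c * (1 + a * (ε * Real.log 2)) =
            1 + a + (1 / (ε * Real.log 2) + a * (ε * Real.log 2)) := by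
          rw [hc]; field_simp; ring
        have : 0 ≤ 1 / (ε * Real.log 2) + a * (ε * Real.log 2) := by positivity
        rw [e]; push_cast; linarith
      exact h2.trans (mul_le_mul_of_nonneg_left h1 (by linarith))
    · rw [one_mul]
      push Not at h
      have h1 : (2 : ℝ) ^ (1 / ε) ≤ p := (Nat.le_ceil _).trans (by exact_mod_cast h)
      have h2 : (2 : ℝ) ≤ (p : ℝ) ^ ε := by
        have := Real.rpow_le_rpow (by positivity) h1 hε.le
        rwa [← Real.rpow_mul (by norm_num), one_div_mul_cancel hε.ne', Real.rpow_one] at this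
      have h3 : a + 1 ≤ 2 ^ a := Nat.lt_two_pow_self
      calc ((a + 1 : ℕ) : ℝ) ≤ (2 : ℝ) ^ a := by exact_mod_cast h3
        _ ≤ _ := by gcongr
  have h1 : (#n.divisors : ℝ) = ∏ p ∈ n.primeFactors, ((n.factorization p + 1 : ℕ) : ℝ) := by
    rw [Nat.card_divisors hn.ne']; push_cast; rfl
  have h2 : (n : ℝ) ^ ε = ∏ p ∈ n.primeFactors, ((p ^ n.factorization p : ℕ) : ℝ) ^ ε := by
    rw [Real.finsetProd_rpow _ _ (fun _ _ => by positivity)]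
    congr 1
    conv_lhs => rw [← Nat.prod_factorization_pow_eq_self hn.ne']
    rw [Finsupp.prod, Nat.support_factorization]; push_cast; rfl
  rw [h1, h2]
  refine (Finset.prod_le_prod (fun _ _ => by positivity) key).trans ?_
  rw [Finset.prod_mul_distrib]
  refine mul_le_mul_of_nonneg_right ?_ (Finset.prod_nonneg fun _ _ => by positivity)
  rw [Finset.prod_ite, Finset.prod_const, Finset.prod_const_one, mul_one]
  refine pow_le_pow_right₀ hc1 ?_
  calc #(n.primeFactors.filter (· < P)) ≤ #(range P) := Finset.card_le_card fun p hp => by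
        rw [Finset.mem_range]; exact (Finset.mem_filter.1 hp).2
    _ = P := Finset.card_range P

lemma eq_of_sum_cubes {a b a' b' : ℕ} (h1 : a + b = a' + b') (h2 : a ^ 3 + b ^ 3 = a' ^ 3 + b' ^ 3)
    (h : a ≤ b) (h' : a' ≤ b') : a = a' := by
  have aux : ∀ a b a' b' : ℕ, a + b = a' + b' → a ^ 3 + b ^ 3 = a' ^ 3 + b' ^ 3 → a' ≤ b' →
      ¬ a < a' := by
    intro a b a' b' h1 h2 h' hlt
    obtain ⟨t, ht, rfl⟩ : ∃ t, 0 < t ∧ a' = a + t := ⟨a' - a, by omega, by omega⟩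
    obtain ⟨s, rfl⟩ : ∃ s, b' = a + t + s := ⟨b' - (a + t), by omega⟩
    obtain rfl : b = a + t + s + t := by omega
    zify at h2 ht
    have : (0 : ℤ) < t * t * (2 * a + 2 * t + s) + t * s * (2 * a + 2 * t + s) := by positivity
    nlinarith
  rcases lt_trichotomy a a' with hlt | heq | hgt
  · exact absurd hlt (aux a b a' b' h1 h2 h')
  · exact heq
  · exact absurd hgt (aux a' b' a b h1.symm h2.symm h)

lemma card_two_cubes_le (B m : ℕ) (hm : 0 < m) :
    #((Icc 1 B ×ˢ Icc 1 B).filter (fun t => t.1 ^ 3 + t.2 ^ 3 = m)) ≤ 2 * #m.divisors := by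
  have h : #((Icc 1 B ×ˢ Icc 1 B).filter (fun t => t.1 ^ 3 + t.2 ^ 3 = m)) ≤
      #((univ : Finset Bool) ×ˢ m.divisors) := by
    refine Finset.card_le_card_of_injOn (fun t => (decide (t.1 ≤ t.2), t.1 + t.2)) ?_ ?_
    · rintro ⟨a, b⟩ h
      simp only [Finset.coe_filter, Set.mem_ofPred_eq] at h
      simp only [Finset.coe_product, Set.mem_prod, Finset.mem_coe, Finset.mem_univ, true_and,
        Nat.mem_divisors]
      refine ⟨?_, hm.ne'⟩
      rw [← h.2]
      exact Odd.nat_add_dvd_pow_add_pow a b (by decide)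
    · rintro ⟨a, b⟩ h ⟨a', b'⟩ h' e
      simp only [Finset.coe_filter, Set.mem_ofPred_eq] at h h'
      simp only [Prod.mk.injEq, decide_eq_decide] at e
      obtain ⟨e1, e2⟩ := e
      rcases le_total a b with hab | hab
      · have := eq_of_sum_cubes e2 (h.2.trans h'.2.symm) hab (e1.1 hab)
        simp only [Prod.mk.injEq]; omega
      · rcases le_total b' a' with h3 | h3
        · have := eq_of_sum_cubes (a := b) (b := a) (a' := b') (b' := a') (by omega)
            (by rw [add_comm, h.2, add_comm, h'.2]) hab h3
          simp only [Prod.mk.injEq]; omega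
        · have hab2 := e1.2 h3
          have := eq_of_sum_cubes e2 (h.2.trans h'.2.symm) hab2 h3
          simp only [Prod.mk.injEq]; omega
  refine h.trans (le_of_eq ?_)
  rw [Finset.card_product]; simp

lemma rthree_le {ε : ℝ} (hε : 0 < ε) :
    ∃ C : ℝ, 0 < C ∧ ∀ n : ℕ, 0 < n → (rthree n : ℝ) ≤ C * (n : ℝ) ^ (1 / 3 + ε) := by
  obtain ⟨C, hC1, hC⟩ := card_divisors_le hε
  refine ⟨2 * C, by linarith, fun n hn => ?_⟩
  set L := ⌊(n : ℝ) ^ (1 / 3 : ℝ)⌋₊ with hL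
  have hn' : (0 : ℝ) < n := by positivity
  rw [rthree_eq le_rfl, Finset.card_eq_sum_card_fiberwise (f := fun t => t.1) (t := Icc 1 L)]
  · push_cast
    have key : ∀ l ∈ Icc 1 L, (#(((Icc 1 n ×ˢ Icc 1 n ×ˢ Icc 1 n).filter
        (fun t => t.1 ^ 3 + t.2.1 ^ 3 + t.2.2 ^ 3 = n)).filter (fun t => t.1 = l)) : ℝ) ≤
        2 * C * (n : ℝ) ^ ε := by
      intro l _
      by_cases hl : l ^ 3 < n
      · have h1 : #(((Icc 1 n ×ˢ Icc 1 n ×ˢ Icc 1 n).filter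
          (fun t => t.1 ^ 3 + t.2.1 ^ 3 + t.2.2 ^ 3 = n)).filter (fun t => t.1 = l)) ≤
          #((Icc 1 n ×ˢ Icc 1 n).filter (fun t => t.1 ^ 3 + t.2 ^ 3 = n - l ^ 3)) := by
          refine Finset.card_le_card_of_injOn (fun t => t.2) ?_ ?_
          · rintro ⟨a, b, c⟩ h
            simp only [Finset.coe_filter, Finset.mem_filter, Finset.mem_product,
              Set.mem_ofPred_eq] at h ⊢
            obtain ⟨⟨h1, h2⟩, rfl⟩ := h
            exact ⟨h1.2, by omega⟩
          · rintro ⟨a, t⟩ h ⟨a', t'⟩ h' e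
            simp only [Finset.coe_filter, Finset.mem_filter, Set.mem_ofPred_eq] at h h' e
            rw [h.2, h'.2, e]
        have h2 := h1.trans (card_two_cubes_le n (n - l ^ 3) (by omega))
        have h3 := hC (n - l ^ 3) (by omega)
        have h4 : ((n - l ^ 3 : ℕ) : ℝ) ^ ε ≤ (n : ℝ) ^ ε := by
          gcongr; omega
        have h5 : (#(((Icc 1 n ×ˢ Icc 1 n ×ˢ Icc 1 n).filter
          (fun t => t.1 ^ 3 + t.2.1 ^ 3 + t.2.2 ^ 3 = n)).filter (fun t => t.1 = l)) : ℝ) ≤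
          2 * #(n - l ^ 3).divisors := by exact_mod_cast h2
        nlinarith
      · rw [Finset.filter_filter, Finset.filter_false_of_mem]
        · simp only [Finset.card_empty, Nat.cast_zero]; positivity
        · rintro ⟨a, b, c⟩ h ⟨h1, h2⟩
          simp only [Finset.mem_product, Finset.mem_Icc] at h h1 h2
          subst h2
          have := Nat.one_le_pow 3 b h.2.1.1
          omega
    refine (Finset.sum_le_sum key).trans ?_
    rw [Finset.sum_const, nsmul_eq_mul, Nat.card_Icc, Nat.add_sub_cancel, Real.rpow_add hn']
    have := Nat.floor_le (a := (n : ℝ) ^ (1 / 3 : ℝ)) (by positivity)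
    rw [← hL] at this
    calc (L : ℝ) * (2 * C * (n : ℝ) ^ ε) ≤ (n : ℝ) ^ (1 / 3 : ℝ) * (2 * C * (n : ℝ) ^ ε) := by
          gcongr
      _ = _ := by ring
  · rintro ⟨a, b, c⟩ h
    simp only [Finset.coe_filter, Finset.mem_product, Finset.mem_Icc, Set.mem_ofPred_eq,
      Finset.coe_Icc, Set.mem_Icc] at h ⊢
    refine ⟨h.1.1.1, ?_⟩
    rw [hL, Nat.le_floor_iff (by positivity)]
    have h3 : ((a : ℝ) ^ 3) ≤ n := by
      have : a ^ 3 ≤ n := by omega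
      exact_mod_cast this
    have := Real.rpow_le_rpow (z := 1 / 3) (by positivity) h3 (by norm_num)
    rwa [← Real.rpow_natCast, ← Real.rpow_mul (by positivity),
      show ((3 : ℕ) : ℝ) * (1 / 3) = 1 by norm_num, Real.rpow_one] at this

/-- The second moment `Σ_{n ≤ x} r₃(n)²`. -/
noncomputable def RR (x : ℝ) : ℝ := ∑ n ∈ Icc 1 ⌊x⌋₊, (rthree n : ℝ) ^ 2

lemma RR_nonneg (x : ℝ) : 0 ≤ RR x := Finset.sum_nonneg fun _ _ => by positivity

lemma rhothree_one (a : ℕ) : rhothree 1 a = 1 := by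
  rw [rhothree_eq one_pos]; simp [Nat.mod_one]

lemma abs_sum_rthree_sub_le {x : ℝ} (hx : 1 ≤ x) :
    |∑ n ∈ Icc 1 ⌊x⌋₊, (rthree n : ℝ) - cG * x| ≤ 12 * x ^ (2 / 3 : ℝ) := by
  have h := abs_Athree_sub_le one_pos (by linarith : 0 ≤ x) 1
  rw [rhothree_one, Athree] at h
  simp only [Nat.mod_one, Finset.filter_true, Nat.cast_one, one_pow, mul_one, div_one] at h
  refine h.trans ?_
  have h1 : 1 ≤ x ^ (1 / 3 : ℝ) := Real.one_le_rpow hx (by norm_num)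
  have h2 : x ^ (2 / 3 : ℝ) = (x ^ (1 / 3 : ℝ)) ^ 2 := by
    rw [← Real.rpow_natCast, ← Real.rpow_mul (by linarith)]; norm_num
  rw [h2]; nlinarith

lemma sum_rthree_le {x : ℝ} (hx : 1 ≤ x) :
    ∑ n ∈ Icc 1 ⌊x⌋₊, (rthree n : ℝ) ≤ (cG + 12) * x := by
  have h := (abs_le.1 (abs_sum_rthree_sub_le hx)).2
  have : x ^ (2 / 3 : ℝ) ≤ x := by
    conv_rhs => rw [← Real.rpow_one x]
    exact Real.rpow_le_rpow_of_exponent_le hx (by norm_num)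
  linarith

lemma RR_le {ε : ℝ} (hε : 0 < ε) :
    ∃ C : ℝ, 0 < C ∧ ∀ x : ℝ, 1 ≤ x → RR x ≤ C * x ^ (4 / 3 + ε) := by
  obtain ⟨C, hC, h⟩ := rthree_le hε
  have hc := cG_pos
  refine ⟨C * (cG + 12), by positivity, fun x hx => ?_⟩
  have h1 : ∀ n ∈ Icc 1 ⌊x⌋₊, (rthree n : ℝ) ^ 2 ≤ C * x ^ (1 / 3 + ε) * rthree n := by
    intro n hn
    rw [Finset.mem_Icc] at hn
    rw [sq]
    refine mul_le_mul_of_nonneg_right ((h n (by omega)).trans ?_) (Nat.cast_nonneg _)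
    have : (n : ℝ) ≤ x := (Nat.le_floor_iff (by linarith)).1 hn.2
    gcongr
  refine (Finset.sum_le_sum h1).trans ?_
  rw [← Finset.mul_sum]
  refine (mul_le_mul_of_nonneg_left (sum_rthree_le hx) (by positivity)).trans (le_of_eq ?_)
  rw [show (4 / 3 + ε : ℝ) = (1 / 3 + ε) + 1 by ring, Real.rpow_add_one (by positivity)]
  ring

lemma le_RR : ∃ c x₀ : ℝ, 0 < c ∧ 1 ≤ x₀ ∧ ∀ x : ℝ, x₀ ≤ x → c * x ≤ RR x := by
  have hc := cG_pos
  refine ⟨cG ^ 2 / 4, max 1 ((24 / cG) ^ (3 : ℝ)), by positivity, le_max_left _ _, fun x hx => ?_⟩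
  have hx1 : 1 ≤ x := (le_max_left _ _).trans hx
  have hx0 : 0 < x := by linarith
  have h1 : 24 / cG ≤ x ^ (1 / 3 : ℝ) := by
    have := Real.rpow_le_rpow (z := 1 / 3) (by positivity) ((le_max_right _ _).trans hx)
      (by norm_num)
    rwa [← Real.rpow_mul (by positivity), show (3 : ℝ) * (1 / 3) = 1 by norm_num,
      Real.rpow_one] at this
  have h2 : 12 * x ^ (2 / 3 : ℝ) ≤ cG / 2 * x := by
    have e : x = x ^ (2 / 3 : ℝ) * x ^ (1 / 3 : ℝ) := by
      rw [← Real.rpow_add hx0]; norm_num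
    rw [div_le_iff₀ hc] at h1
    have : 0 < x ^ (2 / 3 : ℝ) := by positivity
    calc 12 * x ^ (2 / 3 : ℝ) ≤ cG / 2 * (x ^ (2 / 3 : ℝ) * x ^ (1 / 3 : ℝ)) := by nlinarith
      _ = _ := by rw [← e]
  have h3 := (abs_le.1 (abs_sum_rthree_sub_le hx1)).1
  have h4 : cG / 2 * x ≤ ∑ n ∈ Icc 1 ⌊x⌋₊, (rthree n : ℝ) := by linarith
  have h5 := sq_sum_le_card_mul_sum_sq (s := Icc 1 ⌊x⌋₊) (f := fun n => (rthree n : ℝ))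
  rw [Nat.card_Icc, Nat.add_sub_cancel] at h5
  have h6 : (⌊x⌋₊ : ℝ) ≤ x := Nat.floor_le hx0.le
  have h7 : (cG / 2 * x) ^ 2 ≤ x * RR x := by
    calc (cG / 2 * x) ^ 2 ≤ (∑ n ∈ Icc 1 ⌊x⌋₊, (rthree n : ℝ)) ^ 2 := by gcongr
      _ ≤ _ := h5
      _ ≤ _ := mul_le_mul_of_nonneg_right h6 (RR_nonneg x)
  have h8 : x * (cG ^ 2 / 4 * x) ≤ x * RR x := by linarith [h7,
    show (cG / 2 * x) ^ 2 = x * (cG ^ 2 / 4 * x) by ring]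
  exact le_of_mul_le_mul_left h8 hx0

/-- Number of solutions of `u₁³ + u₂³ + u₃³ = v₁³ + v₂³ + v₃³` in a ring. -/
noncomputable def sixCard (A : Type*) [CommRing A] : ℕ :=
  Nat.card {p : (A × A × A) × (A × A × A) //
    p.1.1 ^ 3 + p.1.2.1 ^ 3 + p.1.2.2 ^ 3 = p.2.1 ^ 3 + p.2.2.1 ^ 3 + p.2.2.2 ^ 3}

lemma sixCard_congr {A B : Type*} [CommRing A] [CommRing B] (e : A ≃+* B) :
    sixCard A = sixCard B := by
  refine Nat.card_congr (Equiv.subtypeEquiv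
    (Equiv.prodCongr (Equiv.prodCongr e.toEquiv (Equiv.prodCongr e.toEquiv e.toEquiv))
      (Equiv.prodCongr e.toEquiv (Equiv.prodCongr e.toEquiv e.toEquiv))) ?_)
  rintro ⟨⟨a, b, c⟩, ⟨a', b', c'⟩⟩
  simp only [Equiv.prodCongr_apply, Prod.map_apply, RingEquiv.toEquiv_eq_coe,
    EquivLike.coe_coe, ← map_pow, ← map_add, e.injective.eq_iff]

lemma sixCard_prod (A B : Type*) [CommRing A] [CommRing B] :
    sixCard (A × B) = sixCard A * sixCard B := by
  rw [sixCard, sixCard, sixCard, ← Nat.card_prod]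
  refine Nat.card_congr
    { toFun := fun p => (⟨((p.1.1.1.1, p.1.1.2.1.1, p.1.1.2.2.1),
          (p.1.2.1.1, p.1.2.2.1.1, p.1.2.2.2.1)), ?_⟩,
        ⟨((p.1.1.1.2, p.1.1.2.1.2, p.1.1.2.2.2), (p.1.2.1.2, p.1.2.2.1.2, p.1.2.2.2.2)), ?_⟩)
      invFun := fun p => ⟨(((p.1.1.1.1, p.2.1.1.1), (p.1.1.1.2.1, p.2.1.1.2.1),
          (p.1.1.1.2.2, p.2.1.1.2.2)), ((p.1.1.2.1, p.2.1.2.1), (p.1.1.2.2.1, p.2.1.2.2.1),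
          (p.1.1.2.2.2, p.2.1.2.2.2))), ?_⟩
      left_inv := fun _ => rfl
      right_inv := fun _ => rfl }
  · exact congrArg Prod.fst p.2
  · exact congrArg Prod.snd p.2
  · exact Prod.ext p.1.2 p.2.2

lemma sum_Icc_zmod {M : Type*} [AddCommMonoid M] (q : ℕ) [NeZero q] (f : ZMod q → M) :
    ∑ a ∈ Icc 1 q, f (a : ZMod q) = ∑ z, f z := by
  rw [← Finset.sum_coe_sort (Icc 1 q) (fun a => f (a : ZMod q))]
  exact Fintype.sum_equiv (iccZMod q) _ _ fun _ => rfl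

lemma sum_rhothree_sq_eq_sixCard {q : ℕ} (hq : 0 < q) :
    ∑ a ∈ Icc 1 q, rhothree q a ^ 2 = sixCard (ZMod q) := by
  have : NeZero q := ⟨hq.ne'⟩
  have h := sum_Icc_zmod (M := ℕ) q (fun z => Nat.card {t : ZMod q × ZMod q × ZMod q //
    t.1 ^ 3 + t.2.1 ^ 3 + t.2.2 ^ 3 = z} ^ 2)
  refine Eq.trans h ?_
  simp only [sixCard, Nat.card_eq_fintype_card, Fintype.card_subtype]
  symm
  rw [Finset.card_eq_sum_card_fiberwise
    (f := fun p : (ZMod q × ZMod q × ZMod q) × (ZMod q × ZMod q × ZMod q) =>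
      p.1.1 ^ 3 + p.1.2.1 ^ 3 + p.1.2.2 ^ 3) (t := univ) (fun _ _ => Finset.mem_coe.2 (mem_univ _))]
  refine Finset.sum_congr rfl fun z _ => ?_
  rw [sq, ← Finset.card_product, Finset.filter_filter]
  congr 1
  ext ⟨t, s⟩
  simp only [Finset.mem_filter, Finset.mem_univ, true_and, Finset.mem_product]
  constructor
  · rintro ⟨h1, h2⟩; exact ⟨h2, h1 ▸ h2⟩
  · rintro ⟨h1, h2⟩; exact ⟨h1.trans h2.symm, h1⟩

lemma Hq_eq_sixCard {q : ℕ} (hq : 0 < q) : Hq q = sixCard (ZMod q) / (q : ℝ) ^ 5 := by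
  have h := sum_rhothree_sq hq
  rw [eq_div_iff (by positivity), mul_comm, ← h, ← sum_rhothree_sq_eq_sixCard hq]
  push_cast; rfl

lemma Hq_mul {m n : ℕ} (hm : 0 < m) (hn : 0 < n) (h : Nat.Coprime m n) :
    Hq (m * n) = Hq m * Hq n := by
  rw [Hq_eq_sixCard (Nat.mul_pos hm hn), Hq_eq_sixCard hm, Hq_eq_sixCard hn,
    sixCard_congr (ZMod.chineseRemainder h), sixCard_prod]
  push_cast
  rw [mul_pow, div_mul_div_comm]

noncomputable def Hf : ArithmeticFunction ℝ := ⟨Hq, by simp [Hq]⟩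
noncomputable def Jf : ArithmeticFunction ℝ := ⟨Jd, by simp [Jd]⟩

lemma Jf_apply (n : ℕ) : Jf n = Jd n := rfl

lemma Hq_one : Hq 1 = 1 := by
  simp [Hq, sg, Sthree_eq, norm_ex]

lemma Jd_one : Jd 1 = 1 := by
  have := Hq_eq_sum_divisors one_pos
  simpa [Hq_one] using this.symm

lemma isMultiplicative_Hf : Hf.IsMultiplicative := by
  refine ⟨Hq_one, fun {m n} h => ?_⟩
  rcases Nat.eq_zero_or_pos m with rfl | hm
  · simp
  rcases Nat.eq_zero_or_pos n with rfl | hn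
  · simp
  exact Hq_mul hm hn h

lemma Jf_eq : Jf = (ArithmeticFunction.moebius : ArithmeticFunction ℝ) * Hf := by
  have h : Hf = (ArithmeticFunction.zeta : ArithmeticFunction ℝ) * Jf := by
    ext n
    rcases Nat.eq_zero_or_pos n with rfl | hn
    · simp
    rw [ArithmeticFunction.coe_zeta_mul_apply]
    exact Hq_eq_sum_divisors hn
  rw [h, ← mul_assoc, ArithmeticFunction.coe_moebius_mul_coe_zeta, one_mul]

lemma isMultiplicative_Jf : Jf.IsMultiplicative := by
  rw [Jf_eq]
  exact (ArithmeticFunction.isMultiplicative_moebius.intCast).mul isMultiplicative_Hf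

lemma sum_Icc_shift {M : Type*} [AddCommGroup M] {q : ℕ} (F : ℕ → M)
    (hF : ∀ n, F (n + q) = F n) (m : ℕ) :
    ∑ u ∈ Icc 1 q, F (u + m) = ∑ u ∈ Icc 1 q, F u := by
  induction m with
  | zero => rfl
  | succ m ih =>
    rw [← ih]
    have h1 : ∀ G : ℕ → M, ∑ u ∈ Icc 1 q, G u = ∑ u ∈ range q, G (u + 1) := by
      intro G
      rw [Finset.range_eq_Ico, Finset.sum_Ico_add' G 0 q 1, Finset.Ico_add_one_right_eq_Icc]
    rw [h1, h1]
    have h2 := Finset.sum_range_succ (fun u => F (u + 1 + m)) q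
    have h3 := Finset.sum_range_succ' (fun u => F (u + 1 + m)) q
    have h4 : F (q + 1 + m) = F (0 + 1 + m) := by
      rw [show q + 1 + m = (0 + 1 + m) + q by ring, hF]
    rw [h2, h4] at h3
    have h5 := add_right_cancel h3
    rw [h5]
    exact Finset.sum_congr rfl fun u _ => by congr 1; ring

lemma sum_Icc_mul_periodic {M : Type*} [AddCommGroup M] {q : ℕ} (F : ℕ → M)
    (hF : ∀ n, F (n + q) = F n) (g : ℕ) :
    ∑ u ∈ Icc 1 (g * q), F u = g • ∑ u ∈ Icc 1 q, F u := by
  induction g with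
  | zero => simp
  | succ g ih =>
    have h1 : Icc 1 ((g + 1) * q) = Icc 1 (g * q) ∪ Ioc (g * q) (g * q + q) := by
      ext n; simp only [Finset.mem_union, Finset.mem_Icc, Finset.mem_Ioc, add_mul, one_mul]; omega
    have h2 : Disjoint (Icc 1 (g * q)) (Ioc (g * q) (g * q + q)) := by
      rw [Finset.disjoint_left]; intro n h h'
      rw [Finset.mem_Icc] at h; rw [Finset.mem_Ioc] at h'; omega
    rw [h1, Finset.sum_union h2, ih, add_smul, one_smul]
    congr 1
    rw [← sum_Icc_shift F hF (g * q)]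
    have h3 : Ioc (g * q) (g * q + q) = (Icc 1 q).map (addRightEmbedding (g * q)) := by
      rw [Finset.map_add_right_Icc]
      ext n; simp only [Finset.mem_Icc, Finset.mem_Ioc]; omega
    rw [h3, Finset.sum_map]; rfl

lemma Sthree_periodic {q : ℕ} (hq : 0 < q) {b b' : ℕ} (h : b % q = b' % q) :
    Sthree q b = Sthree q b' := by
  rw [Sthree_eq, Sthree_eq]
  refine Finset.sum_congr rfl fun u _ => ?_
  have := ex_periodic hq (u ^ 3) b b' h
  rwa [mul_comm, mul_comm (((u ^ 3 : ℕ) : ℝ))] at this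

/-- The part of the cubic sum over units vanishes at suitable prime powers. -/
lemma sum_units_eq_zero {p : ℕ} (hp : p.Prime) {q s w₀ b : ℕ} (hq : 0 < q) (hps : p ∣ s)
    (h3s : 3 * s * p = w₀ * q) (hw : Nat.Coprime w₀ p) (hs2 : q ∣ 3 * s ^ 2) (hs3 : q ∣ s ^ 3)
    (hb : Nat.Coprime b p) (hpq : p ∣ q) :
    ∑ u ∈ (Icc 1 q).filter (fun u => ¬ p ∣ u), ex (b * (u ^ 3 : ℕ) / q) = 0 := by
  have hq' : (q : ℝ) ≠ 0 := by positivity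
  have hp' : (p : ℝ) ≠ 0 := by have := hp.pos; positivity
  set F : ℕ → ℂ := fun u => if ¬ p ∣ u then ex (b * (u ^ 3 : ℕ) / q) else 0 with hF
  have hper : ∀ n, F (n + q) = F n := by
    intro n
    simp only [hF, Nat.dvd_add_left hpq]
    split_ifs with h
    · rfl
    · exact ex_periodic hq b _ _ (Nat.ModEq.pow 3 (by simp [Nat.ModEq]))
  have hsh : ∀ u w, F (u + s * w) = F u * ex (((b * u ^ 2 * w₀ : ℕ) : ℝ) * w / p) := by
    intro u w
    simp only [hF, Nat.dvd_add_left (hps.mul_right w)]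
    split_ifs with h
    · simp
    · rw [← ex_add]
      obtain ⟨A, hA⟩ := hs2
      obtain ⟨B, hB⟩ := hs3
      refine ex_eq_of_sub_eq_int (b * (u * w ^ 2 * A + w ^ 3 * B)) ?_
      have h3 : (3 : ℝ) * s * p = w₀ * q := by exact_mod_cast h3s
      have hA' : (3 : ℝ) * s ^ 2 = q * A := by exact_mod_cast hA
      have hB' : (s : ℝ) ^ 3 = q * B := by exact_mod_cast hB
      have e : (((u + s * w) ^ 3 : ℕ) : ℝ) =
          u ^ 3 + u ^ 2 * w * (3 * s) + u * w ^ 2 * (3 * s ^ 2) + w ^ 3 * s ^ 3 := by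
        push_cast; ring
      rw [e, hA', hB', show (3 : ℝ) * s = w₀ * q / p by rw [← h3]; field_simp]
      push_cast
      field_simp
      ring
  rw [Finset.sum_filter]
  change ∑ u ∈ Icc 1 q, F u = 0
  have h1 : ∀ w ∈ Icc 1 p, ∑ u ∈ Icc 1 q, F u =
      ∑ u ∈ Icc 1 q, F u * ex (((b * u ^ 2 * w₀ : ℕ) : ℝ) * w / p) := by
    intro w _
    rw [← sum_Icc_shift F hper (s * w)]
    exact Finset.sum_congr rfl fun u _ => hsh u w
  have h2 := Finset.sum_congr (rfl : Icc 1 p = Icc 1 p) h1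
  rw [Finset.sum_const, Finset.sum_comm, Nat.card_Icc, Nat.add_sub_cancel, nsmul_eq_mul] at h2
  have h3 : ∀ u ∈ Icc 1 q,
      ∑ w ∈ Icc 1 p, F u * ex (((b * u ^ 2 * w₀ : ℕ) : ℝ) * w / p) = 0 := by
    intro u _
    rw [← Finset.mul_sum]
    by_cases h : p ∣ u
    · simp [hF, h]
    · have h4 := sum_ex hp.pos ((b * u ^ 2 * w₀ : ℕ) : ℤ)
      rw [if_neg] at h4
      · rw [mul_eq_zero]; right
        rw [← h4]
        refine Finset.sum_congr rfl fun w _ => ?_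
        congr 1; push_cast; ring
      · rw [Int.natCast_dvd_natCast]
        intro h5
        rcases (Nat.Prime.dvd_mul hp).1 h5 with h6 | h6
        · rcases (Nat.Prime.dvd_mul hp).1 h6 with h7 | h7
          · exact hp.one_lt.ne' (Nat.dvd_one.1 (hb ▸ Nat.dvd_gcd h7 dvd_rfl))
          · exact h (hp.dvd_of_dvd_pow h7)
        · exact hp.one_lt.ne' (Nat.dvd_one.1 (hw ▸ Nat.dvd_gcd h6 dvd_rfl))
  rw [Finset.sum_eq_zero h3, mul_eq_zero] at h2
  exact h2.resolve_left (by exact_mod_cast hp.pos.ne')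

lemma Sthree_split {p : ℕ} (hp : 0 < p) (m b : ℕ) :
    Sthree (p * m) b =
      ∑ u ∈ (Icc 1 (p * m)).filter (fun u => ¬ p ∣ u), ex (b * (u ^ 3 : ℕ) / (p * m : ℕ)) +
      ∑ z ∈ Icc 1 m, ex (b * ((p * z) ^ 3 : ℕ) / (p * m : ℕ)) := by
  rw [Sthree_eq, ← Finset.sum_filter_add_sum_filter_not (Icc 1 (p * m)) (fun u => ¬ p ∣ u)]
  congr 1
  symm
  refine Finset.sum_bij (fun z _ => p * z) ?_ ?_ ?_ ?_
  · intro z hz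
    rw [Finset.mem_Icc] at hz
    simp only [Finset.mem_filter, Finset.mem_Icc, not_not, dvd_mul_right, and_true]
    exact ⟨Nat.mul_pos hp hz.1, Nat.mul_le_mul_left p hz.2⟩
  · intro z _ z' _ h
    exact Nat.eq_of_mul_eq_mul_left hp h
  · intro u hu
    simp only [Finset.mem_filter, Finset.mem_Icc, not_not] at hu
    obtain ⟨⟨h1, h2⟩, z, rfl⟩ := hu
    refine ⟨z, Finset.mem_Icc.2 ⟨Nat.pos_of_mul_pos_left h1, Nat.le_of_mul_le_mul_left h2 hp⟩, rfl⟩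
  · intro z _; rfl

lemma Sthree_prime_pow {p : ℕ} (hp : p.Prime) {b : ℕ} (hb : Nat.Coprime b p) (k : ℕ) :
    Sthree (p ^ (k + 3)) b = p ^ 2 * Sthree (p ^ k) b := by
  have hp0 := hp.pos
  have hp' : (p : ℝ) ≠ 0 := by positivity
  have e : p ^ (k + 3) = p * p ^ (k + 2) := by ring
  have hz : ∑ u ∈ (Icc 1 (p * p ^ (k + 2))).filter (fun u => ¬ p ∣ u),
      ex (b * (u ^ 3 : ℕ) / (p * p ^ (k + 2) : ℕ)) = 0 := by
    by_cases h3 : p = 3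
    · subst h3
      refine sum_units_eq_zero hp (s := 3 ^ (k + 1)) (w₀ := 1) (by positivity) ?_ ?_ (by norm_num)
        ?_ ?_ hb (dvd_mul_right _ _)
      · exact ⟨3 ^ k, by ring⟩
      · ring
      · exact ⟨3 ^ k, by ring⟩
      · exact ⟨3 ^ (2 * k), by ring⟩
    · refine sum_units_eq_zero hp (s := p ^ (k + 2)) (w₀ := 3) (by positivity) ?_ ?_ ?_
        ?_ ?_ hb (dvd_mul_right _ _)
      · exact ⟨p ^ (k + 1), by ring⟩
      · ring
      · exact (Nat.coprime_primes Nat.prime_three hp).2 (Ne.symm h3)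
      · exact ⟨3 * p ^ (k + 1), by ring⟩
      · exact ⟨p ^ (2 * k + 3), by ring⟩
  rw [e, Sthree_split hp0, hz, zero_add]
  have h1 : ∀ z ∈ Icc 1 (p ^ (k + 2)), ex (b * ((p * z) ^ 3 : ℕ) / (p * p ^ (k + 2) : ℕ)) =
      ex (b * (z ^ 3 : ℕ) / (p ^ k : ℕ)) := by
    intro z _; congr 1; push_cast; field_simp; ring
  rw [Finset.sum_congr rfl h1, show p ^ (k + 2) = p ^ 2 * p ^ k by ring,
    sum_Icc_mul_periodic (q := p ^ k) (fun z => ex (b * (z ^ 3 : ℕ) / (p ^ k : ℕ))), Sthree_eq,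
    nsmul_eq_mul]
  · push_cast; rfl
  · intro n
    exact ex_periodic (by positivity) b _ _ (Nat.ModEq.pow 3 (by simp [Nat.ModEq]))

lemma norm_Sthree_le (q b : ℕ) : ‖Sthree q b‖ ≤ q := by
  rw [Sthree_eq]
  refine (norm_sum_le _ _).trans ?_
  simp [norm_ex]

lemma norm_Sthree_sq_le {p : ℕ} (hp : p.Prime) {b : ℕ} (hb : Nat.Coprime b p) :
    ‖Sthree (p ^ 2) b‖ ≤ 3 * p := by
  have hp0 := hp.pos
  have hp' : (p : ℝ) ≠ 0 := by positivity
  by_cases h3 : p = 3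
  · subst h3
    refine (norm_Sthree_le _ _).trans ?_
    norm_num
  · have hz : ∑ u ∈ (Icc 1 (p * p)).filter (fun u => ¬ p ∣ u),
        ex (b * (u ^ 3 : ℕ) / (p * p : ℕ)) = 0 := by
      refine sum_units_eq_zero hp (s := p) (w₀ := 3) (by positivity) dvd_rfl ?_ ?_
        ?_ ?_ hb (dvd_mul_right _ _)
      · ring
      · exact (Nat.coprime_primes Nat.prime_three hp).2 (Ne.symm h3)
      · exact ⟨3, by ring⟩
      · exact ⟨p, by ring⟩
    rw [sq, Sthree_split hp0, hz, zero_add]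
    refine (norm_sum_le _ _).trans ?_
    have : (0 : ℝ) < p := by positivity
    simp only [norm_ex, Finset.sum_const, Nat.card_Icc, Nat.add_sub_cancel, nsmul_eq_mul, mul_one]
    linarith

lemma card_cube_roots_le {p : ℕ} [Fact p.Prime] (w : ZMod p) :
    #(univ.filter (fun z : ZMod p => z ^ 3 = w)) ≤ 3 := by
  have h := Polynomial.card_nthRoots 3 w
  refine le_trans ?_ ((Multiset.toFinset_card_le _).trans h)
  refine Finset.card_le_card fun z hz => ?_
  rw [Multiset.mem_toFinset, Polynomial.mem_nthRoots (by norm_num)]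
  exact (Finset.mem_filter.1 hz).2

lemma Sthree_eq_zmod {p : ℕ} [NeZero p] (b : ℕ) :
    Sthree p b = ∑ z : ZMod p, ex ((((b : ZMod p) * z ^ 3).val : ℕ) / p) := by
  rw [← sum_Icc_zmod, Sthree_eq]
  refine Finset.sum_congr rfl fun u _ => ?_
  have h := ex_periodic (Nat.pos_of_neZero p) 1 (b * u ^ 3)
    (((b : ZMod p) * (u : ZMod p) ^ 3).val) ?_
  · rw [Nat.cast_one, one_mul, one_mul] at h
    rw [← h]; congr 1; push_cast; ring
  · rw [← Nat.cast_pow, ← Nat.cast_mul, ZMod.val_natCast, Nat.mod_mod]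

lemma sum_norm_Sthree_sq_le {p : ℕ} [hp : Fact p.Prime] :
    ∑ c ∈ Icc 1 p, ‖Sthree p c‖ ^ 2 ≤ 9 * (p : ℝ) ^ 2 := by
  have hp0 : 0 < p := hp.out.pos
  have h1 : ((∑ c ∈ Icc 1 p, ‖Sthree p c‖ ^ 2 : ℝ) : ℂ) =
      ((∑ u ∈ Icc 1 p, ∑ v ∈ Icc 1 p,
        if (p : ℤ) ∣ (u : ℤ) ^ 3 - (v : ℤ) ^ 3 then (p : ℝ) else 0 : ℝ) : ℂ) := by
    push_cast
    have h2 : ∀ c ∈ Icc 1 p, (‖Sthree p c‖ : ℂ) ^ 2 = ∑ u ∈ Icc 1 p, ∑ v ∈ Icc 1 p,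
        ex (c * (((u : ℤ) ^ 3 - (v : ℤ) ^ 3 : ℤ) : ℝ) / p) := by
      intro c _
      rw [← Complex.mul_conj', Sthree_eq, map_sum, Finset.sum_mul_sum]
      refine Finset.sum_congr rfl fun u _ => Finset.sum_congr rfl fun v _ => ?_
      rw [conj_ex, ← ex_add]; congr 1; push_cast; ring
    rw [Finset.sum_congr rfl h2, Finset.sum_comm]
    refine Finset.sum_congr rfl fun u _ => ?_
    rw [Finset.sum_comm]
    refine Finset.sum_congr rfl fun v _ => ?_
    rw [sum_ex hp0]
    split_ifs <;> simp
  rw [Complex.ofReal_inj.1 h1]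
  have h3 : ∀ u ∈ Icc 1 p, ∑ v ∈ Icc 1 p,
      (if (p : ℤ) ∣ (u : ℤ) ^ 3 - (v : ℤ) ^ 3 then (p : ℝ) else 0) ≤ 3 * p := by
    intro u _
    have h4 : ∀ v ∈ Icc 1 p, (if (p : ℤ) ∣ (u : ℤ) ^ 3 - (v : ℤ) ^ 3 then (p : ℝ) else 0) =
        (fun z : ZMod p => if z ^ 3 = (u : ZMod p) ^ 3 then (p : ℝ) else 0) v := by
      intro v _
      simp only
      refine if_congr ?_ rfl rfl
      rw [← ZMod.intCast_zmod_eq_zero_iff_dvd]; push_cast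
      rw [sub_eq_zero, eq_comm]
    rw [Finset.sum_congr rfl h4,
      sum_Icc_zmod p (fun z : ZMod p => if z ^ 3 = (u : ZMod p) ^ 3 then (p : ℝ) else 0),
      ← Finset.sum_filter, Finset.sum_const, nsmul_eq_mul]
    gcongr
    exact_mod_cast card_cube_roots_le _
  calc _ ≤ ∑ u ∈ Icc 1 p, 3 * (p : ℝ) := Finset.sum_le_sum h3
    _ = 3 * (p : ℝ) ^ 2 := by simp; ring
    _ ≤ _ := by nlinarith [sq_nonneg (p : ℝ)]

lemma norm_Sthree_prime_sq_le {p : ℕ} (hp : p.Prime) {b : ℕ} (hb : Nat.Coprime b p) :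
    ‖Sthree p b‖ ^ 2 ≤ 54 * p := by
  have : Fact p.Prime := ⟨hp⟩
  have hb0 : (b : ZMod p) ≠ 0 := by
    intro h
    rw [ZMod.natCast_eq_zero_iff] at h
    exact hp.one_lt.ne' (Nat.dvd_one.1 (hb ▸ Nat.dvd_gcd h dvd_rfl))
  set h : ZMod p → ℝ := fun z => ‖Sthree p z.val‖ ^ 2 with hh
  have e1 : ∀ t : ZMod p, t ≠ 0 → h (b * t ^ 3) = ‖Sthree p b‖ ^ 2 := by
    intro t ht
    simp only [hh]
    congr 2
    rw [Sthree_eq_zmod, Sthree_eq_zmod, ZMod.natCast_val, ZMod.cast_id]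
    refine Fintype.sum_equiv (Equiv.mulLeft₀ t ht) _ _ fun z => ?_
    simp only [Equiv.mulLeft₀_apply, mul_pow, mul_assoc]
  have e2 : ∑ t ∈ univ.filter (fun t : ZMod p => t ≠ 0), h (b * t ^ 3) ≤ 3 * ∑ z, h z := by
    rw [← Finset.sum_fiberwise_of_maps_to (t := univ) (g := fun t : ZMod p => b * t ^ 3)
      (fun _ _ => mem_univ _), Finset.mul_sum]
    refine Finset.sum_le_sum fun z _ => ?_
    have h5 : ∀ t ∈ (univ.filter (fun t : ZMod p => t ≠ 0)).filter (fun t => b * t ^ 3 = z),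
        h (b * t ^ 3) = h z := fun t ht => by rw [(Finset.mem_filter.1 ht).2]
    rw [Finset.sum_congr rfl h5, Finset.sum_const, nsmul_eq_mul]
    have h6 : 0 ≤ h z := by positivity
    refine mul_le_mul_of_nonneg_right ?_ h6
    have h7 := card_cube_roots_le ((b : ZMod p)⁻¹ * z)
    refine le_trans (Nat.cast_le.2 (Finset.card_le_card (fun t ht => ?_))) (Nat.cast_le.2 h7)
    rw [Finset.mem_filter] at ht ⊢
    refine ⟨mem_univ _, ?_⟩
    rw [← ht.2, inv_mul_cancel_left₀ hb0]
  rw [Finset.sum_congr rfl (fun t ht => e1 t (Finset.mem_filter.1 ht).2), Finset.sum_const,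
    Finset.filter_ne' univ (0 : ZMod p), Finset.card_erase_of_mem (mem_univ _), Finset.card_univ,
    ZMod.card, nsmul_eq_mul, ← sum_Icc_zmod] at e2
  have e3 : ∑ a ∈ Icc 1 p, h a = ∑ c ∈ Icc 1 p, ‖Sthree p c‖ ^ 2 := by
    refine Finset.sum_congr rfl fun c _ => ?_
    simp only [hh]
    rw [Sthree_periodic hp.pos (b := (c : ZMod p).val) (b' := c)]
    rw [ZMod.val_natCast, Nat.mod_mod]
  rw [e3, Nat.cast_sub hp.one_le, Nat.cast_one] at e2
  have e4 := sum_norm_Sthree_sq_le (p := p)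
  have h2 : (2 : ℝ) ≤ p := by exact_mod_cast hp.two_le
  have : ((p : ℝ) / 2) * ‖Sthree p b‖ ^ 2 ≤ (p / 2) * (54 * p) := by
    nlinarith [sq_nonneg ‖Sthree p b‖]
  exact le_of_mul_le_mul_left this (by linarith)

lemma Jd_pow_succ (p k : ℕ) :
    Jd (p ^ (k + 1)) = ∑ b ∈ (Icc 1 (p ^ (k + 1))).filter (fun b => Nat.Coprime b p),
      ‖sg (p ^ (k + 1)) b‖ ^ 6 := by
  refine Finset.sum_congr (Finset.filter_congr fun b _ => ?_) fun _ _ => rfl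
  exact Nat.coprime_pow_right_iff (by omega) _ _

lemma Jd_prime_pow_le {p : ℕ} (hp : p.Prime) (k : ℕ) {B : ℝ}
    (h : ∀ b, Nat.Coprime b p → ‖Sthree (p ^ (k + 1)) b‖ ^ 6 ≤ B) :
    Jd (p ^ (k + 1)) ≤ B * ((p : ℝ) ^ (k + 1)) / ((p : ℝ) ^ (k + 1)) ^ 6 := by
  have hB : 0 ≤ B := le_trans (by positivity) (h 1 (Nat.coprime_one_left p))
  have hp0 : (0 : ℝ) < (p : ℝ) ^ (k + 1) := by have := hp.pos; positivity
  rw [Jd_pow_succ p]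
  calc _ ≤ ∑ b ∈ (Icc 1 (p ^ (k + 1))).filter (fun b => Nat.Coprime b p),
      B / ((p : ℝ) ^ (k + 1)) ^ 6 := by
        refine Finset.sum_le_sum fun b hb => ?_
        rw [sg, norm_div, div_pow, Complex.norm_natCast]
        push_cast
        gcongr
        exact h b (Finset.mem_filter.1 hb).2
    _ ≤ ∑ b ∈ Icc 1 (p ^ (k + 1)), B / ((p : ℝ) ^ (k + 1)) ^ 6 :=
        Finset.sum_le_sum_of_subset_of_nonneg (Finset.filter_subset _ _) fun _ _ _ => by positivity
    _ = _ := by simp; ring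

lemma Jd_prime_le {p : ℕ} (hp : p.Prime) : Jd p ≤ 157464 / (p : ℝ) ^ 2 := by
  have hp0 : (0 : ℝ) < p := by exact_mod_cast hp.pos
  have h := Jd_prime_pow_le hp 0 (B := (54 * p) ^ 3) (fun b hb => by
    rw [zero_add, pow_one, show 6 = 2 * 3 by rfl, pow_mul]
    exact pow_le_pow_left₀ (by positivity) (norm_Sthree_prime_sq_le hp hb) 3)
  simp only [zero_add, pow_one] at h
  refine h.trans (le_of_eq ?_)
  field_simp; norm_num

lemma Jd_prime_sq_le {p : ℕ} (hp : p.Prime) : Jd (p ^ 2) ≤ 729 / (p : ℝ) ^ 4 := by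
  have hp0 : (0 : ℝ) < p := by exact_mod_cast hp.pos
  have h := Jd_prime_pow_le hp 1 (B := (3 * p) ^ 6) (fun b hb =>
    pow_le_pow_left₀ (by positivity) (norm_Sthree_sq_le hp hb) 6)
  refine h.trans (le_of_eq ?_)
  field_simp; ring

lemma norm_sg_prime_pow {p : ℕ} (hp : p.Prime) (k : ℕ) {b : ℕ} (hb : Nat.Coprime b p) :
    ‖sg (p ^ (k + 3)) b‖ ^ 6 = ‖sg (p ^ k) b‖ ^ 6 / (p : ℝ) ^ 6 := by
  have hp0 : (0 : ℝ) < p := by exact_mod_cast hp.pos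
  rw [sg, sg, Sthree_prime_pow hp hb]
  simp only [norm_div, norm_mul, norm_pow, Complex.norm_natCast, Nat.cast_pow]
  field_simp
  ring

lemma Jd_prime_pow_add_three {p : ℕ} (hp : p.Prime) (k : ℕ) :
    Jd (p ^ (k + 4)) = Jd (p ^ (k + 1)) / (p : ℝ) ^ 3 := by
  have hp0 : (0 : ℝ) < p := by exact_mod_cast hp.pos
  rw [Jd_pow_succ p (k + 3), Jd_pow_succ p k, Finset.sum_filter, Finset.sum_filter]
  have h1 : ∀ b ∈ Icc 1 (p ^ (k + 3 + 1)),
      (if Nat.Coprime b p then ‖sg (p ^ (k + 3 + 1)) b‖ ^ 6 else 0) =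
      (fun b => if Nat.Coprime b p then ‖sg (p ^ (k + 1)) b‖ ^ 6 / (p : ℝ) ^ 6 else 0) b := by
    intro b _
    simp only
    split_ifs with h
    · exact norm_sg_prime_pow hp (k + 1) h
    · rfl
  rw [Finset.sum_congr rfl h1, show p ^ (k + 3 + 1) = p ^ 3 * p ^ (k + 1) by ring,
    sum_Icc_mul_periodic, nsmul_eq_mul]
  · rw [Finset.mul_sum, Finset.sum_div]
    refine Finset.sum_congr rfl fun b _ => ?_
    split_ifs
    · push_cast; field_simp
    · simp
  · intro n
    have e : Nat.Coprime (n + p ^ (k + 1)) p ↔ Nat.Coprime n p := by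
      rw [pow_succ]; exact Nat.coprime_add_mul_right_left n p (p ^ k)
    simp only [e, sg]
    rw [Sthree_periodic (b := n + p ^ (k + 1)) (b' := n) (by have := hp.pos; positivity) (by simp)]

lemma Jd_prime_cube {p : ℕ} (hp : p.Prime) :
    Jd (p ^ 3) = 1 / (p : ℝ) ^ 3 - 1 / (p : ℝ) ^ 4 := by
  have hp0 : (0 : ℝ) < p := by exact_mod_cast hp.pos
  rw [Jd_pow_succ p 2]
  have h1 : ∀ b ∈ (Icc 1 (p ^ (2 + 1))).filter (fun b => Nat.Coprime b p),
      ‖sg (p ^ (2 + 1)) b‖ ^ 6 = 1 / (p : ℝ) ^ 6 := by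
    intro b hb
    rw [norm_sg_prime_pow hp 0 (Finset.mem_filter.1 hb).2]
    simp [sg, Sthree_eq, norm_ex]
  rw [Finset.sum_congr rfl h1, Finset.sum_const, nsmul_eq_mul]
  have h2 : #((Icc 1 (p ^ (2 + 1))).filter (fun b => Nat.Coprime b p)) = p ^ 2 * (p - 1) := by
    have h3 := Nat.filter_coprime_Ico_eq_totient (p ^ 3) 1
    rw [Nat.totient_prime_pow hp (by norm_num)] at h3
    rw [← h3]
    congr 1
    ext b
    simp only [Finset.mem_filter, Finset.mem_Icc, Finset.mem_Ico]
    rw [Nat.coprime_pow_left_iff (by norm_num), Nat.coprime_comm]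
    constructor <;> rintro ⟨⟨h4, h5⟩, h6⟩ <;>
      exact ⟨⟨h4, by rw [show 2 + 1 = 3 from rfl] at *; omega⟩, h6⟩
  rw [h2]
  push_cast [Nat.cast_sub hp.one_le]
  field_simp

lemma cube_inj {a b : ℕ} (h : a ^ 3 = b ^ 3) : a = b := Nat.pow_left_injective (by norm_num) h

/-- The arithmetic function supported on cubes with `m³ ↦ f m`. -/
noncomputable def cubeLift (f : ArithmeticFunction ℝ) : ArithmeticFunction ℝ :=
  ⟨fun n => if h : ∃ m, m ^ 3 = n then f h.choose else 0, by
    split_ifs with h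
    · have := h.choose_spec
      rw [pow_eq_zero_iff (by norm_num)] at this
      rw [this, ArithmeticFunction.map_zero]
    · rfl⟩

lemma cubeLift_cube (f : ArithmeticFunction ℝ) (m : ℕ) : cubeLift f (m ^ 3) = f m := by
  have h : ∃ m', m' ^ 3 = m ^ 3 := ⟨m, rfl⟩
  exact (dif_pos h).trans (by rw [cube_inj h.choose_spec])

lemma cubeLift_of_not {f : ArithmeticFunction ℝ} {n : ℕ} (h : ¬ ∃ m, m ^ 3 = n) :
    cubeLift f n = 0 := dif_neg h

lemma cubeLift_mul (f h : ArithmeticFunction ℝ) :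
    cubeLift f * cubeLift h = cubeLift (f * h) := by
  ext n
  rw [ArithmeticFunction.mul_apply]
  by_cases hn : ∃ m, m ^ 3 = n
  · obtain ⟨m, rfl⟩ := hn
    rw [cubeLift_cube, ArithmeticFunction.mul_apply]
    rcases Nat.eq_zero_or_pos m with rfl | hm
    · simp
    have e : ∑ x ∈ m.divisorsAntidiagonal, f x.1 * h x.2 =
        ∑ x ∈ m.divisorsAntidiagonal.image (fun x => (x.1 ^ 3, x.2 ^ 3)),
          cubeLift f x.1 * cubeLift h x.2 := by
      rw [Finset.sum_image]
      · simp only [cubeLift_cube]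
      · rintro ⟨a, b⟩ _ ⟨c, d⟩ _ hh
        simp only [Prod.mk.injEq] at hh
        rw [cube_inj hh.1, cube_inj hh.2]
    rw [e]
    symm
    refine Finset.sum_subset ?_ ?_
    · rintro ⟨a, b⟩ hx
      rw [Finset.mem_image] at hx
      obtain ⟨⟨i, j⟩, hij, hh⟩ := hx
      rw [Nat.mem_divisorsAntidiagonal] at hij
      simp only [Prod.mk.injEq] at hh
      rw [Nat.mem_divisorsAntidiagonal, ← hh.1, ← hh.2, ← mul_pow, hij.1]
      exact ⟨rfl, by positivity⟩
    · rintro ⟨a, b⟩ hx hx'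
      by_contra hne
      rw [mul_eq_zero, not_or] at hne
      have ha : ∃ i, i ^ 3 = a := by by_contra hc; exact hne.1 (cubeLift_of_not hc)
      have hb : ∃ i, i ^ 3 = b := by by_contra hc; exact hne.2 (cubeLift_of_not hc)
      obtain ⟨i, rfl⟩ := ha
      obtain ⟨j, rfl⟩ := hb
      refine hx' (Finset.mem_image.2 ⟨(i, j), ?_, rfl⟩)
      rw [Nat.mem_divisorsAntidiagonal] at hx ⊢
      refine ⟨cube_inj ?_, hm.ne'⟩
      rw [mul_pow]; exact hx.1
  · rw [cubeLift_of_not hn]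
    refine Finset.sum_eq_zero ?_
    rintro ⟨a, b⟩ hx
    by_contra hne
    rw [mul_eq_zero, not_or] at hne
    have ha : ∃ i, i ^ 3 = a := by by_contra hc; exact hne.1 (cubeLift_of_not hc)
    have hb : ∃ i, i ^ 3 = b := by by_contra hc; exact hne.2 (cubeLift_of_not hc)
    obtain ⟨i, rfl⟩ := ha
    obtain ⟨j, rfl⟩ := hb
    rw [Nat.mem_divisorsAntidiagonal] at hx
    exact hn ⟨i * j, by rw [mul_pow]; exact hx.1⟩

lemma cubeLift_isMultiplicative {f : ArithmeticFunction ℝ} (hf : f.IsMultiplicative) :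
    (cubeLift f).IsMultiplicative := by
  refine ⟨?_, ?_⟩
  · rw [show (1 : ℕ) = 1 ^ 3 by norm_num, cubeLift_cube, hf.map_one]
  · intro a b hab
    by_cases ha : ∃ i, i ^ 3 = a
    · by_cases hb : ∃ j, j ^ 3 = b
      · obtain ⟨i, rfl⟩ := ha
        obtain ⟨j, rfl⟩ := hb
        rw [← mul_pow, cubeLift_cube, cubeLift_cube, cubeLift_cube, hf.map_mul_of_coprime]
        rwa [Nat.coprime_pow_left_iff (by norm_num), Nat.coprime_pow_right_iff (by norm_num)] at hab
      · rw [cubeLift_of_not hb, mul_zero, cubeLift_of_not]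
        rintro ⟨m, hm⟩
        obtain ⟨d, hd⟩ := exists_eq_pow_of_mul_eq_pow (a := b) (b := a) (c := m) (k := 3)
          (Nat.isUnit_iff.2 hab.symm) (by rw [mul_comm, hm])
        exact hb ⟨d, hd.symm⟩
    · rw [cubeLift_of_not ha, zero_mul, cubeLift_of_not]
      rintro ⟨m, hm⟩
      obtain ⟨d, hd⟩ := exists_eq_pow_of_mul_eq_pow (a := a) (b := b) (c := m) (k := 3)
        (Nat.isUnit_iff.2 hab) (by rw [hm])
      exact ha ⟨d, hd.symm⟩

/-- The function `m ↦ m⁻³`. -/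
noncomputable def invCube : ArithmeticFunction ℝ := ⟨fun m => ((m : ℝ) ^ 3)⁻¹, by simp⟩

lemma invCube_apply (m : ℕ) : invCube m = ((m : ℝ) ^ 3)⁻¹ := rfl

/-- The function `m ↦ μ(m) m⁻³`. -/
noncomputable def mobCube : ArithmeticFunction ℝ :=
  ⟨fun m => (ArithmeticFunction.moebius m : ℝ) * ((m : ℝ) ^ 3)⁻¹, by simp⟩

lemma mobCube_apply (m : ℕ) :
    mobCube m = (ArithmeticFunction.moebius m : ℝ) * ((m : ℝ) ^ 3)⁻¹ := rfl

lemma mobCube_isMultiplicative : mobCube.IsMultiplicative := by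
  refine ⟨by simp [mobCube_apply], fun {m n} h => ?_⟩
  rw [mobCube_apply, mobCube_apply, mobCube_apply,
    ArithmeticFunction.isMultiplicative_moebius.map_mul_of_coprime h]
  push_cast
  rw [mul_pow, mul_inv]; ring

lemma invCube_mul_mobCube : invCube * mobCube = 1 := by
  ext n
  have h := congrArg (fun f : ArithmeticFunction ℝ => f n)
    (ArithmeticFunction.coe_zeta_mul_coe_moebius (R := ℝ))
  simp only [ArithmeticFunction.mul_apply] at h ⊢
  have h2 : ∀ x ∈ n.divisorsAntidiagonal, invCube x.1 * mobCube x.2 =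
      ((n : ℝ) ^ 3)⁻¹ * (((ArithmeticFunction.zeta : ArithmeticFunction ℝ) x.1) *
        ((ArithmeticFunction.moebius : ArithmeticFunction ℝ) x.2)) := by
    rintro ⟨a, b⟩ hx
    rw [Nat.mem_divisorsAntidiagonal] at hx
    simp only at hx ⊢
    have ha : a ≠ 0 := by rintro rfl; exact hx.2 (by rw [← hx.1, zero_mul])
    rw [invCube_apply, mobCube_apply, ← hx.1]
    push_cast
    rw [mul_pow, mul_inv, ArithmeticFunction.natCoe_apply, ArithmeticFunction.zeta_apply_ne ha,
      ArithmeticFunction.intCoe_apply]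
    push_cast; ring
  rw [Finset.sum_congr rfl h2, ← Finset.mul_sum, h]
  by_cases hn : n = 1
  · subst hn; simp
  · rw [ArithmeticFunction.one_apply_ne hn, mul_zero]

lemma cubeLift_one : cubeLift 1 = 1 := by
  ext n
  by_cases hn : ∃ m, m ^ 3 = n
  · obtain ⟨m, rfl⟩ := hn
    rw [cubeLift_cube, ArithmeticFunction.one_apply, ArithmeticFunction.one_apply]
    simp [pow_eq_one_iff]
  · rw [cubeLift_of_not hn, ArithmeticFunction.one_apply_ne]
    rintro rfl; exact hn ⟨1, by norm_num⟩

/-- `J` with its cubic part removed. -/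
noncomputable def gf : ArithmeticFunction ℝ := cubeLift mobCube * Jf

lemma Jf_eq_mul_gf : Jf = cubeLift invCube * gf := by
  rw [gf, ← mul_assoc, cubeLift_mul, invCube_mul_mobCube, cubeLift_one, one_mul]

lemma gf_isMultiplicative : gf.IsMultiplicative :=
  (cubeLift_isMultiplicative mobCube_isMultiplicative).mul isMultiplicative_Jf

lemma cubeLift_prime_pow {p : ℕ} (hp : p.Prime) {i : ℕ} (hi0 : i ≠ 0) (hi : i ≠ 3) :
    cubeLift mobCube (p ^ i) = 0 := by
  by_cases h : ∃ m, m ^ 3 = p ^ i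
  · obtain ⟨m, hm⟩ := h
    rw [← hm, cubeLift_cube]
    obtain ⟨j, _, rfl⟩ := (Nat.dvd_prime_pow hp).1
      (Dvd.intro_left (m ^ 2) (by rw [← hm]; ring) : m ∣ p ^ i)
    rw [← pow_mul] at hm
    have := Nat.pow_right_injective hp.two_le hm
    rw [mobCube_apply, ArithmeticFunction.moebius_apply_prime_pow hp (by omega), if_neg (by omega)]
    simp
  · exact cubeLift_of_not h

lemma gf_prime_pow {p : ℕ} (hp : p.Prime) (k : ℕ) :
    gf (p ^ k) = Jd (p ^ k) - if 3 ≤ k then Jd (p ^ (k - 3)) / (p : ℝ) ^ 3 else 0 := by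
  rw [gf, ArithmeticFunction.mul_apply,
    Nat.sum_divisorsAntidiagonal (fun i j => cubeLift mobCube i * Jf j),
    Nat.sum_divisors_prime_pow hp]
  rw [← Finset.sum_subset (s₁ := ({0, 3} : Finset ℕ).filter (fun i => i ≤ k))]
  · rw [Finset.sum_filter, Finset.sum_pair (by norm_num)]
    have h1 : cubeLift mobCube (p ^ 0) = 1 := by
      rw [pow_zero]; exact (cubeLift_isMultiplicative mobCube_isMultiplicative).map_one
    have h3 : cubeLift mobCube (p ^ 3) = -((p : ℝ) ^ 3)⁻¹ := by
      rw [cubeLift_cube, mobCube_apply, ArithmeticFunction.moebius_apply_prime hp]; simp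
    rw [if_pos (Nat.zero_le _), h1, h3, Jf_apply, pow_zero, Nat.div_one, one_mul, sub_eq_add_neg]
    congr 1
    split_ifs with h
    · rw [Nat.pow_div h hp.pos, Jf_apply]; ring
    · simp
  · intro i hi
    rw [Finset.mem_filter] at hi
    rw [Finset.mem_range]; omega
  · intro i hi hi'
    rw [Finset.mem_range] at hi
    rw [Finset.mem_filter, not_and] at hi'
    have : i ∉ ({0, 3} : Finset ℕ) := fun h => hi' h (by omega)
    simp only [Finset.mem_insert, Finset.mem_singleton, not_or] at this
    rw [cubeLift_prime_pow hp this.1 this.2, zero_mul]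

lemma gf_prime_pow_eq_zero {p : ℕ} (hp : p.Prime) (k : ℕ) : gf (p ^ (k + 4)) = 0 := by
  rw [gf_prime_pow hp, if_pos (by omega), Jd_prime_pow_add_three hp]
  simp

lemma abs_gf_prime_pow_le {p : ℕ} (hp : p.Prime) {k : ℕ} (hk : 1 ≤ k) (hk' : k ≤ 3) :
    |gf (p ^ k)| ≤ 157464 / (p : ℝ) ^ (k + 1) := by
  have hp1 : (1 : ℝ) ≤ p := by exact_mod_cast hp.one_le
  rw [gf_prime_pow hp]
  interval_cases k
  · simpa [abs_of_nonneg (Jd_nonneg _)] using Jd_prime_le hp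
  · simp only [show ¬ 3 ≤ 2 by norm_num, if_false, sub_zero, abs_of_nonneg (Jd_nonneg _)]
    refine (Jd_prime_sq_le hp).trans ?_
    rw [div_le_div_iff₀ (by positivity) (by positivity)]
    have : (p : ℝ) ^ (2 + 1) ≤ p ^ 4 := pow_le_pow_right₀ hp1 (by norm_num)
    nlinarith [pow_pos (by linarith : (0 : ℝ) < p) 4]
  · simp only [le_refl, if_true, Nat.sub_self, pow_zero, Jd_one, Jd_prime_cube hp]
    rw [show 1 / (p : ℝ) ^ 3 - 1 / (p : ℝ) ^ 4 - 1 / (p : ℝ) ^ 3 = -(1 / (p : ℝ) ^ 4) by ring,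
      abs_neg, abs_of_nonneg (by positivity)]
    gcongr
    norm_num

/-- Convergence criterion for multiplicative functions supported on fourth-power-free numbers. -/
lemma summable_of_multiplicative {f : ℕ → ℝ} (h0 : f 0 = 0) (hnn : ∀ n, 0 ≤ f n) (h1 : f 1 = 1)
    (hm : ∀ {m n}, Nat.Coprime m n → f (m * n) = f m * f n) {B δ : ℝ} (hδ : 0 < δ)
    (hB : ∀ p : ℕ, p.Prime → ∀ k, 1 ≤ k → k ≤ 3 → f (p ^ k) ≤ B * (p : ℝ) ^ (-1 - δ))
    (hz : ∀ p : ℕ, p.Prime → ∀ k, f (p ^ (k + 4)) = 0) : Summable f := by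
  have hB0 : 0 ≤ B := by
    have h := (hnn _).trans (hB 2 Nat.prime_two 1 le_rfl (by norm_num))
    by_contra hc
    push Not at hc
    nlinarith [Real.rpow_pos_of_pos (show (0 : ℝ) < (2 : ℕ) by norm_num) (-1 - δ)]
  have hsp : ∀ {p : ℕ}, p.Prime → HasSum (fun n : ℕ => f (p ^ n)) (∑ n ∈ range 4, f (p ^ n)) := by
    intro p hp
    refine hasSum_sum_of_ne_finset_zero fun k hk => ?_
    rw [Finset.mem_range, not_lt] at hk
    obtain ⟨j, rfl⟩ := Nat.exists_eq_add_of_le hk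
    rw [add_comm]; exact hz p hp j
  have hE := fun N => EulerProduct.summable_and_hasSum_smoothNumbers_prod_primesBelow_tsum h1 hm
    (fun {p} hp => ((hsp hp).summable.congr fun n => (Real.norm_of_nonneg (hnn _)).symm)) N
  have hs : Summable (fun n : ℕ => (n : ℝ) ^ (-1 - δ)) :=
    Real.summable_nat_rpow.2 (by linarith)
  refine summable_of_sum_range_le (c := Real.exp (3 * B * ∑' n : ℕ, (n : ℝ) ^ (-1 - δ))) hnn
    fun N => ?_
  have hle : ∑ n ∈ range N, f n ≤ ∏ p ∈ N.primesBelow, ∑' n : ℕ, f (p ^ n) := by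
    have hh := (hE N).2
    have : ∑ n ∈ range N, f n = ∑ n ∈ (range N).filter (fun n => n ∈ N.smoothNumbers), f n := by
      rw [Finset.sum_filter]
      refine Finset.sum_congr rfl fun n hn => ?_
      rw [Finset.mem_range] at hn
      split_ifs with h
      · rfl
      · rcases Nat.eq_zero_or_pos n with rfl | hn0
        · exact h0
        · exact absurd (Nat.mem_smoothNumbers_of_lt hn0 hn) h
    rw [this]
    have h2 : ∑ n ∈ (range N).filter (fun n => n ∈ N.smoothNumbers), f n =
        ∑ m ∈ ((range N).filter (fun n => n ∈ N.smoothNumbers)).subtype (· ∈ N.smoothNumbers),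
          f m := by
      rw [Finset.sum_subtype_of_mem]
      intro n hn; exact (Finset.mem_filter.1 hn).2
    rw [h2]
    exact sum_le_hasSum _ (fun m _ => hnn m) hh
  refine hle.trans ?_
  have hp : ∀ p ∈ N.primesBelow, ∑' n : ℕ, f (p ^ n) ≤
      Real.exp (3 * B * (p : ℝ) ^ (-1 - δ)) := by
    intro p hp
    have hpp := Nat.prime_of_mem_primesBelow hp
    rw [(hsp hpp).tsum_eq]
    refine le_trans ?_ (Real.add_one_le_exp _)
    have e1 := hB p hpp 1 le_rfl (by norm_num)
    have e2 := hB p hpp 2 (by norm_num) (by norm_num)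
    have e3 := hB p hpp 3 (by norm_num) (by norm_num)
    simp only [Finset.sum_range_succ, Finset.sum_range_zero, pow_zero, h1]
    linarith
  refine (Finset.prod_le_prod (fun p _ => tsum_nonneg fun n => hnn _) hp).trans ?_
  rw [← Real.exp_sum, ← Finset.mul_sum]
  gcongr
  exact hs.sum_le_tsum _ fun n _ => by positivity

lemma summable_gf_rpow {a s δ : ℝ} (ha : 0 < a) (hδ : 0 < δ)
    (h1 : -2 * a + s ≤ -1 - δ) (h2 : -3 * a + 2 * s ≤ -1 - δ) (h3 : -4 * a + 3 * s ≤ -1 - δ) :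
    Summable (fun n : ℕ => |gf n| ^ a * (n : ℝ) ^ s) := by
  refine summable_of_multiplicative (δ := δ) (B := 157464 ^ a) ?_ ?_ ?_ ?_ hδ ?_ ?_
  · rw [ArithmeticFunction.map_zero, abs_zero, Real.zero_rpow ha.ne', zero_mul]
  · intro n; positivity
  · simp [gf_isMultiplicative.map_one]
  · intro m n h
    rw [gf_isMultiplicative.map_mul_of_coprime h, abs_mul, Nat.cast_mul,
      Real.mul_rpow (abs_nonneg _) (abs_nonneg _), Real.mul_rpow (Nat.cast_nonneg _)
        (Nat.cast_nonneg _)]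
    ring
  · intro p hp k hk hk'
    have hp1 : (1 : ℝ) ≤ p := by exact_mod_cast hp.one_le
    have hp0 : (0 : ℝ) < p := by linarith
    calc |gf (p ^ k)| ^ a * ((p ^ k : ℕ) : ℝ) ^ s
        ≤ (157464 / (p : ℝ) ^ (k + 1)) ^ a * ((p ^ k : ℕ) : ℝ) ^ s := by
          gcongr
          exact abs_gf_prime_pow_le hp hk hk'
      _ = 157464 ^ a * (p : ℝ) ^ (-((k : ℝ) + 1) * a + k * s) := by
          rw [Real.div_rpow (by norm_num) (by positivity), Real.rpow_add hp0, Real.rpow_mul hp0.le,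
            Real.rpow_mul hp0.le, Real.rpow_neg hp0.le, Real.inv_rpow (by positivity)]
          rw [show (k : ℝ) + 1 = ((k + 1 : ℕ) : ℝ) by push_cast; ring, Real.rpow_natCast,
            Real.rpow_natCast]
          push_cast; ring
      _ ≤ 157464 ^ a * (p : ℝ) ^ (-1 - δ) := by
          gcongr
          interval_cases k <;> push_cast <;> linarith
  · intro p hp k
    rw [gf_prime_pow_eq_zero hp, abs_zero, Real.zero_rpow ha.ne', zero_mul]

lemma summable_gf_mul_rpow {s : ℝ} (hs : s < 1) :
    Summable (fun n : ℕ => |gf n| * (n : ℝ) ^ s) := by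
  have h := summable_gf_rpow (a := 1) (s := s) (δ := 1 - s) one_pos (by linarith)
    (by linarith) (by linarith) (by linarith)
  simpa using h

lemma summable_cubeLift_invCube {s : ℝ} (hs : s < 2 / 3) :
    Summable (fun n : ℕ => cubeLift invCube n * (n : ℝ) ^ s) := by
  have hinj : Function.Injective (fun m : ℕ => m ^ 3) := fun _ _ h => cube_inj h
  rw [← hinj.summable_iff]
  · have h2 : Summable (fun m : ℕ => (m : ℝ) ^ (-3 + 3 * s)) :=
      Real.summable_nat_rpow.2 (by linarith)
    refine (summable_nat_add_iff 1).1 (((summable_nat_add_iff 1).2 h2).congr fun m => ?_)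
    simp only [Function.comp_def]
    rw [cubeLift_cube, invCube_apply, Real.rpow_add (by positivity),
      Real.rpow_mul (by positivity), Real.rpow_neg (by positivity)]
    push_cast
    norm_cast
  · intro n hn
    rw [cubeLift_of_not (by simpa using hn), zero_mul]

lemma cubeLift_invCube_nonneg (n : ℕ) : 0 ≤ cubeLift invCube n := by
  by_cases h : ∃ m, m ^ 3 = n
  · obtain ⟨m, rfl⟩ := h
    rw [cubeLift_cube, invCube_apply]; positivity
  · rw [cubeLift_of_not h]

/-- Grouping a double series according to the product of the two indices. -/
lemma hasSum_divisorsAntidiagonal {f : ℕ × ℕ → ℝ} (hf : Summable f) (h1 : ∀ n, f (0, n) = 0)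
    (h2 : ∀ n, f (n, 0) = 0) :
    HasSum (fun d : ℕ => ∑ x ∈ d.divisorsAntidiagonal, f x) (∑' x, f x) := by
  have h := hf.hasSum.tsum_fiberwise (fun x : ℕ × ℕ => x.1 * x.2)
  suffices e : (fun d : ℕ => ∑ x ∈ d.divisorsAntidiagonal, f x) =
      fun c => ∑' b : ↑((fun x : ℕ × ℕ => x.1 * x.2) ⁻¹' {c}), f b by rw [e]; exact h
  funext d
  rcases Nat.eq_zero_or_pos d with rfl | hd
  · rw [Nat.divisorsAntidiagonal_zero, Finset.sum_empty, eq_comm]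
    refine (tsum_congr fun x => ?_).trans tsum_zero
    obtain ⟨⟨a, b⟩, hx⟩ := x
    have hx' : a * b = 0 := hx
    rcases Nat.mul_eq_zero.1 hx' with rfl | rfl
    · exact h1 _
    · exact h2 _
  · have e : (fun x : ℕ × ℕ => x.1 * x.2) ⁻¹' {d} = (d.divisorsAntidiagonal : Set (ℕ × ℕ)) := by
      ext x
      simp [hd.ne']
    rw [e, Finset.tsum_subtype']

lemma hasSum_Jd_mul {F : ℕ → ℝ}
    (hF : Summable (fun x : ℕ × ℕ => cubeLift invCube x.1 * gf x.2 * F (x.1 * x.2))) :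
    HasSum (fun d => Jd d * F d)
      (∑' x : ℕ × ℕ, cubeLift invCube x.1 * gf x.2 * F (x.1 * x.2)) := by
  have h := hasSum_divisorsAntidiagonal hF (by simp) (by simp)
  suffices e : (fun d : ℕ => Jd d * F d) = fun d : ℕ => ∑ x ∈ d.divisorsAntidiagonal,
      cubeLift invCube x.1 * gf x.2 * F (x.1 * x.2) by rw [e]; exact h
  funext d
  rw [← Jf_apply, Jf_eq_mul_gf, ArithmeticFunction.mul_apply, Finset.sum_mul]
  refine Finset.sum_congr rfl fun x hx => ?_
  rw [(Nat.mem_divisorsAntidiagonal.1 hx).1]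

lemma summable_gf_double {F : ℕ → ℝ} {s C : ℝ} (hs : s < 2 / 3)
    (hF : ∀ n : ℕ, 0 < n → |F n| ≤ C * (n : ℝ) ^ s) :
    Summable (fun x : ℕ × ℕ => cubeLift invCube x.1 * gf x.2 * F (x.1 * x.2)) := by
  have h := (summable_cubeLift_invCube hs).mul_of_nonneg
    (summable_gf_mul_rpow (s := s) (by linarith))
    (fun n => mul_nonneg (cubeLift_invCube_nonneg n) (by positivity)) (fun n => by positivity)
  refine Summable.of_norm_bounded (h.mul_left C) ?_
  rintro ⟨a, b⟩
  rcases Nat.eq_zero_or_pos a with rfl | ha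
  · simp
  rcases Nat.eq_zero_or_pos b with rfl | hb
  · simp
  have h1 := hF (a * b) (Nat.mul_pos ha hb)
  rw [Nat.cast_mul, Real.mul_rpow (by positivity) (by positivity)] at h1
  simp only [norm_mul, Real.norm_eq_abs, abs_of_nonneg (cubeLift_invCube_nonneg a)]
  calc cubeLift invCube a * |gf b| * |F (a * b)|
      ≤ cubeLift invCube a * |gf b| * (C * ((a : ℝ) ^ s * (b : ℝ) ^ s)) := by
        have := cubeLift_invCube_nonneg a
        gcongr
    _ = _ := by ring

lemma summable_Jd_mul_rpow {s : ℝ} (hs : s < 2 / 3) :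
    Summable (fun d : ℕ => Jd d * (d : ℝ) ^ s) := by
  have h0 : ∀ n : ℕ, 0 < n → |(fun n : ℕ => (n : ℝ) ^ s) n| ≤ 1 * (n : ℝ) ^ s := fun n _ => by
    simp only
    rw [one_mul, abs_of_nonneg (by positivity)]
  exact (hasSum_Jd_mul (summable_gf_double hs h0)).summable

lemma summable_Jd : Summable Jd := by
  simpa using summable_Jd_mul_rpow (s := 0) (by norm_num)

lemma Hq_le_tsum (q : ℕ) : Hq q ≤ ∑' d, Jd d := by
  rcases Nat.eq_zero_or_pos q with rfl | hq
  · simpa [Hq] using tsum_nonneg Jd_nonneg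
  · rw [Hq_eq_sum_divisors hq]
    exact summable_Jd.sum_le_tsum _ fun n _ => Jd_nonneg n

lemma tsum_Jd_pos : 0 < ∑' d, Jd d :=
  lt_of_lt_of_le (by rw [Hq_one]; exact one_pos) (Hq_le_tsum 1)

lemma sqrt_sum_le {ι : Type*} (s : Finset ι) (f : ι → ℝ) (hf : ∀ i, 0 ≤ f i) :
    √(∑ i ∈ s, f i) ≤ ∑ i ∈ s, √(f i) := by
  induction s using Finset.induction_on with
  | empty => simp
  | insert a s ha ih =>
    rw [Finset.sum_insert ha, Finset.sum_insert ha]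
    refine le_trans ?_ (add_le_add_right ih _)
    rw [Real.sqrt_le_left (by positivity)]
    have h1 := Real.sq_sqrt (hf a)
    have h2 := Real.sq_sqrt (Finset.sum_nonneg fun i (_ : i ∈ s) => hf i)
    nlinarith [Real.sqrt_nonneg (f a), Real.sqrt_nonneg (∑ i ∈ s, f i),
      mul_nonneg (Real.sqrt_nonneg (f a)) (Real.sqrt_nonneg (∑ i ∈ s, f i))]

lemma summable_sqrt_Jd {δ : ℝ} (hδ : 0 < δ) :
    Summable (fun d : ℕ => √(Jd d) * (d : ℝ) ^ (-δ)) := by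
  have hu : Summable (fun n : ℕ => √(cubeLift invCube n) * (n : ℝ) ^ (-δ)) := by
    have hinj : Function.Injective (fun m : ℕ => m ^ 3) := fun _ _ h => cube_inj h
    rw [← hinj.summable_iff]
    · have h2 : Summable (fun m : ℕ => (m : ℝ) ^ (-(3 / 2 : ℝ))) :=
        Real.summable_nat_rpow.2 (by norm_num)
      refine h2.of_nonneg_of_le (fun m => by simp only [Function.comp_def]; positivity) fun m => ?_
      simp only [Function.comp_def]
      rcases Nat.eq_zero_or_pos m with rfl | hm
      · simp only [ne_eq, OfNat.ofNat_ne_zero, not_false_eq_true, zero_pow,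
          ArithmeticFunction.map_zero, Real.sqrt_zero, zero_mul]
        positivity
      have hm1 : (1 : ℝ) ≤ m := by exact_mod_cast hm
      have hm0 : (0 : ℝ) < m := by linarith
      rw [cubeLift_cube, invCube_apply, Real.sqrt_eq_rpow, ← Real.rpow_natCast,
        ← Real.rpow_neg hm0.le, ← Real.rpow_mul hm0.le]
      rw [show -((3 : ℕ) : ℝ) * (1 / 2) = -(3 / 2 : ℝ) by norm_num]
      refine mul_le_of_le_one_right (by positivity) ?_
      exact Real.rpow_le_one_of_one_le_of_nonpos (by exact_mod_cast Nat.one_le_pow _ _ hm)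
        (by linarith)
    · intro n hn
      rw [cubeLift_of_not (by simpa using hn), Real.sqrt_zero, zero_mul]
  have hg := summable_gf_rpow (a := 1 / 2) (s := -δ) (δ := min δ (1 / 2)) (by norm_num)
    (by positivity) (by linarith [min_le_left δ (1 / 2)]) (by linarith [min_le_right δ (1 / 2)])
    (by linarith [min_le_right δ (1 / 2)])
  have h := hu.mul_of_nonneg hg (fun n => by positivity) (fun n => by positivity)
  have h2 := hasSum_divisorsAntidiagonal h (by simp) (by simp)
  refine h2.summable.of_nonneg_of_le (fun n => by positivity) fun d => ?_
  rw [← Jf_apply, Jf_eq_mul_gf, ArithmeticFunction.mul_apply]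
  have h3 : √(∑ x ∈ d.divisorsAntidiagonal, cubeLift invCube x.1 * gf x.2) ≤
      ∑ x ∈ d.divisorsAntidiagonal, √(cubeLift invCube x.1 * |gf x.2|) :=
    (Real.sqrt_le_sqrt (Finset.sum_le_sum fun x _ => mul_le_mul_of_nonneg_left (le_abs_self _)
      (cubeLift_invCube_nonneg _))).trans (sqrt_sum_le _ _ fun x =>
        mul_nonneg (cubeLift_invCube_nonneg _) (abs_nonneg _))
  refine (mul_le_mul_of_nonneg_right h3 (by positivity)).trans (le_of_eq ?_)
  rw [Finset.sum_mul]
  refine Finset.sum_congr rfl fun x hx => ?_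
  rw [← (Nat.mem_divisorsAntidiagonal.1 hx).1, Nat.cast_mul,
    Real.mul_rpow (Nat.cast_nonneg _) (Nat.cast_nonneg _),
    Real.sqrt_mul (cubeLift_invCube_nonneg _), Real.sqrt_eq_rpow |gf x.2|]
  ring

lemma sum_sqrt_Jd_le {δ : ℝ} (hδ : 0 < δ) :
    ∃ C : ℝ, 0 < C ∧ ∀ D : ℕ, ∑ d ∈ Icc 1 D, √(Jd d) ≤ C * (D : ℝ) ^ δ := by
  have h := summable_sqrt_Jd hδ
  refine ⟨1 + ∑' d : ℕ, √(Jd d) * (d : ℝ) ^ (-δ), ?_, fun D => ?_⟩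
  · have : 0 ≤ ∑' d : ℕ, √(Jd d) * (d : ℝ) ^ (-δ) := tsum_nonneg fun d => by positivity
    linarith
  calc ∑ d ∈ Icc 1 D, √(Jd d) ≤ ∑ d ∈ Icc 1 D, √(Jd d) * (d : ℝ) ^ (-δ) * (D : ℝ) ^ δ := by
        refine Finset.sum_le_sum fun d hd => ?_
        rw [Finset.mem_Icc] at hd
        have hd0 : (0 : ℝ) < d := by exact_mod_cast hd.1
        rw [mul_assoc, Real.rpow_neg hd0.le, inv_mul_eq_div]
        refine le_mul_of_one_le_right (Real.sqrt_nonneg _) ?_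
        rw [one_le_div (by positivity)]
        exact Real.rpow_le_rpow hd0.le (by exact_mod_cast hd.2) hδ.le
    _ = (∑ d ∈ Icc 1 D, √(Jd d) * (d : ℝ) ^ (-δ)) * (D : ℝ) ^ δ := by rw [Finset.sum_mul]
    _ ≤ _ := by
        gcongr
        have := h.sum_le_tsum (Icc 1 D) fun n _ => by positivity
        linarith

open MeasureTheory in
/-- A Sobolev-type bound for the value of a function at the centre of an interval. -/
lemma norm_sq_le_integral {f f' : ℝ → ℂ} (hf : ∀ t, HasDerivAt f (f' t) t) (hc : Continuous f')
    (α : ℝ) {h l : ℝ} (hh : 0 < h) (hl : 0 < l) :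
    ‖f α‖ ^ 2 ≤ ∫ t in Set.Ioc (α - h) (α + h),
      ((2 * h)⁻¹ * ‖f t‖ ^ 2 + (l * ‖f t‖ ^ 2 + l⁻¹ * ‖f' t‖ ^ 2)) := by
  have hfc : Continuous f := continuous_iff_continuousAt.2 fun t => (hf t).continuousAt
  set I := Set.Ioc (α - h) (α + h) with hI
  have hfi : ∀ {g : ℝ → ℝ}, Continuous g → IntegrableOn g I := fun {g} hg =>
    (hg.integrableOn_Icc (a := α - h) (b := α + h)).mono_set Set.Ioc_subset_Icc_self
  have c1 : Continuous fun t => ‖f t‖ ^ 2 := by fun_prop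
  have c2 : Continuous fun t => l * ‖f t‖ ^ 2 + l⁻¹ * ‖f' t‖ ^ 2 := by fun_prop
  set B := ∫ t in I, (l * ‖f t‖ ^ 2 + l⁻¹ * ‖f' t‖ ^ 2) with hB
  have key : ∀ β ∈ I, ‖f α‖ ^ 2 ≤ ‖f β‖ ^ 2 + B := by
    intro β hβ
    have hd : ∀ t, HasDerivAt (fun t => f t ^ 2) (2 * f t * f' t) t := fun t =>
      ((hf t).fun_pow 2).congr_deriv (by simp)
    have e := intervalIntegral.integral_eq_sub_of_hasDerivAt (a := β) (b := α)
      (fun t _ => hd t) ((by fun_prop : Continuous fun t => 2 * f t * f' t).intervalIntegrable _ _)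
    have h1 : ‖f α ^ 2 - f β ^ 2‖ ≤ B := by
      rw [← e]
      refine (intervalIntegral.norm_integral_le_integral_norm_uIoc).trans ?_
      refine (setIntegral_mono_set (t := I) (hfi (by fun_prop)) ?_ ?_).trans ?_
      · filter_upwards with t using norm_nonneg _
      · refine Filter.Eventually.of_forall fun t ht => ?_
        have ht' : t ∈ Set.uIoc β α := ht
        rw [Set.mem_uIoc] at ht'
        rw [hI, Set.mem_Ioc] at hβ
        change t ∈ I
        rw [hI, Set.mem_Ioc]
        rcases ht' with h2 | h2 <;> constructor <;> linarith [h2.1, h2.2, hβ.1, hβ.2]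
      · refine setIntegral_mono (hfi (by fun_prop)) (hfi c2) fun t => ?_
        simp only [norm_mul, Complex.norm_ofNat]
        have h3 : (l * ‖f t‖ - ‖f' t‖) ^ 2 * l⁻¹ =
            l * ‖f t‖ ^ 2 + l⁻¹ * ‖f' t‖ ^ 2 - 2 * ‖f t‖ * ‖f' t‖ := by
          field_simp; ring
        have h4 : 0 ≤ (l * ‖f t‖ - ‖f' t‖) ^ 2 * l⁻¹ := by positivity
        linarith
    have h2 := norm_sub_norm_le (f α ^ 2) (f β ^ 2)
    rw [norm_pow, norm_pow] at h2
    linarith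
  have hv : (volume.real I) = 2 * h := by
    rw [hI, Real.volume_real_Ioc_of_le (by linarith)]; ring
  have h5 := setIntegral_mono_on (μ := volume) (s := I) (hfi continuous_const)
    (hfi (g := fun t => ‖f t‖ ^ 2 + B) (c1.add continuous_const)) measurableSet_Ioc key
  rw [integral_add (hfi c1) (hfi continuous_const), setIntegral_const, setIntegral_const, hv,
    smul_eq_mul, smul_eq_mul] at h5
  rw [integral_add (hfi (c1.const_mul _)) (hfi c2), integral_const_mul, ← hB]
  have h6 : (2 * h)⁻¹ * (2 * h * ‖f α‖ ^ 2) ≤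
      (2 * h)⁻¹ * ((∫ t in I, ‖f t‖ ^ 2) + 2 * h * B) := by gcongr
  have e1 : (2 * h)⁻¹ * (2 * h * ‖f α‖ ^ 2) = ‖f α‖ ^ 2 := by field_simp
  have e2 : (2 * h)⁻¹ * (2 * h * B) = B := by field_simp
  rwa [mul_add, e1, e2] at h6

lemma hasDerivAt_ex (n : ℕ) (t : ℝ) :
    HasDerivAt (fun t : ℝ => ex (n * t)) (2 * Real.pi * Complex.I * n * ex (n * t)) t := by
  have h1 : HasDerivAt (fun t : ℝ => 2 * Real.pi * Complex.I * n * (t : ℂ))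
      (2 * Real.pi * Complex.I * n) t := by
    simpa using (Complex.ofRealCLM.hasDerivAt (x := t)).const_mul (2 * Real.pi * Complex.I * n)
  have h2 := h1.cexp
  have e : (fun t : ℝ => ex (n * t)) =
      fun t : ℝ => Complex.exp (2 * Real.pi * Complex.I * n * (t : ℂ)) := by
    funext s; rw [ex]; congr 1; push_cast; ring
  rw [e]
  convert h2 using 1
  rw [ex, mul_comm]; congr 2; push_cast; ring

lemma continuous_ex : Continuous ex := by
  unfold ex; fun_prop

lemma integral_ex_int (k : ℤ) : ∫ t in (0 : ℝ)..2, ex (k * t) = if k = 0 then 2 else 0 := by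
  split_ifs with h
  · subst h; simp [ex_zero]
  · have hc : (2 * Real.pi * Complex.I * k : ℂ) ≠ 0 := by
      have := Complex.two_pi_I_ne_zero
      exact mul_ne_zero this (by exact_mod_cast h)
    have e : (fun t : ℝ => ex (k * t)) =
        fun t : ℝ => Complex.exp (2 * Real.pi * Complex.I * k * (t : ℂ)) := by
      funext s; rw [ex]; congr 1; push_cast; ring
    rw [e, integral_exp_mul_complex hc]
    have e1 : Complex.exp (2 * Real.pi * Complex.I * k * ((2 : ℝ) : ℂ)) = 1 := by
      have := ex_intCast (2 * k)
      rw [ex] at this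
      rw [← this]; congr 1; push_cast; ring
    rw [e1]; simp

lemma integral_norm_sq_trig (N : ℕ) (c : ℕ → ℂ) :
    ∫ t in (0 : ℝ)..2, ‖∑ n ∈ Icc 1 N, c n * ex (n * t)‖ ^ 2 = 2 * ∑ n ∈ Icc 1 N, ‖c n‖ ^ 2 := by
  have hce := continuous_ex
  rw [← Complex.ofReal_inj, ← intervalIntegral.integral_ofReal]
  have e : ∀ t : ℝ, ((‖∑ n ∈ Icc 1 N, c n * ex (n * t)‖ ^ 2 : ℝ) : ℂ) =
      ∑ m ∈ Icc 1 N, ∑ n ∈ Icc 1 N,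
        c m * (starRingEnd ℂ) (c n) * ex (((m : ℤ) - (n : ℤ) : ℤ) * t) := by
    intro t
    push_cast
    rw [← Complex.mul_conj', map_sum, Finset.sum_mul_sum]
    refine Finset.sum_congr rfl fun m _ => Finset.sum_congr rfl fun n _ => ?_
    rw [map_mul, conj_ex, sub_mul, sub_eq_add_neg ((m : ℝ) * t), ex_add]
    ring
  simp only [e]
  rw [intervalIntegral.integral_finsetSum]
  · rw [Complex.ofReal_mul, Complex.ofReal_sum, Finset.mul_sum]
    refine Finset.sum_congr rfl fun m hm => ?_
    rw [intervalIntegral.integral_finsetSum]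
    · rw [Finset.sum_eq_single m]
      · rw [intervalIntegral.integral_const_mul, integral_ex_int, if_pos (by ring),
          Complex.mul_conj']
        push_cast; ring
      · intro n _ hn
        rw [intervalIntegral.integral_const_mul, integral_ex_int, if_neg, mul_zero]
        intro h; apply hn; omega
      · intro h; exact absurd hm h
    · intro n _
      exact (by fun_prop : Continuous _).intervalIntegrable _ _
  · intro m _
    exact (by fun_prop : Continuous _).intervalIntegrable _ _

lemma one_div_sq_le_abs_sub {D d e b c : ℕ} (hd : d ∈ Icc 1 D) (he : e ∈ Icc 1 D)
    (hb : Nat.gcd b d = 1) (hc : Nat.gcd c e = 1) (hne : ¬ (d = e ∧ b = c)) :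
    1 / (D : ℝ) ^ 2 ≤ |(b : ℝ) / d - c / e| := by
  rw [Finset.mem_Icc] at hd he
  have hd0 : (0 : ℝ) < d := by exact_mod_cast hd.1
  have he0 : (0 : ℝ) < e := by exact_mod_cast he.1
  have hD0 : (0 : ℝ) < D := by exact_mod_cast hd.1.trans hd.2
  have h1 : (b : ℤ) * e - c * d ≠ 0 := by
    intro h
    have h2 : b * e = c * d := by
      have : (b : ℤ) * e = c * d := by linarith
      exact_mod_cast this
    have h3 : d ∣ e := (Nat.Coprime.symm hb).dvd_of_dvd_mul_left ⟨c, by rw [h2, mul_comm]⟩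
    have h4 : e ∣ d := (Nat.Coprime.symm hc).dvd_of_dvd_mul_left ⟨b, by rw [← h2, mul_comm]⟩
    have h5 := Nat.dvd_antisymm h3 h4
    subst h5
    exact hne ⟨rfl, Nat.eq_of_mul_eq_mul_right hd.1 h2⟩
  have h2 : (1 : ℝ) ≤ |(b : ℝ) * e - c * d| := by
    have := Int.one_le_abs h1
    exact_mod_cast this
  rw [div_sub_div _ _ hd0.ne' he0.ne', abs_div, abs_of_pos (mul_pos hd0 he0)]
  rw [mul_comm (d : ℝ) (c : ℝ)]
  apply div_le_div₀ (abs_nonneg _) h2 (mul_pos hd0 he0)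
  rw [sq]
  gcongr
  · exact_mod_cast hd.2
  · exact_mod_cast he.2

open MeasureTheory in
/-- The additive large sieve inequality for Farey fractions. -/
theorem large_sieve {x : ℝ} (hx : 1 ≤ x) {D : ℕ} (hD : 1 ≤ D) :
    ∑ d ∈ Icc 1 D, ∑ b ∈ (Icc 1 d).filter (fun b => Nat.gcd b d = 1), ‖fsum x d b‖ ^ 2 ≤
      (2 * D ^ 2 + 8 * Real.pi * x) * RR x := by
  set N := ⌊x⌋₊ with hN
  have hN1 : 1 ≤ N := Nat.one_le_floor_iff _ |>.2 hx
  have hNx : (N : ℝ) ≤ x := Nat.floor_le (by linarith)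
  have hN0 : (0 : ℝ) < N := by exact_mod_cast hN1
  have hD0 : (0 : ℝ) < D := by exact_mod_cast hD
  have hpi := Real.pi_pos
  set f : ℝ → ℂ := fun t => ∑ n ∈ Icc 1 N, (rthree n : ℂ) * ex (n * t) with hf
  set f' : ℝ → ℂ := fun t => ∑ n ∈ Icc 1 N,
    ((rthree n : ℂ) * (2 * Real.pi * Complex.I * n)) * ex (n * t) with hf'
  have hder : ∀ t, HasDerivAt f (f' t) t := by
    intro t
    have := HasDerivAt.fun_sum (u := Icc 1 N) (fun n _ =>
      (hasDerivAt_ex n t).const_mul (rthree n : ℂ))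
    refine this.congr_deriv ?_
    exact Finset.sum_congr rfl fun n _ => by ring
  have hce := continuous_ex
  have hfc : Continuous f := by fun_prop
  have hf'c : Continuous f' := by fun_prop
  set h : ℝ := 1 / (2 * D ^ 2) with hh
  have hh0 : 0 < h := by positivity
  set l : ℝ := 2 * Real.pi * N with hl
  have hl0 : 0 < l := by positivity
  set w : ℝ → ℝ := fun t => (2 * h)⁻¹ * ‖f t‖ ^ 2 + (l * ‖f t‖ ^ 2 + l⁻¹ * ‖f' t‖ ^ 2) with hw
  have hwc : Continuous w := by fun_prop
  have hw0 : ∀ t, 0 ≤ w t := fun t => by positivity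
  have hfs : ∀ d b : ℕ, fsum x d b = f ((b : ℝ) / d) := by
    intro d b
    rw [fsum, hf]
    refine Finset.sum_congr rfl fun n _ => ?_
    congr 2; ring
  rw [Finset.sum_sigma' (Icc 1 D) (fun d => (Icc 1 d).filter (fun b => Nat.gcd b d = 1))
    (fun d b => ‖fsum x d b‖ ^ 2)]
  set S := (Icc 1 D).sigma (fun d => (Icc 1 d).filter (fun b => Nat.gcd b d = 1)) with hS
  let I : (Σ _ : ℕ, ℕ) → Set ℝ := fun p => Set.Ioc ((p.2 : ℝ) / p.1 - h) ((p.2 : ℝ) / p.1 + h)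
  have hfi : ∀ p, IntegrableOn w (I p) := fun p =>
    (hwc.integrableOn_Icc).mono_set Set.Ioc_subset_Icc_self
  have h1 : ∑ p ∈ S, ‖fsum x p.1 p.2‖ ^ 2 ≤ ∑ p ∈ S, ∫ t in I p, w t := by
    refine Finset.sum_le_sum fun p _ => ?_
    rw [hfs]
    exact norm_sq_le_integral hder hf'c _ hh0 hl0
  have hdisj : Set.Pairwise (↑S) (Function.onFun Disjoint I) := by
    intro p hp q hq hne
    rw [Finset.mem_coe, hS, Finset.mem_sigma, Finset.mem_filter] at hp hq
    have h2 := one_div_sq_le_abs_sub hp.1 hq.1 hp.2.2 hq.2.2 (by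
      rintro ⟨e1, e2⟩
      exact hne (Sigma.ext e1 (heq_of_eq e2)))
    rw [Function.onFun, Set.disjoint_left]
    intro t ht1 ht2
    have h3 : |(p.2 : ℝ) / p.1 - q.2 / q.1| < 2 * h := by
      rw [abs_lt]; constructor <;> linarith [ht1.1, ht1.2, ht2.1, ht2.2]
    have h4 : 2 * h = 1 / (D : ℝ) ^ 2 := by rw [hh]; field_simp
    linarith
  have hsub : (⋃ p ∈ S, I p) ⊆ Set.Ioc 0 2 := by
    intro t ht
    simp only [Set.mem_iUnion] at ht
    obtain ⟨p, hp, ht⟩ := ht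
    rw [hS, Finset.mem_sigma, Finset.mem_filter, Finset.mem_Icc, Finset.mem_Icc] at hp
    obtain ⟨⟨hp1, hp2⟩, ⟨hp3, hp4⟩, -⟩ := hp
    have hp0 : (0 : ℝ) < p.1 := by exact_mod_cast hp1
    have a1 : h ≤ 1 / 2 * (1 / D) := by
      rw [hh, ← one_div_mul_one_div]
      gcongr
      have : (1 : ℝ) ≤ D := by exact_mod_cast hD
      nlinarith
    have a2 : (1 : ℝ) / D ≤ p.2 / p.1 := by
      apply div_le_div₀ (by positivity) (by exact_mod_cast hp3) hp0 (by exact_mod_cast hp2)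
    have a3 : (p.2 : ℝ) / p.1 ≤ 1 := div_le_one_of_le₀ (by exact_mod_cast hp4) hp0.le
    have a4 : (0 : ℝ) < 1 / D := by positivity
    constructor <;> linarith [ht.1, ht.2]
  have h2 : ∑ p ∈ S, ∫ t in I p, w t ≤ ∫ t in (0 : ℝ)..2, w t := by
    rw [← integral_biUnion_finset S (fun _ _ => measurableSet_Ioc) hdisj (fun p _ => hfi p),
      intervalIntegral.integral_of_le (by norm_num)]
    refine setIntegral_mono_set ((hwc.integrableOn_Icc (a := 0) (b := 2)).mono_set
      Set.Ioc_subset_Icc_self) ?_ (LE.le.eventuallyLE hsub)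
    filter_upwards with t using hw0 t
  have hP1 : ∫ t in (0 : ℝ)..2, ‖f t‖ ^ 2 = 2 * RR x := by
    rw [hf, integral_norm_sq_trig, RR]; simp [hN]
  have hP2 : ∫ t in (0 : ℝ)..2, ‖f' t‖ ^ 2 ≤ 2 * (l ^ 2 * RR x) := by
    rw [hf', integral_norm_sq_trig, RR, ← hN]
    refine mul_le_mul_of_nonneg_left ?_ zero_le_two
    rw [Finset.mul_sum]
    refine Finset.sum_le_sum fun n hn => ?_
    rw [← mul_pow]
    gcongr
    rw [norm_mul, mul_comm]
    simp only [norm_mul, Complex.norm_ofNat, Complex.norm_natCast, Complex.norm_I,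
      Complex.norm_real, Real.norm_eq_abs, abs_of_pos hpi, mul_one]
    rw [hl]
    gcongr
    exact (Finset.mem_Icc.1 hn).2
  have h3 : ∫ t in (0 : ℝ)..2, w t = (2 * h)⁻¹ * (∫ t in (0 : ℝ)..2, ‖f t‖ ^ 2) +
      (l * (∫ t in (0 : ℝ)..2, ‖f t‖ ^ 2) + l⁻¹ * ∫ t in (0 : ℝ)..2, ‖f' t‖ ^ 2) := by
    have i1 : Continuous fun t => ‖f t‖ ^ 2 := by fun_prop
    have i2 : Continuous fun t => ‖f' t‖ ^ 2 := by fun_prop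
    rw [hw, intervalIntegral.integral_add, intervalIntegral.integral_add,
      intervalIntegral.integral_const_mul, intervalIntegral.integral_const_mul,
      intervalIntegral.integral_const_mul]
    all_goals exact (by fun_prop : Continuous _).intervalIntegrable _ _
  have hR := RR_nonneg x
  have h4 : l⁻¹ * (2 * (l ^ 2 * RR x)) = 2 * l * RR x := by field_simp
  have h5 : (2 * h)⁻¹ = (D : ℝ) ^ 2 := by rw [hh]; field_simp
  calc _ ≤ _ := h1
    _ ≤ _ := h2
    _ ≤ (D : ℝ) ^ 2 * (2 * RR x) + (l * (2 * RR x) + 2 * l * RR x) := by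
      rw [h3, h5, hP1, ← h4]
      gcongr
    _ = (2 * D ^ 2 + 8 * Real.pi * N) * RR x := by rw [hl]; ring
    _ ≤ _ := by gcongr

lemma card_filter_mod_le (q N a : ℕ) :
    #((Icc 1 N).filter (fun n => n % q = a % q)) ≤ N / q + 1 := by
  rw [← Finset.card_range (N / q + 1)]
  refine Finset.card_le_card_of_injOn (fun n => n / q) ?_ ?_
  · intro n hn
    rw [Finset.mem_coe, Finset.mem_filter, Finset.mem_Icc] at hn
    simp only [Finset.coe_range, Set.mem_Iio]
    exact Nat.lt_succ_of_le (Nat.div_le_div_right hn.1.2)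
  · intro m hm n hn h
    rw [Finset.mem_coe, Finset.mem_filter] at hm hn
    dsimp only at h
    rw [← Nat.div_add_mod m q, ← Nat.div_add_mod n q, h, hm.2, hn.2]

/-- The trivial bound for one modulus. -/
lemma sum_norm_fsum_sq_le {x : ℝ} (hx : 0 ≤ x) {q : ℕ} (hq : 0 < q) :
    ∑ b ∈ Icc 1 q, ‖fsum x q b‖ ^ 2 ≤ (x + q) * RR x := by
  have hq0 : (0 : ℝ) < q := by exact_mod_cast hq
  simp only [fsum_eq hq]
  rw [sum_norm_hat_sq hq]
  have h1 : ∀ a ∈ Icc 1 q, Athree x q a ^ 2 ≤ (x / q + 1) *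
      ∑ n ∈ (Icc 1 ⌊x⌋₊).filter (fun n => n % q = a % q), (rthree n : ℝ) ^ 2 := by
    intro a _
    rw [Athree]
    refine sq_sum_le_card_mul_sum_sq.trans ?_
    gcongr
    have h2 := card_filter_mod_le q ⌊x⌋₊ a
    have h3 : ((⌊x⌋₊ / q : ℕ) : ℝ) ≤ x / q :=
      Nat.cast_div_le.trans (by gcongr; exact Nat.floor_le hx)
    calc _ ≤ ((⌊x⌋₊ / q + 1 : ℕ) : ℝ) := by exact_mod_cast h2
      _ ≤ _ := by push_cast; linarith
  calc _ ≤ q * ∑ a ∈ Icc 1 q, (x / q + 1) *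
      ∑ n ∈ (Icc 1 ⌊x⌋₊).filter (fun n => n % q = a % q), (rthree n : ℝ) ^ 2 := by
        gcongr with a ha; exact h1 a ha
    _ = (x + q) * RR x := by
      rw [← Finset.mul_sum, ← sum_residue hq, RR, ← mul_assoc]
      congr 1; field_simp

lemma Wc_le_sum_fsum {x : ℝ} (hx : 0 ≤ x) (d : ℕ) :
    Wc x d ≤ 2 * (∑ b ∈ (Icc 1 d).filter (fun b => Nat.gcd b d = 1), ‖fsum x d b‖ ^ 2) +
      2 * cG ^ 2 * x ^ 2 * Jd d := by
  have h1 : Wc x d ≤ ∑ b ∈ (Icc 1 d).filter (fun b => Nat.gcd b d = 1),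
      (2 * ‖fsum x d b‖ ^ 2 + 2 * cG ^ 2 * x ^ 2 * ‖sg d b‖ ^ 6) := by
    refine Finset.sum_le_sum fun b _ => ?_
    have h2 : ‖Dl x d b‖ ≤ ‖fsum x d b‖ + cG * x * ‖sg d b‖ ^ 3 := by
      rw [Dl]
      refine (norm_sub_le _ _).trans_eq ?_
      rw [norm_mul, norm_pow, Complex.norm_real, Real.norm_of_nonneg (mul_nonneg cG_pos.le hx)]
    calc ‖Dl x d b‖ ^ 2 ≤ (‖fsum x d b‖ + cG * x * ‖sg d b‖ ^ 3) ^ 2 := by gcongr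
      _ ≤ 2 * ‖fsum x d b‖ ^ 2 + 2 * (cG * x * ‖sg d b‖ ^ 3) ^ 2 := by
        nlinarith [sq_nonneg (‖fsum x d b‖ - cG * x * ‖sg d b‖ ^ 3)]
      _ = _ := by ring
  refine h1.trans ?_
  rw [Finset.sum_add_distrib, ← Finset.mul_sum, ← Finset.mul_sum, ← Jd]

lemma Wc_le_trivial {x : ℝ} (hx : 0 ≤ x) {d : ℕ} (hd : 0 < d) :
    Wc x d ≤ 2 * (x + d) * RR x + 2 * cG ^ 2 * x ^ 2 * Jd d := by
  refine (Wc_le_sum_fsum hx d).trans ?_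
  rw [mul_assoc 2 (x + d)]
  gcongr
  refine le_trans ?_ (sum_norm_fsum_sq_le hx hd)
  exact Finset.sum_le_sum_of_subset_of_nonneg (Finset.filter_subset _ _)
    fun _ _ _ => by positivity

/-- Harmonic sums, as real numbers. -/
noncomputable def harm (M : ℕ) : ℝ := ∑ m ∈ Icc 1 M, (m : ℝ)⁻¹

lemma harm_succ (M : ℕ) : harm (M + 1) = harm M + ((M : ℝ) + 1)⁻¹ := by
  rw [harm, Finset.sum_Icc_succ_top (by omega), harm]; push_cast; rfl

lemma harm_eq (M : ℕ) : harm M = (harmonic M : ℝ) := by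
  rw [harmonic_eq_sum_Icc, harm]; push_cast; rfl

local notation "γ" => Real.eulerMascheroniConstant

lemma log_one_add_inv_le {M : ℝ} (hM : 0 < M) :
    Real.log (M + 1) - Real.log M ≤ (M⁻¹ + (M + 1)⁻¹) / 2 := by
  have h1 : 0 ≤ Real.log ((M + 1) / M) := Real.log_nonneg (by rw [le_div_iff₀ hM]; linarith)
  have h2 := Real.self_le_sinh_iff.2 h1
  rw [Real.sinh_log (by positivity), Real.log_div (by positivity) hM.ne'] at h2
  refine h2.trans_eq ?_
  field_simp; ring

lemma inv_le_log_sub {M : ℝ} (hM : 1 ≤ M) :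
    M⁻¹ ≤ Real.log (M + 1 / 2) - Real.log (M - 1 / 2) := by
  have h0 : 0 < M := by linarith
  set z := 1 / (2 * M) with hz
  have hz0 : 0 < z := by positivity
  have hz1 : z < 1 := by rw [hz, div_lt_one (by positivity)]; linarith
  have h1 := Real.hasSum_log_sub_log_of_abs_lt_one (x := z) (by rw [abs_of_pos hz0]; exact hz1)
  have h2 := le_hasSum h1 0 (fun k _ => by positivity)
  have e1 : Real.log (M + 1 / 2) = Real.log M + Real.log (1 + z) := by
    rw [← Real.log_mul h0.ne' (by positivity)]
    congr 1; rw [hz]; field_simp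
  have e2 : Real.log (M - 1 / 2) = Real.log M + Real.log (1 - z) := by
    rw [← Real.log_mul h0.ne' (by linarith)]
    congr 1; rw [hz]; field_simp
  have e3 : M⁻¹ = 2 * z := by rw [hz]; field_simp
  simp at h2
  rw [e1, e2, e3]; linarith

lemma tendsto_harm_sub_log :
    Filter.Tendsto (fun n : ℕ => harm n - Real.log n) Filter.atTop (nhds γ) := by
  have := Real.tendsto_harmonic_sub_log
  simpa only [harm_eq] using this

lemma harm_le {M : ℕ} (hM : 1 ≤ M) : harm M ≤ Real.log M + γ + 1 / (2 * M) := by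
  have hmono : ∀ n, M ≤ n → harm M - Real.log M - 1 / (2 * M) ≤
      harm n - Real.log n - 1 / (2 * n) := by
    intro n hn
    induction n, hn using Nat.le_induction with
    | base => exact le_rfl
    | succ n hn ih =>
      refine ih.trans ?_
      have hn0 : (0 : ℝ) < n := by exact_mod_cast hM.trans hn
      have h1 := log_one_add_inv_le hn0
      rw [harm_succ]; push_cast
      have e1 : 1 / (2 * (n : ℝ)) = (n : ℝ)⁻¹ / 2 := by field_simp
      have e2 : 1 / (2 * ((n : ℝ) + 1)) = ((n : ℝ) + 1)⁻¹ / 2 := by field_simp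
      rw [e1, e2]; linarith
  have hlim : Filter.Tendsto (fun n : ℕ => harm n - Real.log n - 1 / (2 * n)) Filter.atTop
      (nhds (γ - 0)) := by
    refine tendsto_harm_sub_log.sub ?_
    have := (tendsto_one_div_atTop_nhds_zero_nat (𝕜 := ℝ)).const_mul (1 / 2)
    rw [mul_zero] at this
    refine this.congr fun n => ?_
    rw [one_div_mul_one_div]
  have h2 := ge_of_tendsto hlim (Filter.eventually_atTop.2 ⟨M, hmono⟩)
  linarith

lemma le_harm (M : ℕ) : Real.log (M + 1 / 2) + γ ≤ harm M := by
  have hanti : ∀ n, M ≤ n → harm n - Real.log (n + 1 / 2) ≤ harm M - Real.log (M + 1 / 2) := by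
    intro n hn
    induction n, hn using Nat.le_induction with
    | base => exact le_rfl
    | succ n hn ih =>
      refine le_trans ?_ ih
      have h1 := inv_le_log_sub (M := n + 1) (by linarith [Nat.cast_nonneg (α := ℝ) n])
      rw [show (n : ℝ) + 1 - 1 / 2 = n + 1 / 2 by ring] at h1
      rw [harm_succ]; push_cast
      linarith
  have hlim : Filter.Tendsto (fun n : ℕ => harm n - Real.log (n + 1)) Filter.atTop (nhds γ) := by
    have := Real.tendsto_harmonic_sub_log_add_one
    simpa only [harm_eq] using this
  have h2 := le_of_tendsto hlim (Filter.eventually_atTop.2 ⟨M, fun n hn =>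
    (sub_le_sub_left (Real.log_le_log (by positivity) (by linarith)) _).trans (hanti n hn)⟩)
  linarith

/-- Half the derivative of `psiH`. -/
noncomputable def kapH (Y : ℝ) : ℝ :=
  Y * (harm ⌊Y⌋₊ - Real.log Y - γ) + Y - ⌊Y⌋₊ - 1 / 2

lemma abs_kapH_le_one {Y : ℝ} (h0 : 0 < Y) (h1 : Y < 1) : |kapH Y| ≤ 1 := by
  have hf : ⌊Y⌋₊ = 0 := Nat.floor_eq_zero.2 h1
  have hl : Real.log Y ≤ 0 := Real.log_nonpos h0.le h1.le
  have hl2 : 1 - Y⁻¹ ≤ Real.log Y := Real.one_sub_inv_le_log_of_pos h0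
  have hl3 : Y - 1 ≤ Y * Real.log Y := by
    calc Y - 1 = Y * (1 - Y⁻¹) := by field_simp
      _ ≤ _ := by gcongr
  have g1 := Real.one_half_lt_eulerMascheroniConstant
  have g2 := Real.eulerMascheroniConstant_lt_two_thirds
  have e : kapH Y = -(Y * Real.log Y) + (1 - γ) * Y - 1 / 2 := by
    rw [kapH, hf]; simp [harm]; ring
  have hl4 : Y * Real.log Y ≤ 0 := mul_nonpos_of_nonneg_of_nonpos h0.le hl
  have p1 : 0 ≤ (1 - γ) * Y := mul_nonneg (by linarith) h0.le
  have p2 : (1 - γ) * Y ≤ Y := by nlinarith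
  rw [e, abs_le]; constructor <;> linarith

lemma abs_kapH_le_inv {Y : ℝ} (h1 : 1 ≤ Y) : |kapH Y| ≤ Y⁻¹ := by
  set M := ⌊Y⌋₊ with hM
  have hM1 : 1 ≤ M := (Nat.one_le_floor_iff Y).2 h1
  have hM1' : (1 : ℝ) ≤ M := by exact_mod_cast hM1
  have h0 : 0 < Y := by linarith
  have hM0 : (0 : ℝ) < M := by linarith
  have a1 : (M : ℝ) ≤ Y := Nat.floor_le h0.le
  have a2 : Y < M + 1 := Nat.lt_floor_add_one Y
  have hYM : 1 / (2 * (M : ℝ)) ≤ Y⁻¹ := by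
    rw [one_div]; gcongr; linarith
  have hb := harm_le hM1
  have hl := le_harm M
  rw [abs_le]; constructor
  · have h2 : 1 - Y / (M + 1 / 2) ≤ Real.log (M + 1 / 2) - Real.log Y := by
      rw [← Real.log_div (by positivity) h0.ne']
      refine le_trans ?_ (Real.one_sub_inv_le_log_of_pos (by positivity))
      rw [inv_div]
    have h3 : Y * (1 - Y / (M + 1 / 2)) ≤ Y * (harm M - Real.log Y - γ) := by
      apply mul_le_mul_of_nonneg_left _ h0.le; linarith
    have h4 : Y * (1 - Y / (M + 1 / 2)) + Y - M - 1 / 2 =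
        -((Y - M - 1 / 2) ^ 2 / (M + 1 / 2)) := by field_simp; ring
    have h5 : (Y - M - 1 / 2) ^ 2 / (M + 1 / 2) ≤ 1 / (2 * M) := by
      have h6 : (Y - M - 1 / 2) ^ 2 ≤ 1 / 4 := by nlinarith
      have h7 : 1 / (2 * (M : ℝ)) = (1 / 2) / M := by field_simp
      rw [h7]
      apply div_le_div₀ <;> linarith
    rw [kapH, ← hM]; linarith
  · have h2 : Real.log M - Real.log Y ≤ M / Y - 1 := by
      rw [← Real.log_div hM0.ne' h0.ne']
      exact Real.log_le_sub_one_of_pos (by positivity)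
    have h3 : Y * (harm M - Real.log Y - γ) ≤ Y * (M / Y - 1 + 1 / (2 * M)) := by
      apply mul_le_mul_of_nonneg_left _ h0.le; linarith
    have h4 : Y * (M / Y - 1 + 1 / (2 * M)) + Y - M - 1 / 2 = (Y - M) / (2 * M) := by
      field_simp; ring
    have h5 : (Y - M) / (2 * M) ≤ 1 / (2 * (M : ℝ)) := by gcongr; linarith
    rw [kapH, ← hM]; linarith

lemma abs_kapH_le {Y δ : ℝ} (h0 : 0 < Y) (hδ0 : 0 ≤ δ) (hδ1 : δ ≤ 1) :
    |kapH Y| ≤ Y ^ (δ - 1) := by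
  rcases lt_or_ge Y 1 with h | h
  · exact (abs_kapH_le_one h0 h).trans
      (Real.one_le_rpow_of_pos_of_le_one_of_nonpos h0 h.le (by linarith))
  · refine (abs_kapH_le_inv h).trans ?_
    rw [← Real.rpow_neg_one]
    exact Real.rpow_le_rpow_of_exponent_le h (by linarith)

lemma harm_approx : ∃ C : ℝ, 0 < C ∧ ∀ Y : ℝ, 0 < Y →
    |harm ⌊Y⌋₊ - Real.log Y - γ| ≤ C * Y ^ (-(1 / 2 : ℝ)) := by
  refine ⟨4, by norm_num, fun Y hY => ?_⟩
  have g1 := Real.one_half_lt_eulerMascheroniConstant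
  have g2 := Real.eulerMascheroniConstant_lt_two_thirds
  rcases lt_or_ge Y 1 with h | h
  · have hf : ⌊Y⌋₊ = 0 := Nat.floor_eq_zero.2 h
    have h1 : (1 : ℝ) ≤ Y ^ (-(1 / 2 : ℝ)) :=
      Real.one_le_rpow_of_pos_of_le_one_of_nonpos hY h.le (by norm_num)
    have h2 := Real.log_le_sub_one_of_pos (Real.rpow_pos_of_pos hY (-(1 / 2 : ℝ)))
    rw [Real.log_rpow hY] at h2
    have h3 : Real.log Y ≤ 0 := Real.log_nonpos hY.le h.le
    rw [hf]; simp only [harm]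
    rw [abs_le]; constructor <;> simp <;> linarith
  · have h0 : 0 < Y := by linarith
    have h1 := abs_kapH_le_inv h
    have a1 : (⌊Y⌋₊ : ℝ) ≤ Y := Nat.floor_le h0.le
    have a2 : Y < ⌊Y⌋₊ + 1 := Nat.lt_floor_add_one Y
    have h2 : |Y * (harm ⌊Y⌋₊ - Real.log Y - γ)| ≤ 2 := by
      have h3 : Y⁻¹ ≤ 1 := inv_le_one_of_one_le₀ h
      rw [kapH, abs_le] at h1
      rw [abs_le]; constructor <;> linarith [h1.1, h1.2]
    rw [abs_mul, abs_of_pos h0] at h2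
    have h4 : |harm ⌊Y⌋₊ - Real.log Y - γ| ≤ 2 * Y⁻¹ := by
      rw [← div_eq_mul_inv, le_div_iff₀ h0]; linarith
    have h5 : Y⁻¹ ≤ Y ^ (-(1 / 2 : ℝ)) := by
      rw [← Real.rpow_neg_one]
      exact Real.rpow_le_rpow_of_exponent_le h (by norm_num)
    have h6 : 0 < Y ^ (-(1 / 2 : ℝ)) := Real.rpow_pos_of_pos h0 _
    linarith

/-- The quadratically weighted harmonic sum. -/
noncomputable def phiH (Y : ℝ) : ℝ := ∑ m ∈ Icc 1 ⌊Y⌋₊, (Y - m) ^ 2 / m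

noncomputable def psiH (Y : ℝ) : ℝ :=
  phiH Y - (Y ^ 2 * Real.log Y + (γ - 3 / 2) * Y ^ 2 + Y)

lemma hasDerivAt_max_sq (m Y : ℝ) :
    HasDerivAt (fun Y : ℝ => max (Y - m) 0 ^ 2) (2 * max (Y - m) 0) Y := by
  rcases lt_trichotomy Y m with h | h | h
  · rw [max_eq_right (by linarith), mul_zero]
    refine (hasDerivAt_const Y (0 : ℝ)).congr_of_eventuallyEq ?_
    filter_upwards [eventually_lt_nhds h] with y hy
    rw [max_eq_right (by linarith)]; norm_num
  · subst h
    rw [sub_self, max_self, mul_zero, hasDerivAt_iff_isLittleO]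
    simp only [sub_self, max_self, smul_zero, sub_zero]
    norm_num
    have h1 : (fun x => max (x - Y) 0 ^ 2) =O[nhds Y] fun x => (x - Y) ^ 2 := by
      refine Asymptotics.IsBigO.of_bound 1 (Filter.Eventually.of_forall fun x => ?_)
      rw [one_mul, Real.norm_eq_abs, Real.norm_eq_abs, abs_pow, abs_pow]
      refine pow_le_pow_left₀ (abs_nonneg _) ?_ 2
      rw [abs_of_nonneg (a := max (x - Y) 0) (le_max_right _ _)]
      exact max_le (le_abs_self _) (abs_nonneg _)
    refine h1.trans_isLittleO ?_
    have h2 : (fun u : ℝ => u ^ 2) =o[nhds 0] fun u => u :=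
      Asymptotics.isLittleO_pow_id (by norm_num)
    have h3 : Filter.Tendsto (fun x => x - Y) (nhds Y) (nhds 0) := by
      have : Continuous fun x => x - Y := by fun_prop
      simpa using this.tendsto Y
    exact h2.comp_tendsto h3
  · rw [max_eq_left (by linarith)]
    have h1 : HasDerivAt (fun y : ℝ => (y - m) ^ 2) (2 * (Y - m)) Y := by
      simpa using ((hasDerivAt_id' Y).sub_const m).fun_pow 2
    refine h1.congr_of_eventuallyEq ?_
    filter_upwards [eventually_gt_nhds h] with y hy
    rw [max_eq_left (by linarith)]

lemma phiH_eq {Y : ℝ} (hY : 0 ≤ Y) {B : ℕ} (hB : ⌊Y⌋₊ ≤ B) :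
    phiH Y = ∑ m ∈ Icc 1 B, max (Y - m) 0 ^ 2 / m := by
  rw [phiH, ← Finset.sum_subset (Finset.Icc_subset_Icc_right hB)]
  · refine Finset.sum_congr rfl fun m hm => ?_
    rw [Finset.mem_Icc] at hm
    rw [max_eq_left]
    have := (Nat.le_floor_iff hY).1 hm.2
    linarith
  · intro m hm hm2
    rw [Finset.mem_Icc] at hm hm2
    have h1 : ⌊Y⌋₊ < m := by omega
    have := (Nat.floor_lt hY).1 h1
    rw [max_eq_right (by linarith)]; simp

lemma hasDerivAt_psiH {Y : ℝ} (hY : 0 < Y) : HasDerivAt psiH (2 * kapH Y) Y := by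
  have h1 : HasDerivAt (fun y : ℝ => ∑ m ∈ Icc 1 (⌊Y⌋₊ + 1), max (y - (m : ℝ)) 0 ^ 2 / (m : ℝ))
      (∑ m ∈ Icc 1 (⌊Y⌋₊ + 1), 2 * max (Y - (m : ℝ)) 0 / (m : ℝ)) Y :=
    HasDerivAt.fun_sum fun m _ => (hasDerivAt_max_sq m Y).div_const _
  have h2 : HasDerivAt phiH (∑ m ∈ Icc 1 (⌊Y⌋₊ + 1), 2 * max (Y - (m : ℝ)) 0 / (m : ℝ)) Y := by
    refine h1.congr_of_eventuallyEq ?_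
    filter_upwards [eventually_gt_nhds hY, eventually_lt_nhds (Nat.lt_floor_add_one Y)] with y h3 h4
    refine phiH_eq h3.le ?_
    have : y < (⌊Y⌋₊ + 1 : ℕ) := by exact_mod_cast h4
    exact ((Nat.floor_lt h3.le).2 this).le
  have e1 : ∑ m ∈ Icc 1 (⌊Y⌋₊ + 1), 2 * max (Y - (m : ℝ)) 0 / (m : ℝ) =
      2 * (Y * harm ⌊Y⌋₊ - ⌊Y⌋₊) := by
    rw [Finset.sum_Icc_succ_top (by omega), max_eq_right]
    · rw [mul_zero, zero_div, add_zero, harm, Finset.mul_sum]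
      have : (⌊Y⌋₊ : ℝ) = ∑ m ∈ Icc 1 ⌊Y⌋₊, (1 : ℝ) := by simp
      conv_rhs => rw [this]
      rw [← Finset.sum_sub_distrib, Finset.mul_sum]
      refine Finset.sum_congr rfl fun m hm => ?_
      rw [Finset.mem_Icc] at hm
      have h5 := (Nat.le_floor_iff hY.le).1 hm.2
      have h6 : (0 : ℝ) < m := by exact_mod_cast hm.1
      rw [max_eq_left (by linarith)]
      field_simp
    · push_cast; linarith [Nat.lt_floor_add_one Y]
  rw [e1] at h2
  have h3 : HasDerivAt (fun y : ℝ => y ^ 2 * Real.log y + (γ - 3 / 2) * y ^ 2 + y)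
      (2 * Y * Real.log Y + Y ^ 2 * Y⁻¹ + (γ - 3 / 2) * (2 * Y) + 1) Y := by
    have a1 : HasDerivAt (fun y : ℝ => y ^ 2) (2 * Y) Y := by simpa using hasDerivAt_pow 2 Y
    exact ((a1.mul (Real.hasDerivAt_log hY.ne')).add (a1.const_mul _)).add (hasDerivAt_id Y)
  refine (h2.sub h3).congr_deriv ?_
  rw [kapH]; field_simp; ring

lemma psiH_eq_of_lt_one {Y : ℝ} (h : Y < 1) :
    psiH Y = -(Y * (Y * Real.log Y) + (γ - 3 / 2) * Y ^ 2 + Y) := by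
  rw [psiH, phiH, Nat.floor_eq_zero.2 h]; simp; ring

lemma psiH_zero : psiH 0 = 0 := by
  rw [psiH_eq_of_lt_one (by norm_num)]; simp

lemma continuousOn_psiH : ContinuousOn psiH (Set.Ici 0) := by
  intro Y hY
  rcases (Set.mem_Ici.1 hY).eq_or_lt with rfl | h
  · refine ContinuousAt.continuousWithinAt ?_
    have h1 : Continuous fun Y : ℝ => -(Y * (Y * Real.log Y) + (γ - 3 / 2) * Y ^ 2 + Y) := by
      have := Real.continuous_mul_log
      fun_prop
    refine h1.continuousAt.congr ?_
    filter_upwards [eventually_lt_nhds (show (0 : ℝ) < 1 by norm_num)] with y hy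
    exact (psiH_eq_of_lt_one hy).symm
  · exact (hasDerivAt_psiH h).continuousAt.continuousWithinAt

lemma abs_psiH_le {Y δ : ℝ} (hY : 0 ≤ Y) (hδ0 : 0 < δ) (hδ1 : δ ≤ 1) :
    |psiH Y| ≤ 2 / δ * Y ^ δ := by
  have hp : ∀ y : ℝ, 0 < y → HasDerivAt (fun y : ℝ => 2 / δ * y ^ δ) (2 * y ^ (δ - 1)) y := by
    intro y hy
    refine ((Real.hasDerivAt_rpow_const (Or.inl hy.ne')).const_mul (2 / δ)).congr_deriv ?_
    field_simp
  have hpc : ContinuousOn (fun y : ℝ => 2 / δ * y ^ δ) (Set.Ici 0) :=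
    (continuous_const.mul (Real.continuous_rpow_const hδ0.le)).continuousOn
  have key : ∀ σ : ℝ, |σ| = 1 → 0 ≤ 2 / δ * Y ^ δ + σ * psiH Y := by
    intro σ hσ
    have hd : ∀ y : ℝ, 0 < y → HasDerivAt (fun y : ℝ => 2 / δ * y ^ δ + σ * psiH y)
        (2 * y ^ (δ - 1) + σ * (2 * kapH y)) y := fun y hy =>
      (hp y hy).add ((hasDerivAt_psiH hy).const_mul σ)
    have hm : MonotoneOn (fun y : ℝ => 2 / δ * y ^ δ + σ * psiH y) (Set.Ici 0) := by
      refine monotoneOn_of_deriv_nonneg (convex_Ici 0)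
        (hpc.add (continuousOn_const.mul continuousOn_psiH)) ?_ ?_
      · intro y hy
        rw [interior_Ici] at hy
        exact (hd y hy).differentiableAt.differentiableWithinAt
      · intro y hy
        rw [interior_Ici] at hy
        rw [(hd y hy).deriv]
        have h1 := abs_kapH_le hy hδ0.le hδ1
        have h2 : |σ * (2 * kapH y)| ≤ 2 * y ^ (δ - 1) := by
          rw [abs_mul, hσ, one_mul, abs_mul, abs_two]; linarith
        linarith [(abs_le.1 h2).1]
    have := hm (Set.mem_Ici.2 le_rfl) hY hY
    simpa [psiH_zero, Real.zero_rpow hδ0.ne'] using this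
  have k1 := key 1 (by simp)
  have k2 := key (-1) (by simp)
  rw [abs_le]; constructor <;> linarith

lemma abs_psiH_div_cube_le {Y δ t : ℝ} (hY : 0 < Y) (ht : 0 < t) (hδ0 : 0 < δ) (hδ1 : δ ≤ 1) :
    |psiH (Y / t ^ 3)| ≤ 2 / δ * Y ^ δ * t ^ (-(3 * δ)) := by
  refine (abs_psiH_le (by positivity) hδ0 hδ1).trans_eq ?_
  rw [Real.div_rpow hY.le (by positivity), ← Real.rpow_natCast t 3, ← Real.rpow_mul ht.le,
    Real.rpow_neg ht.le]
  push_cast; ring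

lemma hasDerivAt_psiH_div_cube {Y t : ℝ} (hY : 0 < Y) (ht : 0 < t) :
    HasDerivAt (fun t : ℝ => psiH (Y / t ^ 3)) (2 * kapH (Y / t ^ 3) * (-(3 * Y) / t ^ 4)) t := by
  have h1 : HasDerivAt (fun t : ℝ => Y / t ^ 3) (-(3 * Y) / t ^ 4) t := by
    refine ((hasDerivAt_const t Y).fun_div (hasDerivAt_pow 3 t) (by positivity)).congr_deriv ?_
    field_simp; ring
  exact (hasDerivAt_psiH (by positivity : 0 < Y / t ^ 3)).comp t h1

lemma abs_deriv_psiH_div_cube_le {Y t δ : ℝ} (hY : 0 < Y) (ht : 0 < t) (hδ0 : 0 ≤ δ)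
    (hδ1 : δ ≤ 1) :
    |2 * kapH (Y / t ^ 3) * (-(3 * Y) / t ^ 4)| ≤ 6 * Y ^ δ * t ^ (-(1 + 3 * δ)) := by
  set v := Y / t ^ 3 with hv
  have hv0 : 0 < v := by positivity
  have e1 : -(3 * Y) / t ^ 4 = -(3 * v * t⁻¹) := by rw [hv]; field_simp
  rw [e1, abs_mul, abs_neg, abs_mul, abs_two, abs_of_pos (by positivity : 0 < 3 * v * t⁻¹)]
  have h1 := abs_kapH_le hv0 hδ0 hδ1
  calc 2 * |kapH v| * (3 * v * t⁻¹) ≤ 2 * v ^ (δ - 1) * (3 * v * t⁻¹) := by gcongr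
    _ = 6 * (v ^ (δ - 1) * v) * t⁻¹ := by ring
    _ = 6 * v ^ δ * t⁻¹ := by rw [← Real.rpow_add_one hv0.ne']; simp
    _ = 6 * Y ^ δ * t ^ (-(1 + 3 * δ)) := by
      rw [hv, Real.div_rpow hY.le (by positivity), ← Real.rpow_natCast t 3, ← Real.rpow_mul ht.le,
        neg_add, Real.rpow_add ht, Real.rpow_neg_one, Real.rpow_neg ht.le]
      push_cast; field_simp

open MeasureTheory in
lemma integrableOn_psiH_div_cube {Y : ℝ} (hY : 0 < Y) :
    IntegrableOn (fun t : ℝ => psiH (Y / t ^ 3)) (Set.Ioi 0) := by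
  have hc : ContinuousOn (fun t : ℝ => psiH (Y / t ^ 3)) (Set.Ioi 0) := fun t ht =>
    (hasDerivAt_psiH_div_cube hY ht).continuousAt.continuousWithinAt
  rw [← Set.Ioc_union_Ioi_eq_Ioi zero_le_one]
  refine IntegrableOn.union ?_ ?_
  · have h1 : IntegrableOn (fun t : ℝ => 2 / (1 / 6) * Y ^ (1 / 6 : ℝ) * t ^ (-(3 * (1 / 6 : ℝ))))
        (Set.Ioc 0 1) := by
      refine Integrable.const_mul ?_ _
      exact (intervalIntegrable_iff_integrableOn_Ioc_of_le zero_le_one).1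
        (intervalIntegral.intervalIntegrable_rpow' (by norm_num))
    refine h1.mono' ((hc.mono Set.Ioc_subset_Ioi_self).aestronglyMeasurable measurableSet_Ioc) ?_
    refine (ae_restrict_iff' measurableSet_Ioc).2 (Filter.Eventually.of_forall fun t ht => ?_)
    exact abs_psiH_div_cube_le hY ht.1 (by norm_num) (by norm_num)
  · have h1 : IntegrableOn (fun t : ℝ => 2 / 1 * Y ^ (1 : ℝ) * t ^ (-(3 * 1 : ℝ)))
        (Set.Ioi 1) := by
      refine Integrable.const_mul ?_ _
      exact integrableOn_Ioi_rpow_of_lt (by norm_num) one_pos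
    refine h1.mono' ((hc.mono (Set.Ioi_subset_Ioi zero_le_one)).aestronglyMeasurable
      measurableSet_Ioi) ?_
    refine (ae_restrict_iff' measurableSet_Ioi).2 (Filter.Eventually.of_forall fun t ht => ?_)
    exact abs_psiH_div_cube_le hY (lt_trans one_pos ht) (by norm_num) (by norm_num)

lemma summable_psiH_cube {Y : ℝ} (hY : 0 < Y) :
    Summable (fun m : ℕ => psiH (Y / ((m : ℝ) + 1) ^ 3)) := by
  have h1 : Summable (fun m : ℕ => 2 / 1 * Y ^ (1 : ℝ) * ((m : ℝ) + 1) ^ (-(3 * 1 : ℝ))) := by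
    refine Summable.mul_left _ ?_
    have := (summable_nat_add_iff 1).2
      (Real.summable_nat_rpow.2 (show -(3 * 1 : ℝ) < -1 by norm_num))
    simpa using this
  refine Summable.of_norm_bounded h1 fun m => ?_
  exact abs_psiH_div_cube_le hY (by positivity) (by norm_num) (by norm_num)

/-- The constant in the asymptotic expansion of `Σ_m ψ(Y/m³)`. -/
noncomputable def aZero : ℝ := ∫ t in Set.Ioi (0 : ℝ), psiH (1 / t ^ 3)

open MeasureTheory in
lemma integral_psiH_div_cube {Y : ℝ} (hY : 0 < Y) :
    ∫ t in Set.Ioi (0 : ℝ), psiH (Y / t ^ 3) = aZero * Y ^ (1 / 3 : ℝ) := by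
  have hb : 0 < Y ^ (-(1 / 3) : ℝ) := Real.rpow_pos_of_pos hY _
  have h1 := integral_comp_mul_left_Ioi (fun s : ℝ => psiH (1 / s ^ 3)) 0 hb
  rw [mul_zero, ← aZero, smul_eq_mul, Real.rpow_neg hY.le, inv_inv, mul_comm] at h1
  rw [← h1]
  have e : Y = (Y ^ (1 / 3 : ℝ)) ^ 3 := by
    rw [← Real.rpow_natCast, ← Real.rpow_mul hY.le]; norm_num
  congr 1; funext t; congr 1
  rw [mul_pow, inv_pow, ← e]
  simp [div_eq_mul_inv, mul_comm]

open MeasureTheory in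
lemma abs_tsum_psiH_cube_sub_le {δ : ℝ} (hδ0 : 0 < δ) (hδ1 : δ < 1 / 3) :
    ∃ C : ℝ, 0 < C ∧ ∀ Y : ℝ, 0 < Y →
      |∑' m : ℕ, psiH (Y / ((m : ℝ) + 1) ^ 3) - aZero * Y ^ (1 / 3 : ℝ)| ≤ C * Y ^ δ := by
  have hs : Summable (fun m : ℕ => ((m : ℝ) + 1) ^ (-(1 + 3 * δ))) := by
    have := (summable_nat_add_iff 1).2
      (Real.summable_nat_rpow.2 (show -(1 + 3 * δ) < -1 by linarith))
    simpa using this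
  set S := ∑' m : ℕ, ((m : ℝ) + 1) ^ (-(1 + 3 * δ)) with hS
  have hS0 : 0 ≤ S := tsum_nonneg fun m => by positivity
  have hδ3 : 0 < 1 - 3 * δ := by linarith
  refine ⟨6 * S + 2 / δ * (1 / (1 - 3 * δ)), by positivity, fun Y hY => ?_⟩
  set p : ℝ → ℝ := fun t => psiH (Y / t ^ 3) with hp
  have hfi := integrableOn_psiH_div_cube hY
  have hi1 : IntegrableOn p (Set.Ioc 0 1) := hfi.mono_set Set.Ioc_subset_Ioi_self
  have hi2 : IntegrableOn p (Set.Ioi 1) := hfi.mono_set (Set.Ioi_subset_Ioi zero_le_one)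
  have hsplit : aZero * Y ^ (1 / 3 : ℝ) = (∫ t in Set.Ioc 0 1, p t) + ∫ t in Set.Ioi 1, p t := by
    rw [← integral_psiH_div_cube hY, ← Set.Ioc_union_Ioi_eq_Ioi (zero_le_one' ℝ),
      setIntegral_union (Set.Ioc_disjoint_Ioi le_rfl) measurableSet_Ioi hi1 hi2]
  have hsmall : |∫ t in Set.Ioc 0 1, p t| ≤ 2 / δ * (1 / (1 - 3 * δ)) * Y ^ δ := by
    have h1 : IntegrableOn (fun t : ℝ => 2 / δ * Y ^ δ * t ^ (-(3 * δ))) (Set.Ioc 0 1) := by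
      refine Integrable.const_mul ?_ _
      exact (intervalIntegrable_iff_integrableOn_Ioc_of_le zero_le_one).1
        (intervalIntegral.intervalIntegrable_rpow' (by linarith))
    have h2 := norm_integral_le_of_norm_le h1 (f := p)
      ((ae_restrict_iff' measurableSet_Ioc).2 (Filter.Eventually.of_forall fun t ht =>
        abs_psiH_div_cube_le hY ht.1 hδ0 (by linarith)))
    rw [Real.norm_eq_abs] at h2
    refine h2.trans_eq ?_
    rw [integral_const_mul, ← intervalIntegral.integral_of_le zero_le_one,
      integral_rpow (Or.inl (by linarith)), Real.zero_rpow (by linarith), Real.one_rpow]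
    rw [show -(3 * δ) + 1 = 1 - 3 * δ by ring]; ring
  have hii : ∀ a b : ℝ, 0 < a → a ≤ b → IntervalIntegrable p volume a b := fun a b ha hab =>
    (intervalIntegrable_iff_integrableOn_Ioc_of_le hab).2
      (hfi.mono_set (Set.Ioc_subset_Ioi_self.trans (Set.Ioi_subset_Ioi ha.le)))
  have hterm : ∀ m : ℕ, |p (m + 1) - ∫ t in (m + 1 : ℝ)..(m + 2 : ℝ), p t| ≤
      6 * Y ^ δ * ((m : ℝ) + 1) ^ (-(1 + 3 * δ)) := by
    intro m
    set B := 6 * Y ^ δ * ((m : ℝ) + 1) ^ (-(1 + 3 * δ)) with hB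
    have hB0 : 0 ≤ B := by positivity
    have hm0 : (0 : ℝ) < m + 1 := by positivity
    have h1 : ∀ t ∈ Set.Icc (m + 1 : ℝ) (m + 2), ‖p t - p (m + 1)‖ ≤ B * ‖t - (m + 1)‖ := by
      intro t ht
      refine Convex.norm_image_sub_le_of_norm_hasDerivWithin_le
        (f' := fun t => 2 * kapH (Y / t ^ 3) * (-(3 * Y) / t ^ 4))
        (fun s hs => (hasDerivAt_psiH_div_cube hY (hm0.trans_le hs.1)).hasDerivWithinAt)
        (fun s hs => ?_) (convex_Icc (m + 1 : ℝ) (m + 2)) ⟨le_rfl, by linarith⟩ ht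
      refine (abs_deriv_psiH_div_cube_le hY (hm0.trans_le hs.1) hδ0.le (by linarith)).trans ?_
      rw [hB]
      refine mul_le_mul_of_nonneg_left ?_ (by positivity)
      exact Real.rpow_le_rpow_of_nonpos hm0 hs.1 (by linarith)
    have h2 : (∫ t in (m + 1 : ℝ)..(m + 2 : ℝ), p t) - p (m + 1) =
        ∫ t in (m + 1 : ℝ)..(m + 2 : ℝ), (p t - p (m + 1)) := by
      rw [intervalIntegral.integral_sub (hii _ _ hm0 (by linarith)) (by simp)]
      simp; ring
    rw [abs_sub_comm, h2]
    have h3 := intervalIntegral.norm_integral_le_of_norm_le_const (a := (m + 1 : ℝ))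
      (b := m + 2) (C := B) (f := fun t => p t - p (m + 1)) (fun t ht => by
        rw [Set.uIoc_of_le (by linarith)] at ht
        have h4 := h1 t ⟨ht.1.le, ht.2⟩
        have h5 : ‖t - (m + 1)‖ ≤ 1 := by
          rw [Real.norm_eq_abs, abs_le]; constructor <;> linarith [ht.1, ht.2]
        exact h4.trans (mul_le_of_le_one_right hB0 h5))
    have e : |(m : ℝ) + 2 - (m + 1)| = 1 := by norm_num
    rw [e, mul_one] at h3
    exact h3
  have hlim1 := (summable_psiH_cube hY).hasSum.tendsto_sum_nat
  have hlim2 : Filter.Tendsto (fun n : ℕ => ∑ m ∈ range n, ∫ t in (m + 1 : ℝ)..(m + 2 : ℝ), p t)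
      Filter.atTop (nhds (∫ t in Set.Ioi 1, p t)) := by
    have h1 := intervalIntegral_tendsto_integral_Ioi 1 hi2
      (tendsto_natCast_atTop_atTop (R := ℝ).atTop_add (tendsto_const_nhds (x := (1 : ℝ))))
    refine h1.congr fun n => ?_
    have h2 := intervalIntegral.sum_integral_adjacent_intervals (f := p) (μ := volume)
      (a := fun k : ℕ => (k : ℝ) + 1) (n := n) (fun k _ => hii _ _ (by positivity) (by simp))
    simp only [Nat.cast_zero, zero_add] at h2
    rw [← h2]
    refine Finset.sum_congr rfl fun k _ => ?_
    push_cast; congr 1; ring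
  have hlim := (hlim1.sub hlim2).abs
  have hbig : |∑' m : ℕ, psiH (Y / ((m : ℝ) + 1) ^ 3) - ∫ t in Set.Ioi 1, p t| ≤
      6 * S * Y ^ δ := by
    refine le_of_tendsto hlim (Filter.Eventually.of_forall fun n => ?_)
    rw [← Finset.sum_sub_distrib]
    refine (Finset.abs_sum_le_sum_abs _ _).trans ((Finset.sum_le_sum fun m _ => hterm m).trans ?_)
    rw [← Finset.mul_sum]
    have := hs.sum_le_tsum (range n) (fun m _ => by positivity)
    calc _ ≤ 6 * Y ^ δ * S := by gcongr
      _ = _ := by ring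
  rw [hsplit]
  rw [abs_le] at *
  constructor <;> linarith [hbig.1, hbig.2, hsmall.1, hsmall.2]

lemma sum_sum_divisors_mul (N : ℕ) (c F : ℕ → ℝ) :
    ∑ k ∈ Icc 1 N, (∑ d ∈ k.divisors, c d) * F k =
      ∑ d ∈ Icc 1 N, c d * ∑ m ∈ Icc 1 (N / d), F (d * m) := by
  simp only [Finset.sum_mul, Finset.mul_sum]
  rw [Finset.sum_sigma', Finset.sum_sigma']
  refine Finset.sum_nbij' (fun p => ⟨p.2, p.1 / p.2⟩) (fun p => ⟨p.1 * p.2, p.1⟩) ?_ ?_ ?_ ?_ ?_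
  · rintro ⟨k, d⟩ h
    simp only [Finset.mem_sigma, Finset.mem_Icc, Nat.mem_divisors] at h ⊢
    have hd := Nat.pos_of_dvd_of_pos h.2.1 h.1.1
    have hdk := Nat.le_of_dvd h.1.1 h.2.1
    exact ⟨⟨hd, hdk.trans h.1.2⟩, Nat.div_pos hdk hd, Nat.div_le_div_right h.1.2⟩
  · rintro ⟨d, m⟩ h
    simp only [Finset.mem_sigma, Finset.mem_Icc, Nat.mem_divisors] at h ⊢
    refine ⟨⟨Nat.mul_pos h.1.1 h.2.1, ?_⟩, Dvd.intro _ rfl,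
      (Nat.mul_pos h.1.1 h.2.1).ne'⟩
    rw [mul_comm]; exact (Nat.le_div_iff_mul_le h.1.1).1 h.2.2
  · rintro ⟨k, d⟩ h
    simp only [Finset.mem_sigma, Finset.mem_Icc, Nat.mem_divisors] at h
    simp [Nat.mul_div_cancel' h.2.1]
  · rintro ⟨d, m⟩ h
    simp only [Finset.mem_sigma, Finset.mem_Icc] at h
    simp [Nat.mul_div_cancel_left m h.1.1]
  · rintro ⟨k, d⟩ h
    simp only [Finset.mem_sigma, Finset.mem_Icc, Nat.mem_divisors] at h
    simp [Nat.mul_div_cancel' h.2.1]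

lemma Jd_zero : Jd 0 = 0 := by simp [Jd]

lemma hasSum_Jd_of_sum_Hq (N : ℕ) (F : ℕ → ℝ) :
    HasSum (fun d => Jd d * ∑ m ∈ Icc 1 (N / d), F (d * m)) (∑ k ∈ Icc 1 N, Hq k * F k) := by
  have e : ∑ k ∈ Icc 1 N, Hq k * F k =
      ∑ d ∈ Icc 1 N, Jd d * ∑ m ∈ Icc 1 (N / d), F (d * m) := by
    rw [← sum_sum_divisors_mul]
    refine Finset.sum_congr rfl fun k hk => ?_
    rw [Hq_eq_sum_divisors (Finset.mem_Icc.1 hk).1]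
  rw [e]
  refine hasSum_sum_of_ne_finset_zero fun d hd => ?_
  rw [Finset.mem_Icc] at hd
  rcases Nat.eq_zero_or_pos d with rfl | h0
  · rw [Jd_zero, zero_mul]
  · rw [Nat.div_eq_of_lt (by omega)]; simp

/-- The quadratically weighted sum of `H(k)/k`. -/
noncomputable def PhiX (X : ℝ) : ℝ := ∑ k ∈ Icc 1 ⌊X⌋₊, Hq k / k * (X - k) ^ 2

noncomputable def LX (t : ℕ) : ℝ := ∑ q ∈ Icc 1 t, Hq q / q

lemma hasSum_PhiX (X : ℝ) : HasSum (fun d : ℕ => Jd d * (d * phiH (X / d))) (PhiX X) := by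
  have h := hasSum_Jd_of_sum_Hq ⌊X⌋₊ (fun k => (X - k) ^ 2 / k)
  have e : PhiX X = ∑ k ∈ Icc 1 ⌊X⌋₊, Hq k * ((X - k) ^ 2 / k) := by
    rw [PhiX]; exact Finset.sum_congr rfl fun k _ => by ring
  rw [e]
  convert h using 2 with d
  rcases Nat.eq_zero_or_pos d with rfl | h0
  · simp [Jd_zero]
  · have hd : (0 : ℝ) < d := by exact_mod_cast h0
    rw [phiH, Nat.floor_div_natCast, Finset.mul_sum]
    congr 1
    refine Finset.sum_congr rfl fun m hm => ?_
    have hm0 : (0 : ℝ) < m := by exact_mod_cast (Finset.mem_Icc.1 hm).1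
    push_cast; field_simp

lemma hasSum_LX (t : ℕ) : HasSum (fun d : ℕ => Jd d * (harm ⌊(t : ℝ) / d⌋₊ / d)) (LX t) := by
  have h := hasSum_Jd_of_sum_Hq t (fun k => (k : ℝ)⁻¹)
  have e : LX t = ∑ k ∈ Icc 1 t, Hq k * (k : ℝ)⁻¹ := by
    rw [LX]; exact Finset.sum_congr rfl fun k _ => by ring
  rw [e]
  convert h using 2 with d
  rw [harm, Nat.floor_div_natCast, Nat.floor_natCast, Finset.sum_div]
  congr 1
  refine Finset.sum_congr rfl fun m hm => ?_
  push_cast; rw [mul_inv]; ring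

noncomputable def Jtot : ℝ := ∑' d, Jd d
noncomputable def Ainv : ℝ := ∑' d, Jd d * (d : ℝ)⁻¹
noncomputable def Alog : ℝ := ∑' d, Jd d * (Real.log d / d)
noncomputable def aCube : ℝ := aZero * ∑' e : ℕ, gf e * (e : ℝ) ^ (2 / 3 : ℝ)

lemma hasSum_Jtot : HasSum Jd Jtot := summable_Jd.hasSum

lemma hasSum_Ainv : HasSum (fun d : ℕ => Jd d * (d : ℝ)⁻¹) Ainv := by
  refine Summable.hasSum ?_
  simpa [Real.rpow_neg_one] using summable_Jd_mul_rpow (s := -1) (by norm_num)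

lemma hasSum_Alog : HasSum (fun d : ℕ => Jd d * (Real.log d / d)) Alog := by
  refine Summable.hasSum (Summable.of_norm_bounded summable_Jd fun d => ?_)
  rw [norm_mul, Real.norm_of_nonneg (Jd_nonneg d)]
  refine mul_le_of_le_one_right (Jd_nonneg d) ?_
  rcases Nat.eq_zero_or_pos d with rfl | h0
  · simp
  · have hd : (1 : ℝ) ≤ d := by exact_mod_cast h0
    rw [Real.norm_of_nonneg (div_nonneg (Real.log_nonneg hd) (by linarith)),
      div_le_one (by linarith)]
    linarith [Real.log_le_sub_one_of_pos (by linarith : (0 : ℝ) < d)]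

lemma LX_approx : ∃ C : ℝ, 0 < C ∧ ∀ t : ℕ, 0 < t →
    |LX t - (Ainv * Real.log t + (γ * Ainv - Alog))| ≤ C * (t : ℝ) ^ (-(1 / 2 : ℝ)) := by
  obtain ⟨C, hC, h⟩ := harm_approx
  refine ⟨C * Jtot, mul_pos hC tsum_Jd_pos, fun t ht => ?_⟩
  have ht0 : (0 : ℝ) < t := by exact_mod_cast ht
  have h1 := (hasSum_LX t).sub (((hasSum_Ainv.mul_left (Real.log t)).add
    (hasSum_Ainv.mul_left γ)).sub hasSum_Alog)
  have h2 := hasSum_Jtot.mul_left (C * (t : ℝ) ^ (-(1 / 2 : ℝ)))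
  have h3 : ∀ d : ℕ, ‖Jd d * (harm ⌊(t : ℝ) / d⌋₊ / d) - (Real.log t * (Jd d * (d : ℝ)⁻¹) +
      γ * (Jd d * (d : ℝ)⁻¹) - Jd d * (Real.log d / d))‖ ≤ C * (t : ℝ) ^ (-(1 / 2 : ℝ)) * Jd d := by
    intro d
    rcases Nat.eq_zero_or_pos d with rfl | h0
    · simp [Jd_zero]
    · have hd : (1 : ℝ) ≤ d := by exact_mod_cast h0
      have hd0 : (0 : ℝ) < d := by linarith
      have h4 := h (t / d) (by positivity)
      rw [Real.log_div ht0.ne' hd0.ne', Real.div_rpow ht0.le hd0.le] at h4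
      have e : Jd d * (harm ⌊(t : ℝ) / d⌋₊ / d) - (Real.log t * (Jd d * (d : ℝ)⁻¹) +
          γ * (Jd d * (d : ℝ)⁻¹) - Jd d * (Real.log d / d)) =
          Jd d * ((d : ℝ)⁻¹ * (harm ⌊(t : ℝ) / d⌋₊ - (Real.log t - Real.log d) - γ)) := by ring
      rw [e, norm_mul, norm_mul, Real.norm_of_nonneg (Jd_nonneg d),
        Real.norm_of_nonneg (by positivity : 0 ≤ (d : ℝ)⁻¹), Real.norm_eq_abs,
        mul_comm (C * _) (Jd d)]
      refine mul_le_mul_of_nonneg_left ?_ (Jd_nonneg d)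
      calc _ ≤ (d : ℝ)⁻¹ * (C * ((t : ℝ) ^ (-(1 / 2 : ℝ)) / (d : ℝ) ^ (-(1 / 2 : ℝ)))) := by gcongr
        _ = C * (t : ℝ) ^ (-(1 / 2 : ℝ)) * ((d : ℝ)⁻¹ * (d : ℝ) ^ (1 / 2 : ℝ)) := by
          rw [Real.rpow_neg hd0.le (1 / 2), div_inv_eq_mul]; ring
        _ ≤ C * (t : ℝ) ^ (-(1 / 2 : ℝ)) * 1 := by
          gcongr
          rw [← Real.rpow_neg_one, ← Real.rpow_add hd0]
          exact Real.rpow_le_one_of_one_le_of_nonpos hd (by norm_num)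
        _ = _ := mul_one _
  have h5 := tsum_of_norm_bounded h2 h3
  rw [h1.tsum_eq, Real.norm_eq_abs] at h5
  calc _ = _ := by congr 1; ring
    _ ≤ _ := h5
    _ = _ := by ring

lemma summable_psiH_double {X : ℝ} (hX : 0 < X) :
    Summable (fun x : ℕ × ℕ => cubeLift invCube x.1 * gf x.2 *
      (((x.1 * x.2 : ℕ) : ℝ) * psiH (X / (x.1 * x.2 : ℕ)))) := by
  refine summable_gf_double (F := fun n : ℕ => (n : ℝ) * psiH (X / n)) (s := 1 / 2)
    (C := 4 * X ^ (1 / 2 : ℝ)) (by norm_num) fun n hn => ?_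
  have hn0 : (0 : ℝ) < n := by exact_mod_cast hn
  have h1 := abs_psiH_le (Y := X / n) (δ := 1 / 2) (by positivity) (by norm_num) (by norm_num)
  rw [abs_mul, abs_of_pos hn0]
  calc n * |psiH (X / n)| ≤ n * (2 / (1 / 2) * (X / n) ^ (1 / 2 : ℝ)) := by gcongr
    _ = 4 * X ^ (1 / 2 : ℝ) * (n / (n : ℝ) ^ (1 / 2 : ℝ)) := by
      rw [Real.div_rpow hX.le hn0.le]; ring
    _ = _ := by
      congr 1
      rw [div_eq_iff (by positivity), ← Real.rpow_add hn0]; norm_num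

/-- The sum `Σ_{m ≥ 1} ψ(Y/m³)`. -/
noncomputable def thetaH (Y : ℝ) : ℝ := ∑' m : ℕ, psiH (Y / ((m : ℝ) + 1) ^ 3)

lemma tsum_cubeLift_psiH (X : ℝ) (e : ℕ) :
    ∑' a : ℕ, cubeLift invCube a * gf e * (((a * e : ℕ) : ℝ) * psiH (X / (a * e : ℕ))) =
      gf e * e * thetaH (X / e) := by
  have hinj : Function.Injective (fun m : ℕ => (m + 1) ^ 3) := fun m n h => by
    have := cube_inj h
    omega
  rw [← hinj.tsum_eq]
  · rw [thetaH, ← tsum_mul_left]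
    refine tsum_congr fun m => ?_
    rw [cubeLift_cube, invCube_apply, Nat.cast_mul, mul_comm ((((m + 1) ^ 3 : ℕ) : ℝ)) (e : ℝ),
      ← div_div]
    push_cast
    field_simp
  · intro a ha
    by_contra hc
    apply ha
    by_cases h : ∃ m, m ^ 3 = a
    · obtain ⟨m, rfl⟩ := h
      rcases Nat.eq_zero_or_pos m with rfl | hm
      · simp
      · exact absurd ⟨m - 1, by simp [Nat.sub_add_cancel hm]⟩ hc
    · simp only [cubeLift_of_not h, zero_mul]

lemma tsum_psiH_double_approx {δ : ℝ} (hδ0 : 0 < δ) (hδ1 : δ < 1 / 3) :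
    ∃ C : ℝ, 0 < C ∧ ∀ X : ℝ, 0 < X →
      |∑' x : ℕ × ℕ, cubeLift invCube x.1 * gf x.2 *
        (((x.1 * x.2 : ℕ) : ℝ) * psiH (X / (x.1 * x.2 : ℕ))) - aCube * X ^ (1 / 3 : ℝ)| ≤
          C * X ^ δ := by
  obtain ⟨C, hC, h⟩ := abs_tsum_psiH_cube_sub_le hδ0 hδ1
  have hg := (summable_gf_mul_rpow (s := 1 - δ) (by linarith)).hasSum
  have hg23 : Summable (fun e : ℕ => gf e * (e : ℝ) ^ (2 / 3 : ℝ)) := by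
    refine Summable.of_norm_bounded (summable_gf_mul_rpow (s := 2 / 3) (by norm_num)) fun e => ?_
    rw [norm_mul, Real.norm_eq_abs, Real.norm_of_nonneg (by positivity)]
  set G := ∑' e : ℕ, |gf e| * (e : ℝ) ^ (1 - δ) with hG
  have hG0 : 0 ≤ G := tsum_nonneg fun e => by positivity
  refine ⟨C * (G + 1), by positivity, fun X hX => ?_⟩
  have hs := summable_psiH_double hX
  have hs' := (Equiv.prodComm ℕ ℕ).summable_iff.2 hs
  have e1 := (Equiv.prodComm ℕ ℕ).tsum_eq (fun x : ℕ × ℕ => cubeLift invCube x.1 * gf x.2 *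
        (((x.1 * x.2 : ℕ) : ℝ) * psiH (X / (x.1 * x.2 : ℕ))))
  rw [← e1]
  have e2 := hs'.tsum_prod
  have s2 := hs'.prod
  simp only [Function.comp_def, Equiv.prodComm_apply, Prod.fst_swap, Prod.snd_swap] at e2 s2 ⊢
  simp only [tsum_cubeLift_psiH] at e2 s2
  rw [e2]
  have h1 := s2.hasSum.sub ((hg23.hasSum.mul_left aZero).mul_left (X ^ (1 / 3 : ℝ)))
  have h2 : ∀ e : ℕ, ‖gf e * e * thetaH (X / e) -
      X ^ (1 / 3 : ℝ) * (aZero * (gf e * (e : ℝ) ^ (2 / 3 : ℝ)))‖ ≤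
      C * X ^ δ * (|gf e| * (e : ℝ) ^ (1 - δ)) := by
    intro e
    rcases Nat.eq_zero_or_pos e with rfl | he
    · simp
    have he0 : (0 : ℝ) < e := by exact_mod_cast he
    have h3 := h (X / e) (by positivity)
    rw [← thetaH] at h3
    have e3 : gf e * e * thetaH (X / e) -
        X ^ (1 / 3 : ℝ) * (aZero * (gf e * (e : ℝ) ^ (2 / 3 : ℝ))) =
        gf e * e * (thetaH (X / e) - aZero * (X / e) ^ (1 / 3 : ℝ)) := by
      have : (e : ℝ) ^ (2 / 3 : ℝ) = e / (e : ℝ) ^ (1 / 3 : ℝ) := by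
        rw [eq_div_iff (by positivity), ← Real.rpow_add he0]; norm_num
      rw [Real.div_rpow hX.le he0.le, this]; ring
    rw [e3, norm_mul, norm_mul, Real.norm_eq_abs, Real.norm_eq_abs, Real.norm_eq_abs,
      abs_of_pos he0]
    calc |gf e| * e * |thetaH (X / e) - aZero * (X / e) ^ (1 / 3 : ℝ)|
        ≤ |gf e| * e * (C * (X / e) ^ δ) := by gcongr
      _ = _ := by
        rw [Real.div_rpow hX.le he0.le, Real.rpow_sub he0, Real.rpow_one]; ring
  have h5 := tsum_of_norm_bounded (hg.mul_left (C * X ^ δ)) h2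
  rw [h1.tsum_eq, Real.norm_eq_abs] at h5
  calc _ = _ := by rw [aCube]; congr 1; ring
    _ ≤ _ := h5
    _ ≤ C * (G + 1) * X ^ δ := by
      have : 0 ≤ C * X ^ δ := by positivity
      nlinarith

/-- The asymptotic expansion of `Φ`. -/
theorem PhiX_approx {δ : ℝ} (hδ0 : 0 < δ) (hδ1 : δ < 1 / 3) :
    ∃ C : ℝ, 0 < C ∧ ∀ X : ℝ, 0 < X →
      |PhiX X - (Ainv * X ^ 2 * Real.log X + ((γ - 3 / 2) * Ainv - Alog) * X ^ 2 + Jtot * X +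
        aCube * X ^ (1 / 3 : ℝ))| ≤ C * X ^ δ := by
  obtain ⟨C, hC, h⟩ := tsum_psiH_double_approx hδ0 hδ1
  refine ⟨C, hC, fun X hX => ?_⟩
  have hs := hasSum_Jd_mul (F := fun n : ℕ => (n : ℝ) * psiH (X / n)) (summable_psiH_double hX)
  have h1 := ((((hasSum_Ainv.mul_left (X ^ 2 * Real.log X)).sub (hasSum_Alog.mul_left (X ^ 2))).add
    (hasSum_Ainv.mul_left ((γ - 3 / 2) * X ^ 2))).add (hasSum_Jtot.mul_left X)).add hs
  have e : ∀ d : ℕ, Jd d * (d * phiH (X / d)) =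
      X ^ 2 * Real.log X * (Jd d * (d : ℝ)⁻¹) - X ^ 2 * (Jd d * (Real.log d / d)) +
      (γ - 3 / 2) * X ^ 2 * (Jd d * (d : ℝ)⁻¹) + X * Jd d + Jd d * (d * psiH (X / d)) := by
    intro d
    rcases Nat.eq_zero_or_pos d with rfl | h0
    · simp [Jd_zero]
    · have hd0 : (0 : ℝ) < d := by exact_mod_cast h0
      rw [psiH, Real.log_div hX.ne' hd0.ne']
      field_simp; ring
  have h2 := hasSum_PhiX X
  simp only [e] at h2
  rw [h2.unique h1]
  refine le_trans (le_of_eq ?_) (h X hX)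
  congr 1; ring

lemma sum_progression {k : ℕ} (hk : 0 < k) (f : ℕ → ℝ) (hf : f 0 = 0) {n N : ℕ} (hn : n ≤ N)
    (t : ℕ) : ∑ l ∈ Ioc t N, f (n - k * l) =
      ∑ m ∈ (Icc 1 (n - k * (t + 1))).filter (fun m => m % k = n % k), f m := by
  have h1 : ∑ l ∈ Ioc t N, f (n - k * l) =
      ∑ l ∈ (Ioc t N).filter (fun l => k * l < n), f (n - k * l) := by
    rw [Finset.sum_filter]
    refine Finset.sum_congr rfl fun l _ => ?_
    split_ifs with h
    · rfl
    · rw [Nat.sub_eq_zero_of_le (not_lt.1 h), hf]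
  rw [h1]
  refine Finset.sum_bij' (fun l _ => n - k * l) (fun m _ => (n - m) / k) ?_ ?_ ?_ ?_ ?_
  · intro l hl
    simp only [Finset.mem_filter, Finset.mem_Ioc, Finset.mem_Icc] at hl ⊢
    obtain ⟨⟨h1, h2⟩, h3⟩ := hl
    refine ⟨⟨by omega, Nat.sub_le_sub_left (Nat.mul_le_mul_left k h1) n⟩, ?_⟩
    conv_rhs => rw [← Nat.sub_add_cancel h3.le]
    simp
  · intro m hm
    simp only [Finset.mem_filter, Finset.mem_Ioc, Finset.mem_Icc] at hm ⊢
    obtain ⟨⟨h1, h2⟩, h3⟩ := hm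
    have h4 : k ∣ n - m := (Nat.modEq_iff_dvd' (by omega)).1 h3
    obtain ⟨l, hl⟩ := h4
    rw [hl, Nat.mul_div_cancel_left _ hk]
    have h5 : k * (t + 1) ≤ k * l := by omega
    have h6 := Nat.le_of_mul_le_mul_left h5 hk
    have h7 : l ≤ k * l := Nat.le_mul_of_pos_left l hk
    omega
  · intro l hl
    simp only [Finset.mem_filter] at hl
    rw [Nat.sub_sub_self hl.2.le, Nat.mul_div_cancel_left _ hk]
  · intro m hm
    simp only [Finset.mem_filter, Finset.mem_Icc] at hm
    obtain ⟨⟨h1, h2⟩, h3⟩ := hm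
    have h4 : k ∣ n - m := (Nat.modEq_iff_dvd' (by omega)).1 h3
    rw [Nat.mul_div_cancel' h4]
    omega
  · intro l _; rfl

lemma rthree_zero : rthree 0 = 0 := by
  rw [rthree_eq (le_refl 0)]; simp

/-- The correlation `Σ_{n ≤ N} r₃(n) r₃(n - h)`. -/
noncomputable def pc (N h : ℕ) : ℝ := ∑ n ∈ Icc 1 N, (rthree n : ℝ) * rthree (n - h)

lemma pc_eq_zero {N h : ℕ} (hh : N ≤ h) : pc N h = 0 := by
  refine Finset.sum_eq_zero fun n hn => ?_
  rw [Nat.sub_eq_zero_of_le ((Finset.mem_Icc.1 hn).2.trans hh), rthree_zero]; simp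

noncomputable def Zs (N t : ℕ) : ℝ := 2 * ∑ l ∈ Ioc t N, ∑ k ∈ Icc 1 N, pc N (k * l)

lemma sum_Athree_sq (x : ℝ) {q : ℕ} (hq : 0 < q) :
    ∑ a ∈ Icc 1 q, Athree x q a ^ 2 = RR x + 2 * ∑ k ∈ Icc 1 ⌊x⌋₊, pc ⌊x⌋₊ (k * q) := by
  set N := ⌊x⌋₊ with hN
  have h1 := sum_mul_periodic_real hq (Icc 1 N) (fun n => (rthree n : ℝ)) (Athree x q)
    (fun m n h => by unfold Athree; rw [h])
  have h2 : ∑ a ∈ Icc 1 q, Athree x q a ^ 2 = ∑ n ∈ Icc 1 N, (rthree n : ℝ) * Athree x q n := by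
    rw [h1]
    refine Finset.sum_congr rfl fun a _ => ?_
    rw [sq]; rfl
  rw [h2]
  have hlt : ∀ n ∈ Icc 1 N, ∑ m ∈ Icc 1 N, (if m % q = n % q ∧ m < n then (rthree m : ℝ) else 0) =
      ∑ k ∈ Icc 1 N, (rthree (n - k * q) : ℝ) := by
    intro n hn
    have h := sum_progression hq (fun m => (rthree m : ℝ)) (by simp [rthree_zero])
      (Finset.mem_Icc.1 hn).2 0
    have e : Ioc 0 N = Icc 1 N := by ext; simp [Nat.succ_le_iff]
    rw [e] at h
    simp only [mul_comm q] at h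
    rw [h, ← Finset.sum_filter]
    refine Finset.sum_congr ?_ fun _ _ => rfl
    ext m
    simp only [Finset.mem_filter, Finset.mem_Icc] at hn ⊢
    constructor
    · rintro ⟨⟨a, b⟩, c, d⟩
      have h4 : q ∣ n - m := (Nat.modEq_iff_dvd' (by omega)).1 c
      have := Nat.le_of_dvd (by omega) h4
      refine ⟨⟨a, by omega⟩, c⟩
    · rintro ⟨⟨a, b⟩, c⟩
      refine ⟨⟨a, by omega⟩, c, by omega⟩
  have hS : ∑ k ∈ Icc 1 N, pc N (k * q) = ∑ n ∈ Icc 1 N, ∑ m ∈ Icc 1 N,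
      (rthree n : ℝ) * (if m % q = n % q ∧ m < n then (rthree m : ℝ) else 0) := by
    unfold pc
    rw [Finset.sum_comm]
    refine Finset.sum_congr rfl fun n hn => ?_
    rw [← Finset.mul_sum, ← Finset.mul_sum, hlt n hn]
  have hS' : ∑ k ∈ Icc 1 N, pc N (k * q) = ∑ n ∈ Icc 1 N, ∑ m ∈ Icc 1 N,
      (rthree n : ℝ) * (if m % q = n % q ∧ n < m then (rthree m : ℝ) else 0) := by
    rw [hS, Finset.sum_comm]
    refine Finset.sum_congr rfl fun m _ => Finset.sum_congr rfl fun n _ => ?_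
    by_cases h : m % q = n % q ∧ m < n
    · rw [if_pos h, if_pos ⟨h.1.symm, h.2⟩]; ring
    · rw [if_neg h, if_neg (fun h' => h ⟨h'.1.symm, h'.2⟩)]; ring
  have hR : RR x = ∑ n ∈ Icc 1 N, ∑ m ∈ Icc 1 N,
      (rthree n : ℝ) * (if m = n then (rthree m : ℝ) else 0) := by
    refine Finset.sum_congr rfl fun n hn => ?_
    rw [← Finset.mul_sum, Finset.sum_ite_eq' , if_pos hn, sq]
  rw [two_mul]
  nth_rw 2 [hS']
  rw [hS, hR, ← Finset.sum_add_distrib, ← Finset.sum_add_distrib]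
  refine Finset.sum_congr rfl fun n _ => ?_
  rw [← Finset.sum_add_distrib, ← Finset.sum_add_distrib, Athree, Finset.sum_filter,
    Finset.mul_sum]
  refine Finset.sum_congr rfl fun m _ => ?_
  rw [← mul_add, ← mul_add]
  congr 1
  rcases lt_trichotomy m n with h | h | h
  · simp [h.ne, h, h.le.not_gt]
  · simp [h]
  · simp [h.ne', h, h.le.not_gt]

/-- The sum of `Σ r₃ s_q / q` over the moduli up to `t`. -/
noncomputable def Bsum (x : ℝ) (t : ℕ) : ℝ :=
  ∑ q ∈ Icc 1 t, (∑ n ∈ Icc 1 ⌊x⌋₊, (rthree n : ℝ) * sk q n) / q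

lemma Wq_div_eq (x : ℝ) {q : ℕ} (hq : 0 < q) : Wq x q / q =
    RR x + 2 * ∑ k ∈ Icc 1 ⌊x⌋₊, pc ⌊x⌋₊ (k * q) -
      2 * x * ((∑ n ∈ Icc 1 ⌊x⌋₊, (rthree n : ℝ) * sk q n) / q) + cG ^ 2 * x ^ 2 * (Hq q / q) := by
  have hq' : (q : ℝ) ≠ 0 := by positivity
  rw [Wq_eq hq, mul_div_cancel_left₀ _ hq', ← sum_Athree_sq x hq,
    sum_mul_periodic_real hq _ _ _ (fun m n h => sk_congr h)]
  have h : cG ^ 2 * x ^ 2 * (Hq q / q) = ∑ a ∈ Icc 1 q, x ^ 2 / q ^ 2 * sk q a ^ 2 := by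
    rw [← Finset.mul_sum, sum_sk_sq hq]; field_simp
  rw [h, Finset.sum_div, Finset.mul_sum, ← Finset.sum_sub_distrib, ← Finset.sum_add_distrib]
  refine Finset.sum_congr rfl fun a _ => ?_
  have : ∑ n ∈ (Icc 1 ⌊x⌋₊).filter (fun n => n % q = a % q), (rthree n : ℝ) = Athree x q a := rfl
  rw [this, sk]; field_simp; ring

lemma Vthree_natCast (x : ℝ) (t : ℕ) : Vthree x t =
    t * RR x + Zs ⌊x⌋₊ 0 - Zs ⌊x⌋₊ t - 2 * x * Bsum x t + cG ^ 2 * x ^ 2 * LX t := by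
  set N := ⌊x⌋₊ with hN
  rw [Vthree_eq, Nat.floor_natCast,
    Finset.sum_congr rfl fun q hq => Wq_div_eq x (Finset.mem_Icc.1 hq).1,
    Finset.sum_add_distrib, Finset.sum_sub_distrib, Finset.sum_add_distrib, ← Finset.mul_sum,
    ← Finset.mul_sum, ← Finset.mul_sum]
  have h1 : ∑ q ∈ Icc 1 t, ∑ k ∈ Icc 1 N, pc N (k * q) +
        ∑ l ∈ Ioc t N, ∑ k ∈ Icc 1 N, pc N (k * l) =
      ∑ l ∈ Ioc 0 N, ∑ k ∈ Icc 1 N, pc N (k * l) := by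
    have e : Icc 1 t = Ioc 0 t := by ext; simp [Nat.succ_le_iff]
    rw [e]
    rcases le_total t N with h | h
    · rw [← Finset.sum_Ioc_consecutive _ (Nat.zero_le t) h]
    · rw [Finset.Ioc_eq_empty_of_le h, Finset.sum_empty, add_zero,
        ← Finset.sum_Ioc_consecutive _ (Nat.zero_le N) h]
      rw [add_eq_left]
      refine Finset.sum_eq_zero fun q hq => Finset.sum_eq_zero fun k hk => pc_eq_zero ?_
      have := (Finset.mem_Ioc.1 hq).1
      have hk := (Finset.mem_Icc.1 hk).1
      nlinarith
  rw [Zs, Zs, ← h1]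
  simp only [Finset.sum_const, Nat.card_Icc, nsmul_eq_mul, Bsum, LX]
  push_cast
  simp
  ring

lemma sum_Ioc_periodic {k : ℕ} (f : ℕ → ℝ) (hf : ∀ m n, m % k = n % k → f m = f n) (M : ℕ) :
    ∑ n ∈ Ioc M (M + k), f n = ∑ n ∈ Icc 1 k, f n := by
  induction M with
  | zero =>
    rw [zero_add]; congr 1
  | succ M ih =>
    rw [← ih]
    rcases Nat.eq_zero_or_pos k with rfl | hk
    · simp
    have h1 : Ioc M (M + k + 1) = insert (M + 1) (Ioc (M + 1) (M + 1 + k)) := by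
      ext; simp only [Finset.mem_Ioc, Finset.mem_insert]; omega
    have h2 : Ioc M (M + k + 1) = insert (M + k + 1) (Ioc M (M + k)) := by
      ext; simp only [Finset.mem_Ioc, Finset.mem_insert]; omega
    have h3 : ∑ n ∈ Ioc M (M + k + 1), f n = f (M + 1) + ∑ n ∈ Ioc (M + 1) (M + 1 + k), f n := by
      rw [h1, Finset.sum_insert (by simp)]
    rw [h2, Finset.sum_insert (by simp)] at h3
    have h4 : f (M + k + 1) = f (M + 1) := hf _ _ (by
      rw [show M + k + 1 = M + 1 + k by ring, Nat.add_mod_right])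
    linarith

lemma sum_periodic_le {k : ℕ} (hk : 0 < k) (f : ℕ → ℝ) (hf : ∀ m n, m % k = n % k → f m = f n)
    (hf0 : ∀ n, 0 ≤ f n) (N : ℕ) :
    ∑ n ∈ Icc 1 N, f n ≤ ((N / k : ℝ) + 1) * ∑ n ∈ Icc 1 k, f n := by
  have h := sum_mul_periodic_real hk (Icc 1 N) (fun _ => 1) f hf
  simp only [one_mul] at h
  rw [h, Finset.mul_sum]
  refine Finset.sum_le_sum fun a _ => mul_le_mul_of_nonneg_right ?_ (hf0 a)
  rw [Finset.sum_const, nsmul_eq_mul, mul_one]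
  calc _ ≤ ((N / k + 1 : ℕ) : ℝ) := by exact_mod_cast card_filter_mod_le k N a
    _ ≤ _ := by push_cast; gcongr; exact Nat.cast_div_le

lemma abs_card_filter_mod_sub_le {k : ℕ} (hk : 0 < k) (y a : ℕ) :
    |(#((Icc 1 y).filter (fun n => n % k = a % k)) : ℝ) - y / k| ≤ 1 := by
  have h := Nat.Ioc_filter_modEq_card 0 y hk a
  have e : (Ioc 0 y).filter (fun x => x ≡ a [MOD k]) =
      (Icc 1 y).filter (fun n => n % k = a % k) := by
    have e0 : Ioc 0 y = Icc 1 y := by ext; simp [Nat.succ_le_iff]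
    rw [e0]; rfl
  rw [e] at h
  have hk' : (0 : ℚ) < k := by exact_mod_cast hk
  have h1 := Int.floor_le (((y : ℚ) - a) / k)
  have h2 := Int.lt_floor_add_one (((y : ℚ) - a) / k)
  have h3 := Int.floor_le ((((0 : ℕ) : ℚ) - a) / k)
  have h4 := Int.lt_floor_add_one ((((0 : ℕ) : ℚ) - a) / k)
  have h5 : ((y : ℚ) - a) / k - (((0 : ℕ) : ℚ) - a) / k = y / k := by field_simp; simp
  have h6 : ⌊(((0 : ℕ) : ℚ) - a) / k⌋ ≤ ⌊((y : ℚ) - a) / k⌋ :=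
    Int.floor_le_floor (by rw [← sub_nonneg, h5]; positivity)
  rw [max_eq_left (by linarith)] at h
  have h7 : ((#((Icc 1 y).filter (fun n => n % k = a % k)) : ℤ) : ℚ) =
      (⌊((y : ℚ) - a) / k⌋ : ℚ) - ⌊(((0 : ℕ) : ℚ) - a) / k⌋ := by rw [h]; push_cast; rfl
  have h8 : |(#((Icc 1 y).filter (fun n => n % k = a % k)) : ℚ) - y / k| ≤ 1 := by
    rw [← h5, abs_le]
    simp only [Int.cast_natCast] at h7
    rw [h7]
    constructor <;> linarith
  have h9 := (Rat.cast_le (K := ℝ)).2 h8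
  push_cast at h9
  exact h9

/-- The fluctuation of `r₃` about its expected value modulo `k`. -/
noncomputable def ek (k n : ℕ) : ℝ := if n = 0 then 0 else rthree n - sk k n

noncomputable def Ek (k n y : ℕ) : ℝ := ∑ m ∈ (Icc 1 y).filter (fun m => m % k = n % k), ek k m

lemma Ek_congr {k m n : ℕ} (h : m % k = n % k) (y : ℕ) : Ek k m y = Ek k n y := by
  unfold Ek; rw [h]

lemma ek_zero (k : ℕ) : ek k 0 = 0 := if_pos rfl

lemma Ek_zero (k n : ℕ) : Ek k n 0 = 0 := by simp [Ek]

lemma Ek_eq (k n y : ℕ) : Ek k n y =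
    Athree y k n - sk k n * #((Icc 1 y).filter (fun m => m % k = n % k)) := by
  rw [Ek, Athree, Nat.floor_natCast, mul_comm, ← nsmul_eq_mul, ← Finset.sum_const,
    ← Finset.sum_sub_distrib]
  refine Finset.sum_congr rfl fun m hm => ?_
  rw [Finset.mem_filter, Finset.mem_Icc] at hm
  rw [ek, if_neg (by omega), sk_congr hm.2]

noncomputable def epsk (x : ℝ) (k n : ℕ) : ℝ :=
  (3 + cG) * rhothree k n * (x ^ (1 / 3 : ℝ) / k + 1) ^ 2

lemma abs_Ek_le {x : ℝ} {k : ℕ} (hk : 0 < k) (n : ℕ) {y : ℕ} (hy : (y : ℝ) ≤ x) :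
    |Ek k n y| ≤ epsk x k n := by
  have hc := cG_pos
  have hk1 : (1 : ℝ) ≤ k := by exact_mod_cast hk
  have h1 := abs_Athree_sub_le hk (Nat.cast_nonneg (α := ℝ) y) n
  have h2 := abs_card_filter_mod_sub_le hk y n
  have h3 : (y : ℝ) ^ (1 / 3 : ℝ) ≤ x ^ (1 / 3 : ℝ) :=
    Real.rpow_le_rpow (by positivity) hy (by norm_num)
  have h0 : 0 ≤ (y : ℝ) ^ (1 / 3 : ℝ) := by positivity
  have h4 : sk k n ≤ cG * rhothree k n * (x ^ (1 / 3 : ℝ) / k + 1) ^ 2 := by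
    rw [sk]
    have : (1 : ℝ) ≤ (x ^ (1 / 3 : ℝ) / k + 1) ^ 2 := by
      have : 0 ≤ x ^ (1 / 3 : ℝ) / k := by have := h0.trans h3; positivity
      nlinarith
    calc cG * rhothree k n / k ^ 2 ≤ cG * rhothree k n :=
          div_le_self (by positivity) (one_le_pow₀ hk1)
      _ ≤ _ := le_mul_of_one_le_right (by positivity) this
  have e : Ek k n y = (Athree y k n - cG * y * rhothree k n / k ^ 3) -
      sk k n * (#((Icc 1 y).filter (fun m => m % k = n % k)) - (y : ℝ) / k) := by
    rw [Ek_eq, sk]; field_simp; ring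
  rw [e]
  calc _ ≤ _ := abs_sub _ _
    _ ≤ 3 * rhothree k n * ((y : ℝ) ^ (1 / 3 : ℝ) / k + 1) ^ 2 + sk k n * 1 := by
      rw [abs_mul, abs_of_nonneg (sk_nonneg k n)]
      gcongr
      exact sk_nonneg k n
    _ ≤ 3 * rhothree k n * (x ^ (1 / 3 : ℝ) / k + 1) ^ 2 +
        cG * rhothree k n * (x ^ (1 / 3 : ℝ) / k + 1) ^ 2 := by
      rw [mul_one]; gcongr
    _ = _ := by rw [epsk]; ring

lemma epsk_congr (x : ℝ) {k m n : ℕ} (h : m % k = n % k) : epsk x k m = epsk x k n := by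
  unfold epsk; rw [rhothree_congr h]

lemma sum_epsk_sq_le {x : ℝ} {k : ℕ} (hk : 0 < k) (hkx : (k : ℝ) ≤ x ^ (1 / 3 : ℝ)) (hx : 0 ≤ x) :
    ∑ n ∈ Icc 1 k, epsk x k n ^ 2 ≤ 16 * (3 + cG) ^ 2 * x ^ (4 / 3 : ℝ) * k * Hq k := by
  have hk' : (0 : ℝ) < k := by exact_mod_cast hk
  have hH := Hq_nonneg k
  have h1 : ∑ n ∈ Icc 1 k, epsk x k n ^ 2 =
      (3 + cG) ^ 2 * (x ^ (1 / 3 : ℝ) / k + 1) ^ 4 * (k ^ 5 * Hq k) := by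
    rw [← sum_rhothree_sq hk, Finset.mul_sum]
    refine Finset.sum_congr rfl fun n _ => ?_
    rw [epsk]; ring
  rw [h1]
  have h2 : x ^ (1 / 3 : ℝ) / k + 1 ≤ 2 * x ^ (1 / 3 : ℝ) / k := by
    rw [le_div_iff₀ hk', add_mul, div_mul_cancel₀ _ hk'.ne']; linarith
  have h3 : (x ^ (1 / 3 : ℝ)) ^ 4 = x ^ (4 / 3 : ℝ) := by
    rw [← Real.rpow_natCast, ← Real.rpow_mul hx]; norm_num
  calc _ ≤ (3 + cG) ^ 2 * (2 * x ^ (1 / 3 : ℝ) / k) ^ 4 * (k ^ 5 * Hq k) := by gcongr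
    _ = 16 * (3 + cG) ^ 2 * (x ^ (1 / 3 : ℝ)) ^ 4 * k * Hq k := by field_simp; ring
    _ = _ := by rw [h3]

/-- Summation by parts for the correlation of the fluctuations, averaged over `η` consecutive
starting points. -/
lemma abs_sum_ek_correlation_le {k N η t₀ : ℕ} (hk : 0 < k) (hkN : k ≤ N) (ε : ℕ → ℝ)
    (hε : ∀ m n, m % k = n % k → ε m = ε n) (hE : ∀ n y, y ≤ N → |Ek k n y| ≤ ε n) :
    |∑ j ∈ range η, ∑ l ∈ Ioc (t₀ + j) N, ∑ n ∈ Icc 1 N, ek k n * ek k (n - k * l)| ≤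
      (2 * (N / k + 1) + η) * ∑ n ∈ Icc 1 k, ε n ^ 2 := by
  set M : ℕ → ℝ := fun n => ∑ j ∈ range η, Ek k n (n - k * (t₀ + j + 1)) with hM
  have h1 : ∑ j ∈ range η, ∑ l ∈ Ioc (t₀ + j) N, ∑ n ∈ Icc 1 N, ek k n * ek k (n - k * l) =
      ∑ n ∈ Icc 1 N, ek k n * M n := by
    have : ∀ j ∈ range η, ∑ l ∈ Ioc (t₀ + j) N, ∑ n ∈ Icc 1 N, ek k n * ek k (n - k * l) =
        ∑ n ∈ Icc 1 N, ek k n * Ek k n (n - k * (t₀ + j + 1)) := by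
      intro j _
      rw [Finset.sum_comm]
      refine Finset.sum_congr rfl fun n hn => ?_
      rw [← Finset.mul_sum, sum_progression hk _ (ek_zero k) (Finset.mem_Icc.1 hn).2, Ek]
    rw [Finset.sum_congr rfl this, Finset.sum_comm]
    refine Finset.sum_congr rfl fun n _ => ?_
    rw [hM, Finset.mul_sum]
  set F : ℕ → ℝ := fun n => Ek k n n with hF
  have hstep : ∀ n, 1 ≤ n → ek k n = F n - F (n - k) := by
    intro n hn
    have h2 := sum_progression hk (ek k) (ek_zero k) (le_refl n) 0
    have h3 : F (n - k) = Ek k n (n - k * (0 + 1)) := by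
      rw [zero_add, mul_one]
      rcases le_total n k with h | h
      · rw [hF, Nat.sub_eq_zero_of_le h]; simp [Ek_zero]
      · rw [hF]
        refine Ek_congr ?_ _
        conv_rhs => rw [← Nat.sub_add_cancel h]
        simp
    have h4 : F n = ek k n + Ek k n (n - k * (0 + 1)) := by
      rw [hF, zero_add, mul_one]
      simp only [Ek]
      have : (Icc 1 n).filter (fun m => m % k = n % k) =
          insert n ((Icc 1 (n - k)).filter (fun m => m % k = n % k)) := by
        ext m
        simp only [Finset.mem_filter, Finset.mem_Icc, Finset.mem_insert]
        constructor
        · rintro ⟨⟨a, b⟩, c⟩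
          rcases b.eq_or_lt with rfl | b'
          · exact Or.inl rfl
          · have h4 : k ∣ n - m := (Nat.modEq_iff_dvd' b).1 c
            have := Nat.le_of_dvd (by omega) h4
            exact Or.inr ⟨⟨a, by omega⟩, c⟩
        · rintro (rfl | ⟨⟨a, b⟩, c⟩)
          · exact ⟨⟨hn, le_refl _⟩, rfl⟩
          · exact ⟨⟨a, by omega⟩, c⟩
      rw [this, Finset.sum_insert]
      simp only [Finset.mem_filter, Finset.mem_Icc]
      omega
    rw [h3, h4]; ring
  have h2 : ∑ n ∈ Icc 1 N, ek k n * M n =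
      ∑ n ∈ Icc 1 N, F n * M n - ∑ n ∈ Icc 1 N, F (n - k) * M n := by
    rw [← Finset.sum_sub_distrib]
    refine Finset.sum_congr rfl fun n hn => ?_
    rw [hstep n (Finset.mem_Icc.1 hn).1]; ring
  have h3 : ∑ n ∈ Icc 1 N, F (n - k) * M n = ∑ n ∈ Icc 1 (N - k), F n * M (n + k) := by
    symm
    refine Finset.sum_of_injOn (fun n => n + k) (fun a _ b _ h => Nat.add_right_cancel h) ?_ ?_ ?_
    · intro n hn
      simp only [Finset.coe_Icc, Set.mem_Icc] at hn ⊢; omega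
    · intro n hn hn'
      have : n ≤ k := by
        by_contra hc
        apply hn'
        refine ⟨n - k, ?_, by simp only; omega⟩
        rw [Finset.mem_Icc] at hn
        simp only [Finset.coe_Icc, Set.mem_Icc]; omega
      rw [Nat.sub_eq_zero_of_le this, hF]; simp [Ek_zero]
    · intro n _; simp
  have h4 : ∑ n ∈ Icc 1 N, F n * M n =
      ∑ n ∈ Icc 1 (N - k), F n * M n + ∑ n ∈ Ioc (N - k) N, F n * M n := by
    have e1 : ∀ m, Icc 1 m = Ioc 0 m := fun m => by ext; simp [Nat.succ_le_iff]
    rw [e1, e1, Finset.sum_Ioc_consecutive _ (Nat.zero_le _) (Nat.sub_le _ _)]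
  have hMk : ∀ n, M (n + k) - M n = Ek k n (n - k * t₀) - Ek k n (n - k * (t₀ + η)) := by
    intro n
    rw [hM]
    simp only
    rw [← Finset.sum_sub_distrib]
    have := Finset.sum_range_sub' (fun j => Ek k n (n - k * (t₀ + j))) η
    rw [add_zero] at this
    rw [← this]
    refine Finset.sum_congr rfl fun j _ => ?_
    rw [Ek_congr (Nat.add_mod_right n k), mul_add k (t₀ + j) 1, mul_one, Nat.add_sub_add_right,
      ← add_assoc, mul_add k (t₀ + j) 1, mul_one]
  have hF' : ∀ n, n ≤ N → |F n| ≤ ε n := fun n hn => hE n n hn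
  have hP : (N - k) + k = N := Nat.sub_add_cancel hkN
  have hε2 : ∀ m n, m % k = n % k → ε m ^ 2 = ε n ^ 2 := fun m n h => by rw [hε m n h]
  have b1 : |∑ n ∈ Icc 1 (N - k), F n * (M n - M (n + k))| ≤
      2 * ((N / k + 1) * ∑ n ∈ Icc 1 k, ε n ^ 2) := by
    calc _ ≤ ∑ n ∈ Icc 1 (N - k), |F n * (M n - M (n + k))| := Finset.abs_sum_le_sum_abs _ _
      _ ≤ ∑ n ∈ Icc 1 (N - k), 2 * ε n ^ 2 := by
        refine Finset.sum_le_sum fun n hn => ?_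
        have hn' : n ≤ N := by rw [Finset.mem_Icc] at hn; omega
        rw [abs_mul, abs_sub_comm, hMk]
        have g1 := hF' n hn'
        have g2 : |Ek k n (n - k * t₀) - Ek k n (n - k * (t₀ + η))| ≤ ε n + ε n :=
          (abs_sub _ _).trans (add_le_add (hE n _ (by omega)) (hE n _ (by omega)))
        calc _ ≤ ε n * (ε n + ε n) :=
              mul_le_mul g1 g2 (abs_nonneg _) ((abs_nonneg _).trans g1)
          _ = _ := by ring
      _ ≤ ∑ n ∈ Icc 1 N, 2 * ε n ^ 2 :=
        Finset.sum_le_sum_of_subset_of_nonneg (Finset.Icc_subset_Icc_right (Nat.sub_le _ _))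
          fun _ _ _ => by positivity
      _ ≤ _ := by
        rw [← Finset.mul_sum]
        gcongr
        exact sum_periodic_le hk _ hε2 (fun n => sq_nonneg _) N
  have b2 : |∑ n ∈ Ioc (N - k) N, F n * M n| ≤ η * ∑ n ∈ Icc 1 k, ε n ^ 2 := by
    have hs := sum_Ioc_periodic (fun n => ε n ^ 2) hε2 (N - k)
    rw [hP] at hs
    calc _ ≤ ∑ n ∈ Ioc (N - k) N, |F n * M n| := Finset.abs_sum_le_sum_abs _ _
      _ ≤ ∑ n ∈ Ioc (N - k) N, η * ε n ^ 2 := by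
        refine Finset.sum_le_sum fun n hn => ?_
        have hn' : n ≤ N := (Finset.mem_Ioc.1 hn).2
        have g1 := hF' n hn'
        have g2 : |M n| ≤ η * ε n := by
          calc |M n| ≤ ∑ j ∈ range η, |Ek k n (n - k * (t₀ + j + 1))| :=
                Finset.abs_sum_le_sum_abs _ _
            _ ≤ ∑ j ∈ range η, ε n := Finset.sum_le_sum fun j _ => hE n _ (by omega)
            _ = _ := by simp
        rw [abs_mul]
        calc _ ≤ ε n * (η * ε n) := mul_le_mul g1 g2 (abs_nonneg _) ((abs_nonneg _).trans g1)
          _ = _ := by ring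
      _ = _ := by rw [← Finset.mul_sum, hs]
  have h5 : ∑ n ∈ Icc 1 N, ek k n * M n =
      ∑ n ∈ Icc 1 (N - k), F n * (M n - M (n + k)) + ∑ n ∈ Ioc (N - k) N, F n * M n := by
    rw [h2, h3, h4]
    simp only [mul_sub]
    rw [Finset.sum_sub_distrib]; ring
  rw [h1, h5]
  calc _ ≤ _ := abs_add_le _ _
    _ ≤ _ := add_le_add b1 b2
    _ = _ := by ring

lemma sum_tsub_bounds {k : ℕ} (hk : 0 < k) (N t : ℕ) :
    0 ≤ ((N - k * t : ℕ) : ℝ) ^ 2 / (2 * k) - ∑ l ∈ Ioc t N, ((N - k * l : ℕ) : ℝ) ∧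
    ((N - k * t : ℕ) : ℝ) ^ 2 / (2 * k) - ∑ l ∈ Ioc t N, ((N - k * l : ℕ) : ℝ) ≤ N / 2 := by
  have hk' : (0 : ℝ) < k := by exact_mod_cast hk
  have hN : ∀ l, ((N - k * l : ℕ) : ℝ) ≤ N := fun l => by exact_mod_cast Nat.sub_le _ _
  rcases le_total N t with htN | htN
  · rw [Finset.Ioc_eq_empty_of_le htN]
    have : N - k * t = 0 := Nat.sub_eq_zero_of_le (htN.trans (Nat.le_mul_of_pos_left t hk))
    rw [this]; simp; positivity
  have key : ∀ n, t ≤ n →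
      0 ≤ ((N - k * t : ℕ) : ℝ) ^ 2 / (2 * k) - ((N - k * n : ℕ) : ℝ) ^ 2 / (2 * k) -
        ∑ l ∈ Ioc t n, ((N - k * l : ℕ) : ℝ) ∧
      ((N - k * t : ℕ) : ℝ) ^ 2 / (2 * k) - ((N - k * n : ℕ) : ℝ) ^ 2 / (2 * k) -
        ∑ l ∈ Ioc t n, ((N - k * l : ℕ) : ℝ) ≤
          (((N - k * t : ℕ) : ℝ) - ((N - k * n : ℕ) : ℝ)) / 2 := by
    intro n hn
    induction n, hn using Nat.le_induction with
    | base => simp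
    | succ n hn ih =>
      rw [Finset.sum_Ioc_succ_top hn]
      have h1 : 0 ≤ ((N - k * n : ℕ) : ℝ) ^ 2 / (2 * k) -
          ((N - k * (n + 1) : ℕ) : ℝ) ^ 2 / (2 * k) -
          ((N - k * (n + 1) : ℕ) : ℝ) ∧
          ((N - k * n : ℕ) : ℝ) ^ 2 / (2 * k) - ((N - k * (n + 1) : ℕ) : ℝ) ^ 2 / (2 * k) -
          ((N - k * (n + 1) : ℕ) : ℝ) ≤
          (((N - k * n : ℕ) : ℝ) - ((N - k * (n + 1) : ℕ) : ℝ)) / 2 := by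
        rw [mul_add, mul_one]
        rcases le_total k (N - k * n) with h | h
        · obtain ⟨u, hu⟩ : ∃ u, N - k * n = u + k := ⟨N - k * n - k, by omega⟩
          have hu' : N - (k * n + k) = u := by omega
          rw [hu, hu']
          have e : ((u + k : ℕ) : ℝ) ^ 2 / (2 * k) - (u : ℝ) ^ 2 / (2 * k) - u = k / 2 := by
            push_cast; field_simp; ring
          rw [e]; push_cast
          constructor <;> linarith
        · have hu' : N - (k * n + k) = 0 := by omega
          rw [hu']
          have h' : ((N - k * n : ℕ) : ℝ) ≤ k := by exact_mod_cast h
          have h0 : (0 : ℝ) ≤ ((N - k * n : ℕ) : ℝ) := Nat.cast_nonneg _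
          constructor
          · simp; positivity
          · simp only [Nat.cast_zero, ne_eq, OfNat.ofNat_ne_zero, not_false_eq_true, zero_pow,
              zero_div, sub_zero]
            rw [div_le_div_iff₀ (by positivity) (by norm_num)]
            nlinarith
      constructor <;> linarith [ih.1, ih.2, h1.1, h1.2]
  have h := key N htN
  have h0 : N - k * N = 0 := Nat.sub_eq_zero_of_le (Nat.le_mul_of_pos_left N hk)
  rw [h0] at h
  simp only [Nat.cast_zero, ne_eq, OfNat.ofNat_ne_zero, not_false_eq_true, zero_pow,
              zero_div, sub_zero] at h
  exact ⟨h.1, h.2.trans (by linarith [hN t])⟩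

lemma abs_sum_sk_sq_sub_le {k : ℕ} (hk : 0 < k) (y : ℕ) :
    |∑ n ∈ Icc 1 y, sk k n ^ 2 - cG ^ 2 * Hq k * y| ≤ cG ^ 2 * k * Hq k := by
  have hk' : (k : ℝ) ≠ 0 := by positivity
  have h := sum_mul_periodic_real hk (Icc 1 y) (fun _ => 1) (fun n => sk k n ^ 2)
    (fun m n h => by simp only [sk_congr h])
  simp only [one_mul] at h
  have h1 := sum_sk_sq hk
  have h2 : cG ^ 2 * Hq k * y = ∑ a ∈ Icc 1 k, (y / k : ℝ) * sk k a ^ 2 := by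
    rw [← Finset.mul_sum, h1]; field_simp
  rw [h, h2, ← Finset.sum_sub_distrib, ← h1]
  refine (Finset.abs_sum_le_sum_abs _ _).trans (Finset.sum_le_sum fun a _ => ?_)
  rw [← sub_mul, abs_mul, abs_of_nonneg (sq_nonneg (sk k a)), Finset.sum_const, nsmul_eq_mul,
    mul_one]
  exact mul_le_of_le_one_left (sq_nonneg _) (abs_card_filter_mod_sub_le hk y a)

lemma pc_eq (N k l : ℕ) : pc N (k * l) =
    ∑ n ∈ Icc 1 N, ek k n * ek k (n - k * l) +
      ∑ n ∈ Ioc (k * l) N, (rthree n * sk k n + rthree (n - k * l) * sk k (n - k * l) -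
        sk k n ^ 2) := by
  have h1 : ∀ f : ℕ → ℝ, ∑ n ∈ Ioc (k * l) N, f n =
      ∑ n ∈ Icc 1 N, if k * l < n then f n else 0 := by
    intro f
    rw [← Finset.sum_filter]
    refine Finset.sum_congr ?_ fun _ _ => rfl
    ext n; simp only [Finset.mem_Ioc, Finset.mem_filter, Finset.mem_Icc]; omega
  rw [h1, pc, ← Finset.sum_add_distrib]
  refine Finset.sum_congr rfl fun n hn => ?_
  rw [Finset.mem_Icc] at hn
  split_ifs with h
  · have e : sk k (n - k * l) = sk k n := sk_congr (by
      conv_rhs => rw [← Nat.sub_add_cancel h.le]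
      simp)
    rw [ek, ek, if_neg (by omega), if_neg (by omega), e]; ring
  · rw [Nat.sub_eq_zero_of_le (not_lt.1 h), rthree_zero, ek_zero]; simp

lemma abs_main_sub_le {k N : ℕ} (hk : 0 < k) {D : ℝ}
    (hD : ∀ y, y ≤ N → |∑ n ∈ Icc 1 y, (rthree n : ℝ) * sk k n - cG ^ 2 * Hq k * y| ≤ D)
    {h : ℕ} (hh : h ≤ N) :
    |∑ n ∈ Ioc h N, ((rthree n : ℝ) * sk k n + rthree (n - h) * sk k (n - h) - sk k n ^ 2) -
      cG ^ 2 * Hq k * ((N - h : ℕ) : ℝ)| ≤ 3 * D + 2 * (cG ^ 2 * k * Hq k) := by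
  have e1 : ∀ f : ℕ → ℝ, ∑ n ∈ Ioc h N, f n = ∑ n ∈ Icc 1 N, f n - ∑ n ∈ Icc 1 h, f n := by
    intro f
    have e1 : ∀ m, Icc 1 m = Ioc 0 m := fun m => by ext; simp [Nat.succ_le_iff]
    rw [e1, e1, ← Finset.sum_Ioc_consecutive _ (Nat.zero_le h) hh]; ring
  have e2 : ∑ n ∈ Ioc h N, (rthree (n - h) : ℝ) * sk k (n - h) =
      ∑ n ∈ Icc 1 (N - h), (rthree n : ℝ) * sk k n := by
    symm
    refine Finset.sum_nbij' (fun n => n + h) (fun n => n - h) ?_ ?_ ?_ ?_ ?_ <;>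
      simp only [Finset.mem_Icc, Finset.mem_Ioc] <;> intro n hn
    · omega
    · omega
    · omega
    · omega
    · simp
  rw [Finset.sum_sub_distrib, Finset.sum_add_distrib, e2, e1, e1]
  have a1 := abs_le.1 (hD N le_rfl)
  have a2 := abs_le.1 (hD h hh)
  have a3 := abs_le.1 (hD (N - h) (Nat.sub_le _ _))
  have a4 := abs_le.1 (abs_sum_sk_sq_sub_le hk N)
  have a5 := abs_le.1 (abs_sum_sk_sq_sub_le hk h)
  rw [Nat.cast_sub hh] at a3 ⊢
  rw [abs_le]
  constructor <;> linarith [a1.1, a1.2, a2.1, a2.2, a3.1, a3.2, a4.1, a4.2, a5.1, a5.2]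

lemma abs_sum_pc_sub_le {k N : ℕ} (hk : 0 < k) {D : ℝ}
    (hD : ∀ y, y ≤ N → |∑ n ∈ Icc 1 y, (rthree n : ℝ) * sk k n - cG ^ 2 * Hq k * y| ≤ D) (t : ℕ) :
    |∑ l ∈ Ioc t N, pc N (k * l) - ∑ l ∈ Ioc t N, ∑ n ∈ Icc 1 N, ek k n * ek k (n - k * l) -
      cG ^ 2 * Hq k * (((N - k * t : ℕ) : ℝ) ^ 2 / (2 * k))| ≤
      3 * (N / k * D) + 3 * (cG ^ 2 * Hq k * N) := by
  have hk' : (0 : ℝ) < k := by exact_mod_cast hk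
  have hH := Hq_nonneg k
  have hD0 : 0 ≤ D := (abs_nonneg _).trans (hD 0 (Nat.zero_le _))
  set Mn : ℕ → ℝ := fun l => ∑ n ∈ Ioc (k * l) N,
    ((rthree n : ℝ) * sk k n + rthree (n - k * l) * sk k (n - k * l) - sk k n ^ 2) with hMn
  have h1 : ∑ l ∈ Ioc t N, pc N (k * l) -
      ∑ l ∈ Ioc t N, ∑ n ∈ Icc 1 N, ek k n * ek k (n - k * l) = ∑ l ∈ Ioc t N, Mn l := by
    rw [← Finset.sum_sub_distrib]
    refine Finset.sum_congr rfl fun l _ => ?_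
    rw [pc_eq]; ring
  have h2 : |∑ l ∈ Ioc t N, Mn l - cG ^ 2 * Hq k * ∑ l ∈ Ioc t N, ((N - k * l : ℕ) : ℝ)| ≤
      N / k * (3 * D + 2 * (cG ^ 2 * k * Hq k)) := by
    rw [Finset.mul_sum, ← Finset.sum_sub_distrib]
    have h3 : ∀ l ∈ Ioc t N, |Mn l - cG ^ 2 * Hq k * ((N - k * l : ℕ) : ℝ)| ≤
        if l ∈ Icc 1 (N / k) then 3 * D + 2 * (cG ^ 2 * k * Hq k) else 0 := by
      intro l hl
      rw [Finset.mem_Ioc] at hl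
      split_ifs with h
      · rw [Finset.mem_Icc, Nat.le_div_iff_mul_le hk, mul_comm] at h
        exact abs_main_sub_le hk hD h.2
      · have h' : N < k * l := by
          rw [Finset.mem_Icc, Nat.le_div_iff_mul_le hk, mul_comm] at h
          omega
        rw [Nat.sub_eq_zero_of_le h'.le, hMn]
        simp only
        rw [Finset.Ioc_eq_empty_of_le h'.le]; simp
    calc _ ≤ ∑ l ∈ Ioc t N, if l ∈ Icc 1 (N / k) then 3 * D + 2 * (cG ^ 2 * k * Hq k) else 0 :=
          (Finset.abs_sum_le_sum_abs _ _).trans (Finset.sum_le_sum h3)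
      _ = #((Ioc t N).filter (fun l => l ∈ Icc 1 (N / k))) * (3 * D + 2 * (cG ^ 2 * k * Hq k)) := by
        rw [← Finset.sum_filter, Finset.sum_const, nsmul_eq_mul]
      _ ≤ (N / k : ℕ) * (3 * D + 2 * (cG ^ 2 * k * Hq k)) := by
        gcongr
        calc _ ≤ #(Icc 1 (N / k)) := Finset.card_le_card fun l hl => (Finset.mem_filter.1 hl).2
          _ = _ := by simp
      _ ≤ _ := by gcongr; exact Nat.cast_div_le
  have h4 := sum_tsub_bounds hk N t
  rw [h1]
  have h5 : |cG ^ 2 * Hq k * ∑ l ∈ Ioc t N, ((N - k * l : ℕ) : ℝ) -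
      cG ^ 2 * Hq k * (((N - k * t : ℕ) : ℝ) ^ 2 / (2 * k))| ≤ cG ^ 2 * Hq k * N := by
    rw [← mul_sub, abs_mul, abs_of_nonneg (by positivity : 0 ≤ cG ^ 2 * Hq k)]
    gcongr
    have : (0 : ℝ) ≤ N := Nat.cast_nonneg N
    rw [abs_le]
    constructor <;> linarith [h4.1, h4.2]
  calc _ ≤ _ := abs_sub_le _ (cG ^ 2 * Hq k * ∑ l ∈ Ioc t N, ((N - k * l : ℕ) : ℝ)) _
    _ ≤ _ := add_le_add h2 h5
    _ = _ := by field_simp; ring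

lemma abs_max_sq_sub_le {x : ℝ} (hx : 0 ≤ x) {k : ℕ} (hk : 0 < k) (t : ℕ) :
    |((⌊x⌋₊ - k * t : ℕ) : ℝ) ^ 2 / (2 * k) - max (x - k * t) 0 ^ 2 / (2 * k)| ≤ x := by
  have hk' : (1 : ℝ) ≤ k := by exact_mod_cast hk
  have h1 := Nat.floor_le hx
  have h2 := Nat.lt_floor_add_one x
  set b : ℝ := ((⌊x⌋₊ - k * t : ℕ) : ℝ) with hb
  set a : ℝ := max (x - k * t) 0 with ha
  have hb0 : 0 ≤ b := Nat.cast_nonneg _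
  have hax : a ≤ x := max_le (by nlinarith [Nat.cast_nonneg (α := ℝ) t]) hx
  have hab : b ≤ a ∧ a ≤ b + 1 := by
    rcases le_total (k * t) ⌊x⌋₊ with h | h
    · rw [Nat.cast_sub h] at hb
      push_cast at hb
      refine ⟨le_max_of_le_left (by linarith), max_le (by linarith) (by linarith)⟩
    · have hb' : b = 0 := by rw [hb, Nat.sub_eq_zero_of_le h]; simp
      have h' : (⌊x⌋₊ : ℝ) ≤ k * t := by exact_mod_cast h
      rw [hb']
      exact ⟨le_max_right _ _, max_le (by linarith) (by norm_num)⟩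
  rw [← sub_div, abs_div, abs_of_pos (by positivity : (0 : ℝ) < 2 * k), div_le_iff₀ (by positivity),
    abs_le]
  constructor <;> nlinarith

lemma harm_le_rpow {δ : ℝ} (hδ : 0 < δ) : ∃ C : ℝ, 0 < C ∧ ∀ M : ℕ, harm M ≤ C * (M : ℝ) ^ δ := by
  refine ⟨1 + δ⁻¹, by positivity, fun M => ?_⟩
  rcases Nat.eq_zero_or_pos M with rfl | hM
  · simp [harm]; positivity
  have h1 : harm M ≤ 1 + Real.log M := by rw [harm_eq]; exact harmonic_le_one_add_log M
  have h2 := Real.log_le_rpow_div (Nat.cast_nonneg (α := ℝ) M) hδ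
  have h3 : (1 : ℝ) ≤ (M : ℝ) ^ δ := Real.one_le_rpow (by exact_mod_cast hM) hδ.le
  calc _ ≤ _ := h1
    _ ≤ (M : ℝ) ^ δ + (M : ℝ) ^ δ / δ := by linarith
    _ = _ := by ring

lemma harm_mono {M N : ℕ} (h : M ≤ N) : harm M ≤ harm N :=
  Finset.sum_le_sum_of_subset_of_nonneg (Finset.Icc_subset_Icc_right h)
    fun _ _ _ => by positivity

lemma sum_divisors_div_le (N : ℕ) (g : ℕ → ℝ) (hg : ∀ d, 0 ≤ g d) :
    ∑ k ∈ Icc 1 N, (∑ d ∈ k.divisors, g d) / k ≤ harm N * ∑ d ∈ Icc 1 N, g d / d := by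
  have h := sum_sum_divisors_mul N g (fun k => (k : ℝ)⁻¹)
  simp only [div_eq_mul_inv]
  rw [h, Finset.mul_sum]
  refine Finset.sum_le_sum fun d hd => ?_
  have e : ∑ m ∈ Icc 1 (N / d), (((d * m : ℕ) : ℝ))⁻¹ = (d : ℝ)⁻¹ * harm (N / d) := by
    rw [harm, Finset.mul_sum]
    refine Finset.sum_congr rfl fun m _ => ?_
    push_cast; rw [mul_inv]
  rw [e]
  have h1 := harm_mono (Nat.div_le_self N d)
  have h2 : 0 ≤ g d * (d : ℝ)⁻¹ := mul_nonneg (hg d) (by positivity)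
  calc g d * ((d : ℝ)⁻¹ * harm (N / d)) = g d * (d : ℝ)⁻¹ * harm (N / d) := by ring
    _ ≤ g d * (d : ℝ)⁻¹ * harm N := by gcongr
    _ = _ := by ring

lemma Jtot_pos : 0 < Jtot := tsum_Jd_pos

lemma Hq_le_Jtot (q : ℕ) : Hq q ≤ Jtot := Hq_le_tsum q

lemma Wc_le_of_le {x y : ℝ} (hy : 0 ≤ y) (hyx : y ≤ x) {d : ℕ} (hd : 0 < d)
    (hdx : (d : ℝ) ≤ x ^ (1 / 3 : ℝ)) : Wc y d ≤ 144 * Jtot * d ^ 2 * x ^ (4 / 3 : ℝ) := by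
  have hx : 0 ≤ x := hy.trans hyx
  have h1 : y ^ (1 / 3 : ℝ) ≤ x ^ (1 / 3 : ℝ) := Real.rpow_le_rpow hy hyx (by norm_num)
  have hJ := Jtot_pos
  have h3 : (x ^ (1 / 3 : ℝ)) ^ 4 = x ^ (4 / 3 : ℝ) := by
    rw [← Real.rpow_natCast, ← Real.rpow_mul hx]; norm_num
  calc Wc y d ≤ _ := (Wc_le_Wq y d).trans (Wq_le_lattice hd hy)
    _ ≤ 9 * Jtot * d ^ 2 * (x ^ (1 / 3 : ℝ) + x ^ (1 / 3 : ℝ)) ^ 4 := by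
      have := Hq_nonneg d
      gcongr
      exact Hq_le_Jtot d
    _ = 144 * Jtot * d ^ 2 * (x ^ (1 / 3 : ℝ)) ^ 4 := by ring
    _ = _ := by rw [h3]

lemma sqrt_Wc_le {x y : ℝ} (hy : 0 ≤ y) (hyx : y ≤ x) {d : ℕ} (hd : 0 < d)
    (hdx : (d : ℝ) ≤ x ^ (1 / 3 : ℝ)) : √(Wc y d) ≤ 12 * √Jtot * d * x ^ (2 / 3 : ℝ) := by
  have hx : 0 ≤ x := hy.trans hyx
  apply Real.sqrt_le_iff.2
  refine ⟨by positivity, (Wc_le_of_le hy hyx hd hdx).trans (le_of_eq ?_)⟩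
  have h3 : (x ^ (2 / 3 : ℝ)) ^ 2 = x ^ (4 / 3 : ℝ) := by
    rw [← Real.rpow_natCast, ← Real.rpow_mul hx]; norm_num
  rw [mul_pow, mul_pow, mul_pow, Real.sq_sqrt Jtot_pos.le, h3]; ring

lemma abs_sum_rthree_sk_le {x : ℝ} {k : ℕ} (hk : 0 < k) (hkx : (k : ℝ) ≤ x ^ (1 / 3 : ℝ)) {y : ℕ}
    (hy : (y : ℝ) ≤ x) :
    |∑ n ∈ Icc 1 y, (rthree n : ℝ) * sk k n - cG ^ 2 * Hq k * y| ≤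
      12 * cG * √Jtot * x ^ (2 / 3 : ℝ) * ∑ d ∈ k.divisors, √(Jd d) * d := by
  have h := abs_sum_rthree_mul_sk_sub_le hk (y : ℝ)
  have hc := cG_pos
  rw [Nat.floor_natCast] at h
  have e : cG ^ 2 * (y : ℝ) * Hq k = cG ^ 2 * Hq k * y := by ring
  rw [e] at h
  refine h.trans ?_
  rw [Finset.mul_sum, Finset.mul_sum]
  refine Finset.sum_le_sum fun d hd => ?_
  have hd1 := Nat.pos_of_mem_divisors hd
  have hdk : (d : ℝ) ≤ k := by exact_mod_cast Nat.divisor_le hd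
  calc cG * (√(Jd d) * √(Wc y d)) ≤ cG * (√(Jd d) * (12 * √Jtot * d * x ^ (2 / 3 : ℝ))) := by
        gcongr; exact sqrt_Wc_le (Nat.cast_nonneg _) hy hd1 (hdk.trans hkx)
    _ = _ := by ring

lemma Zs_eq {x : ℝ} (hx : 0 ≤ x) {K : ℕ} (hK : (K : ℝ) ≤ x) {t : ℕ} (ht : x ≤ t * K) :
    Zs ⌊x⌋₊ t = 2 * ∑ k ∈ Icc 1 K, ∑ l ∈ Ioc t ⌊x⌋₊, pc ⌊x⌋₊ (k * l) := by
  rw [Zs, Finset.sum_comm]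
  congr 1
  symm
  refine Finset.sum_subset (Finset.Icc_subset_Icc_right (Nat.le_floor hK)) fun k hk hk' => ?_
  refine Finset.sum_eq_zero fun l hl => pc_eq_zero ?_
  rw [Finset.mem_Icc] at hk hk'
  rw [Finset.mem_Ioc] at hl
  have h1 : K ≤ k := by omega
  have h2 : ⌊x⌋₊ ≤ t * K := by
    have : (⌊x⌋₊ : ℝ) ≤ t * K := (Nat.floor_le hx).trans ht
    exact_mod_cast this
  calc _ ≤ _ := h2
    _ ≤ l * k := Nat.mul_le_mul hl.1.le h1
    _ = _ := mul_comm _ _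

/-- The expected value of the truncated correlation sum. -/
noncomputable def Zmain (x : ℝ) (K t : ℕ) : ℝ :=
  ∑ k ∈ Icc 1 K, Hq k / k * max (x - k * t) 0 ^ 2

lemma abs_sum_pc_main_sub_le {x : ℝ} (hx : 0 ≤ x) {k N : ℕ} (hN : N = ⌊x⌋₊) (hk : 0 < k) {D : ℝ}
    (hD : ∀ y, y ≤ N → |∑ n ∈ Icc 1 y, (rthree n : ℝ) * sk k n - cG ^ 2 * Hq k * y| ≤ D) (t : ℕ) :
    |∑ l ∈ Ioc t N, pc N (k * l) - ∑ l ∈ Ioc t N, ∑ n ∈ Icc 1 N, ek k n * ek k (n - k * l) -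
      cG ^ 2 * (Hq k / k * max (x - k * t) 0 ^ 2) / 2| ≤
      3 * (x / k * D) + 4 * (cG ^ 2 * Jtot * x) := by
  have hk' : (0 : ℝ) < k := by exact_mod_cast hk
  have hH := Hq_nonneg k
  have hHJ := Hq_le_Jtot k
  have hJ := Jtot_pos
  have hD0 : 0 ≤ D := (abs_nonneg _).trans (hD 0 (Nat.zero_le _))
  have hNx : (N : ℝ) ≤ x := hN ▸ Nat.floor_le hx
  have g1 := abs_sum_pc_sub_le hk hD t
  have g2 := abs_max_sq_sub_le hx hk t
  rw [← hN] at g2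
  generalize (∑ l ∈ Ioc t N, pc N (k * l) -
    ∑ l ∈ Ioc t N, ∑ n ∈ Icc 1 N, ek k n * ek k (n - k * l)) = A at g1 ⊢
  generalize (((N - k * t : ℕ) : ℝ) ^ 2 / (2 * k)) = B at g1 g2
  have e : cG ^ 2 * (Hq k / k * max (x - k * t) 0 ^ 2) / 2 =
      cG ^ 2 * Hq k * (max (x - k * t) 0 ^ 2 / (2 * k)) := by field_simp
  rw [e]
  have g3 : |cG ^ 2 * Hq k * B - cG ^ 2 * Hq k * (max (x - k * t) 0 ^ 2 / (2 * k))| ≤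
      cG ^ 2 * Jtot * x := by
    rw [← mul_sub, abs_mul, abs_of_nonneg (by positivity : 0 ≤ cG ^ 2 * Hq k)]
    gcongr
  refine (abs_sub_le _ _ _).trans ((add_le_add g1 g3).trans ?_)
  have g4 : (N : ℝ) / k * D ≤ x / k * D := by gcongr
  have g5 : cG ^ 2 * Hq k * N ≤ cG ^ 2 * Jtot * x := by gcongr
  linarith

lemma abs_sum_ek_correlation_le' {x : ℝ} (hx : 0 ≤ x) {k N : ℕ} (hN : N = ⌊x⌋₊) (hk : 0 < k)
    (hkx : (k : ℝ) ≤ x ^ (1 / 3 : ℝ)) (hkx' : (k : ℝ) ≤ x) (η t₀ : ℕ) :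
    |∑ j ∈ range η, ∑ l ∈ Ioc (t₀ + j) N, ∑ n ∈ Icc 1 N, ek k n * ek k (n - k * l)| ≤
      (2 * (x / k + 1) + η) * (16 * (3 + cG) ^ 2 * x ^ (4 / 3 : ℝ) * k * Jtot) := by
  have hc := cG_pos
  have hNx : (N : ℝ) ≤ x := hN ▸ Nat.floor_le hx
  have h1 := abs_sum_ek_correlation_le (N := N) (η := η) (t₀ := t₀) hk (hN ▸ Nat.le_floor hkx')
    (epsk x k) (fun m n h => epsk_congr x h)
    (fun n y hy => abs_Ek_le hk n (((Nat.cast_le (α := ℝ)).2 hy).trans hNx))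
  have h4 := sum_epsk_sq_le hk hkx hx
  have h5 : 16 * (3 + cG) ^ 2 * x ^ (4 / 3 : ℝ) * k * Hq k ≤
      16 * (3 + cG) ^ 2 * x ^ (4 / 3 : ℝ) * k * Jtot := by
    gcongr; exact Hq_le_Jtot k
  refine h1.trans (mul_le_mul ?_ (h4.trans h5) (Finset.sum_nonneg fun _ _ => sq_nonneg _)
    (by positivity))
  gcongr

lemma abs_sum_Zs_term_le {x : ℝ} (hx : 0 ≤ x) {k : ℕ} (hk : 0 < k)
    (hkx : (k : ℝ) ≤ x ^ (1 / 3 : ℝ)) (hkx' : (k : ℝ) ≤ x) (η t₀ : ℕ) :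
    |∑ j ∈ range η, (∑ l ∈ Ioc (t₀ + j) ⌊x⌋₊, pc ⌊x⌋₊ (k * l) -
      cG ^ 2 * (Hq k / k * max (x - k * (t₀ + j : ℕ)) 0 ^ 2) / 2)| ≤
      (2 * (x / k + 1) + η) * (16 * (3 + cG) ^ 2 * x ^ (4 / 3 : ℝ) * k * Jtot) +
      η * (36 * cG * √Jtot * x ^ (5 / 3 : ℝ) * ((∑ d ∈ k.divisors, √(Jd d) * d) / k) +
        4 * (cG ^ 2 * Jtot * x)) := by
  have hN := Nat.floor_le hx
  have h1 := abs_sum_ek_correlation_le' hx rfl hk hkx hkx' η t₀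
  have h2 := fun j : ℕ => abs_sum_pc_main_sub_le hx rfl hk (fun y hy =>
    abs_sum_rthree_sk_le hk hkx (((Nat.cast_le (α := ℝ)).2 hy).trans hN)) (t₀ + j)
  generalize ⌊x⌋₊ = N at *
  have e1 : ∑ j ∈ range η, (∑ l ∈ Ioc (t₀ + j) N, pc N (k * l) -
      cG ^ 2 * (Hq k / k * max (x - k * (t₀ + j : ℕ)) 0 ^ 2) / 2) =
      ∑ j ∈ range η, ∑ l ∈ Ioc (t₀ + j) N, ∑ n ∈ Icc 1 N, ek k n * ek k (n - k * l) +
      ∑ j ∈ range η, (∑ l ∈ Ioc (t₀ + j) N, pc N (k * l) -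
      ∑ l ∈ Ioc (t₀ + j) N, ∑ n ∈ Icc 1 N, ek k n * ek k (n - k * l) -
      cG ^ 2 * (Hq k / k * max (x - k * (t₀ + j : ℕ)) 0 ^ 2) / 2) := by
    rw [← Finset.sum_add_distrib]
    exact Finset.sum_congr rfl fun j _ => by ring
  rw [e1]
  refine (abs_add_le _ _).trans (add_le_add h1 ?_)
  refine (Finset.abs_sum_le_sum_abs _ _).trans ((Finset.sum_le_sum fun j _ => h2 j).trans ?_)
  rw [Finset.sum_const, Finset.card_range, nsmul_eq_mul]
  refine le_of_eq ?_
  have : x ^ (5 / 3 : ℝ) = x * x ^ (2 / 3 : ℝ) := by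
    rcases hx.eq_or_lt with rfl | hx'
    · rw [Real.zero_rpow (by norm_num), zero_mul]
    · rw [← Real.rpow_one_add' hx (by norm_num)]; norm_num
  rw [this]; ring

/-- The averaged truncated correlation sum agrees with its expected value. -/
lemma abs_sum_Zs_sub_le {δ : ℝ} (hδ : 0 < δ) : ∃ C : ℝ, 0 < C ∧ ∀ x : ℝ, 1 ≤ x →
    ∀ K η t₀ : ℕ, 0 < K → (K : ℝ) ≤ x ^ (1 / 3 : ℝ) → x ≤ η * K → η ≤ t₀ →
    |∑ j ∈ range η, (Zs ⌊x⌋₊ (t₀ + j) - cG ^ 2 * Zmain x K (t₀ + j))| ≤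
      C * η * (K ^ 2 * x ^ (4 / 3 : ℝ) + x ^ (5 / 3 + δ : ℝ)) := by
  obtain ⟨C₁, hC₁, h₁⟩ := harm_le_rpow (half_pos hδ)
  obtain ⟨C₂, hC₂, h₂⟩ := sum_sqrt_Jd_le (half_pos hδ)
  have hc := cG_pos
  have hJ := Jtot_pos
  refine ⟨2 * (5 * (16 * (3 + cG) ^ 2 * Jtot) + 36 * cG * √Jtot * (C₁ * C₂) + 4 * (cG ^ 2 * Jtot)),
    by positivity, fun x hx K η t₀ hK hKx hxη hηt => ?_⟩
  have hx0 : 0 ≤ x := by linarith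
  have hK1 : (1 : ℝ) ≤ K := by exact_mod_cast hK
  have hKx' : (K : ℝ) ≤ x := hKx.trans (by
    calc x ^ (1 / 3 : ℝ) ≤ x ^ (1 : ℝ) := Real.rpow_le_rpow_of_exponent_le hx (by norm_num)
      _ = x := Real.rpow_one x)
  have e1 : ∑ j ∈ range η, (Zs ⌊x⌋₊ (t₀ + j) - cG ^ 2 * Zmain x K (t₀ + j)) =
      2 * ∑ k ∈ Icc 1 K, ∑ j ∈ range η, (∑ l ∈ Ioc (t₀ + j) ⌊x⌋₊, pc ⌊x⌋₊ (k * l) -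
      cG ^ 2 * (Hq k / k * max (x - k * (t₀ + j : ℕ)) 0 ^ 2) / 2) := by
    rw [Finset.sum_comm, Finset.mul_sum]
    refine Finset.sum_congr rfl fun j _ => ?_
    rw [Zs_eq hx0 hKx' (hxη.trans (by gcongr; omega)), Zmain, Finset.sum_sub_distrib, mul_sub,
      ← Finset.sum_div, ← Finset.mul_sum]
    ring
  rw [e1, abs_mul, abs_two]
  have h3 : |∑ k ∈ Icc 1 K, ∑ j ∈ range η, (∑ l ∈ Ioc (t₀ + j) ⌊x⌋₊, pc ⌊x⌋₊ (k * l) -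
      cG ^ 2 * (Hq k / k * max (x - k * (t₀ + j : ℕ)) 0 ^ 2) / 2)| ≤
      ∑ k ∈ Icc 1 K, (η * K * (5 * (16 * (3 + cG) ^ 2 * Jtot)) * x ^ (4 / 3 : ℝ) +
      η * (36 * cG * √Jtot * x ^ (5 / 3 : ℝ) * ((∑ d ∈ k.divisors, √(Jd d) * d) / k) +
        4 * (cG ^ 2 * Jtot * x))) := by
    refine (Finset.abs_sum_le_sum_abs _ _).trans (Finset.sum_le_sum fun k hk => ?_)
    rw [Finset.mem_Icc] at hk
    have hkK : (k : ℝ) ≤ K := by exact_mod_cast hk.2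
    have hk0 : (0 : ℝ) < k := by exact_mod_cast hk.1
    refine (abs_sum_Zs_term_le hx0 hk.1 (hkK.trans hKx) (hkK.trans hKx') η t₀).trans ?_
    gcongr ?_ + _
    have h4 : (2 * (x / k + 1) + η) * k ≤ 5 * (η * K) := by
      have : (2 * (x / k + 1) + η) * k = 2 * x + 2 * k + η * k := by field_simp
      have h5 : (η : ℝ) * k ≤ η * K := by gcongr
      rw [this]; linarith [hkK.trans hKx']
    calc (2 * (x / k + 1) + η) * (16 * (3 + cG) ^ 2 * x ^ (4 / 3 : ℝ) * k * Jtot)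
        = (2 * (x / k + 1) + η) * k * (16 * (3 + cG) ^ 2 * Jtot * x ^ (4 / 3 : ℝ)) := by ring
      _ ≤ 5 * (η * K) * (16 * (3 + cG) ^ 2 * Jtot * x ^ (4 / 3 : ℝ)) := by gcongr
      _ = _ := by ring
  have h6 : ∑ k ∈ Icc 1 K, (∑ d ∈ k.divisors, √(Jd d) * d) / k ≤ C₁ * C₂ * x ^ δ := by
    have g := sum_divisors_div_le K (fun d => √(Jd d) * d) (fun d => by positivity)
    have g1 : ∑ d ∈ Icc 1 K, √(Jd d) * d / d = ∑ d ∈ Icc 1 K, √(Jd d) := by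
      refine Finset.sum_congr rfl fun d hd => ?_
      have : (d : ℝ) ≠ 0 := by have := (Finset.mem_Icc.1 hd).1; positivity
      field_simp
    rw [g1] at g
    have g2 : (K : ℝ) ^ (δ / 2) ≤ x ^ (δ / 2) :=
      Real.rpow_le_rpow (by positivity) hKx' (by positivity)
    calc _ ≤ _ := g
      _ ≤ (C₁ * (K : ℝ) ^ (δ / 2)) * (C₂ * (K : ℝ) ^ (δ / 2)) :=
        mul_le_mul (h₁ K) (h₂ K) (Finset.sum_nonneg fun _ _ => Real.sqrt_nonneg _) (by positivity)
      _ ≤ (C₁ * x ^ (δ / 2)) * (C₂ * x ^ (δ / 2)) := by gcongr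
      _ = C₁ * C₂ * (x ^ (δ / 2) * x ^ (δ / 2)) := by ring
      _ = _ := by rw [← Real.rpow_add (by linarith), add_halves]
  have hpow : x ^ (5 / 3 : ℝ) * x ^ δ = x ^ (5 / 3 + δ : ℝ) :=
    (Real.rpow_add (by linarith) _ _).symm
  have hKxx : (K : ℝ) * x ≤ x ^ (5 / 3 + δ : ℝ) := by
    calc (K : ℝ) * x ≤ x ^ (1 / 3 : ℝ) * x := by gcongr
      _ = x ^ (4 / 3 : ℝ) := by
        rw [← Real.rpow_add_one (by linarith)]; norm_num
      _ ≤ _ := Real.rpow_le_rpow_of_exponent_le hx (by linarith)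
  refine (mul_le_mul_of_nonneg_left h3 zero_le_two).trans ?_
  calc 2 * ∑ k ∈ Icc 1 K, (η * K * (5 * (16 * (3 + cG) ^ 2 * Jtot)) * x ^ (4 / 3 : ℝ) +
      η * (36 * cG * √Jtot * x ^ (5 / 3 : ℝ) * ((∑ d ∈ k.divisors, √(Jd d) * d) / k) +
        4 * (cG ^ 2 * Jtot * x)))
      = 2 * (η * (K ^ 2 * x ^ (4 / 3 : ℝ) * (5 * (16 * (3 + cG) ^ 2 * Jtot)) +
        36 * cG * √Jtot * x ^ (5 / 3 : ℝ) *
          (∑ k ∈ Icc 1 K, (∑ d ∈ k.divisors, √(Jd d) * d) / k) +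
        4 * (cG ^ 2 * Jtot) * (K * x))) := by
          rw [Finset.sum_add_distrib, Finset.sum_const, ← Finset.mul_sum, Finset.sum_add_distrib,
            ← Finset.mul_sum, Finset.sum_const]
          simp only [Nat.card_Icc, Nat.add_sub_cancel, nsmul_eq_mul]
          ring
    _ ≤ 2 * (η * (K ^ 2 * x ^ (4 / 3 : ℝ) * (5 * (16 * (3 + cG) ^ 2 * Jtot)) +
        36 * cG * √Jtot * x ^ (5 / 3 : ℝ) * (C₁ * C₂ * x ^ δ) +
        4 * (cG ^ 2 * Jtot) * x ^ (5 / 3 + δ : ℝ))) := by gcongr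
    _ = 2 * (η * (K ^ 2 * x ^ (4 / 3 : ℝ) * (5 * (16 * (3 + cG) ^ 2 * Jtot)) +
        36 * cG * √Jtot * (C₁ * C₂) * x ^ (5 / 3 + δ : ℝ) +
        4 * (cG ^ 2 * Jtot) * x ^ (5 / 3 + δ : ℝ))) := by rw [← hpow]; ring
    _ ≤ _ := by
      have a1 : 0 ≤ (η : ℝ) * (K ^ 2 * x ^ (4 / 3 : ℝ)) := by positivity
      have a2 : 0 ≤ (η : ℝ) * x ^ (5 / 3 + δ : ℝ) := by positivity
      have b1 : 0 ≤ 5 * (16 * (3 + cG) ^ 2 * Jtot) := by positivity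
      have b2 : 0 ≤ 36 * cG * √Jtot * (C₁ * C₂) + 4 * (cG ^ 2 * Jtot) := by positivity
      have := mul_nonneg a1 b2
      have := mul_nonneg a2 b1
      nlinarith

lemma harm_mul_le {δ : ℝ} (hδ : 0 < δ) : ∃ C : ℝ, 0 < C ∧ ∀ x : ℝ, 1 ≤ x → ∀ t : ℕ,
    (t : ℝ) ≤ 3 * x → harm t ≤ C * x ^ δ := by
  obtain ⟨C, hC, h⟩ := harm_le_rpow hδ
  refine ⟨C * 3 ^ δ, by positivity, fun x hx t ht => (h t).trans ?_⟩
  rw [mul_assoc, ← Real.mul_rpow (by norm_num) (by linarith)]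
  gcongr

lemma sum_sqrt_Jd_mul_le {δ : ℝ} (hδ : 0 < δ) : ∃ C : ℝ, 0 < C ∧ ∀ x : ℝ, 1 ≤ x → ∀ t : ℕ,
    (t : ℝ) ≤ 3 * x → ∑ d ∈ Icc 1 t, √(Jd d) ≤ C * x ^ δ := by
  obtain ⟨C, hC, h⟩ := sum_sqrt_Jd_le hδ
  refine ⟨C * 3 ^ δ, by positivity, fun x hx t ht => (h t).trans ?_⟩
  rw [mul_assoc, ← Real.mul_rpow (by norm_num) (by linarith)]
  gcongr

lemma sqrt_Wc_div_le {c₁ x : ℝ} (hc₁ : 0 < c₁) (hx : 0 ≤ x) (hR : c₁ * x ≤ RR x) {K d : ℕ}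
    (hK : 0 < K) (hKx : (K : ℝ) ≤ x ^ (1 / 3 : ℝ)) (hd : 0 < d) (hdx : (d : ℝ) ≤ 3 * x) :
    √(Jd d) * √(Wc x d) / d ≤
      (12 * √Jtot * x ^ (2 / 3 : ℝ) + √(8 / c₁) * (RR x / K)) * √(Jd d) +
        2 * cG / c₁ * (RR x / K) * Jd d := by
  have hc := cG_pos
  have hRn := RR_nonneg x
  have hd' : (0 : ℝ) < d := by exact_mod_cast hd
  have hK' : (0 : ℝ) < K := by exact_mod_cast hK
  have hJ := Jd_nonneg d
  rcases le_or_gt d K with h | h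
  · have hdK : (d : ℝ) ≤ K := by exact_mod_cast h
    have h1 := sqrt_Wc_le hx le_rfl hd (hdK.trans hKx)
    have h2 : √(Jd d) * √(Wc x d) / d ≤ 12 * √Jtot * x ^ (2 / 3 : ℝ) * √(Jd d) := by
      rw [div_le_iff₀ hd']
      calc _ ≤ √(Jd d) * (12 * √Jtot * d * x ^ (2 / 3 : ℝ)) := by gcongr
        _ = _ := by ring
    have h3 : 0 ≤ √(8 / c₁) * (RR x / K) * √(Jd d) := by positivity
    have h4 : 0 ≤ 2 * cG / c₁ * (RR x / K) * Jd d := by positivity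
    linarith
  · have hdK : (K : ℝ) ≤ d := by exact_mod_cast h.le
    have hxR : x ≤ RR x / c₁ := by rw [le_div_iff₀ hc₁]; linarith
    have h1 : Wc x d ≤ 8 / c₁ * RR x ^ 2 + (2 * cG / c₁ * RR x) ^ 2 * Jd d := by
      calc Wc x d ≤ _ := Wc_le_trivial hx hd
        _ ≤ 2 * (x + 3 * x) * RR x + 4 * cG ^ 2 * x ^ 2 * Jd d := by gcongr; norm_num
        _ = 8 * x * RR x + 4 * cG ^ 2 * x ^ 2 * Jd d := by ring
        _ ≤ 8 * (RR x / c₁) * RR x + 4 * cG ^ 2 * (RR x / c₁) ^ 2 * Jd d := by gcongr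
        _ = _ := by ring
    have h2 : √(Wc x d) ≤ √(8 / c₁) * RR x + 2 * cG / c₁ * RR x * √(Jd d) := by
      apply Real.sqrt_le_iff.2
      refine ⟨by positivity, h1.trans ?_⟩
      have e1 : √(8 / c₁) ^ 2 = 8 / c₁ := Real.sq_sqrt (by positivity)
      have e2 : √(Jd d) ^ 2 = Jd d := Real.sq_sqrt hJ
      have e3 : 0 ≤ (√(8 / c₁) * RR x) * (2 * cG / c₁ * RR x * √(Jd d)) := by positivity
      calc 8 / c₁ * RR x ^ 2 + (2 * cG / c₁ * RR x) ^ 2 * Jd d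
          = (√(8 / c₁) * RR x) ^ 2 + (2 * cG / c₁ * RR x * √(Jd d)) ^ 2 := by
            rw [mul_pow √(8 / c₁), e1, mul_pow _ √(Jd d), e2]
        _ ≤ _ := by rw [add_sq]; linarith
    calc √(Jd d) * √(Wc x d) / d
        ≤ √(Jd d) * (√(8 / c₁) * RR x + 2 * cG / c₁ * RR x * √(Jd d)) / K := by gcongr
      _ = √(8 / c₁) * (RR x / K) * √(Jd d) + 2 * cG / c₁ * (RR x / K) * √(Jd d) ^ 2 := by ring
      _ = √(8 / c₁) * (RR x / K) * √(Jd d) + 2 * cG / c₁ * (RR x / K) * Jd d := by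
          rw [Real.sq_sqrt hJ]
      _ ≤ _ := by
          have : 0 ≤ 12 * √Jtot * x ^ (2 / 3 : ℝ) * √(Jd d) := by positivity
          linarith

lemma sum_Jd_le (s : Finset ℕ) : ∑ d ∈ s, Jd d ≤ Jtot :=
  summable_Jd.sum_le_tsum s fun d _ => Jd_nonneg d

/-- The linear term in the expansion of the variance. -/
lemma abs_Bsum_sub_le {δ c₁ : ℝ} (hδ : 0 < δ) (hc₁ : 0 < c₁) : ∃ C : ℝ, 0 < C ∧
    ∀ x : ℝ, 1 ≤ x → c₁ * x ≤ RR x → ∀ K t : ℕ, 0 < K → (K : ℝ) ≤ x ^ (1 / 3 : ℝ) →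
    (t : ℝ) ≤ 3 * x →
    |2 * x * Bsum x t - 2 * cG ^ 2 * x ^ 2 * LX t| ≤
      C * x ^ δ * (x ^ (5 / 3 : ℝ) + x * RR x / K) := by
  obtain ⟨C₁, hC₁, h₁⟩ := harm_mul_le (half_pos hδ)
  obtain ⟨C₂, hC₂, h₂⟩ := sum_sqrt_Jd_mul_le (half_pos hδ)
  have hc := cG_pos
  have hJ := Jtot_pos
  refine ⟨2 * cG * C₁ * ((12 * √Jtot + √(8 / c₁)) * C₂ + 2 * cG / c₁ * Jtot), by positivity,
    fun x hx hR K t hK hKx ht => ?_⟩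
  have hx0 : 0 ≤ x := by linarith
  have hRn := RR_nonneg x
  have hK' : (0 : ℝ) < K := by exact_mod_cast hK
  have e1 : 2 * x * Bsum x t - 2 * cG ^ 2 * x ^ 2 * LX t =
      2 * x * ∑ q ∈ Icc 1 t,
        ((∑ n ∈ Icc 1 ⌊x⌋₊, (rthree n : ℝ) * sk q n) - cG ^ 2 * x * Hq q) / q := by
    rw [Bsum, LX]
    simp only [sub_div, Finset.sum_sub_distrib, mul_div_assoc, ← Finset.mul_sum]
    ring
  have h3 : |∑ q ∈ Icc 1 t, ((∑ n ∈ Icc 1 ⌊x⌋₊, (rthree n : ℝ) * sk q n) - cG ^ 2 * x * Hq q) / q| ≤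
      cG * (harm t * ∑ d ∈ Icc 1 t, √(Jd d) * √(Wc x d) / d) := by
    refine (Finset.abs_sum_le_sum_abs _ _).trans ?_
    have := sum_divisors_div_le t (fun d => √(Jd d) * √(Wc x d)) (fun d => by positivity)
    refine le_trans ?_ (mul_le_mul_of_nonneg_left this hc.le)
    rw [Finset.mul_sum]
    refine Finset.sum_le_sum fun q hq => ?_
    rw [Finset.mem_Icc] at hq
    rw [abs_div, Nat.abs_cast, ← mul_div_assoc]
    gcongr
    exact abs_sum_rthree_mul_sk_sub_le hq.1 x
  have h4 : ∑ d ∈ Icc 1 t, √(Jd d) * √(Wc x d) / d ≤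
      (12 * √Jtot * x ^ (2 / 3 : ℝ) + √(8 / c₁) * (RR x / K)) * (C₂ * x ^ (δ / 2)) +
        2 * cG / c₁ * (RR x / K) * (Jtot * x ^ (δ / 2)) := by
    have h5 : ∀ d ∈ Icc 1 t, √(Jd d) * √(Wc x d) / d ≤
        (12 * √Jtot * x ^ (2 / 3 : ℝ) + √(8 / c₁) * (RR x / K)) * √(Jd d) +
        2 * cG / c₁ * (RR x / K) * Jd d := by
      intro d hd
      rw [Finset.mem_Icc] at hd
      exact sqrt_Wc_div_le hc₁ hx0 hR hK hKx hd.1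
        (le_trans ((Nat.cast_le (α := ℝ)).2 hd.2) ht)
    refine (Finset.sum_le_sum h5).trans ?_
    rw [Finset.sum_add_distrib, ← Finset.mul_sum, ← Finset.mul_sum]
    have h6 : (1 : ℝ) ≤ x ^ (δ / 2) := Real.one_le_rpow hx (by positivity)
    have h7 : ∑ d ∈ Icc 1 t, Jd d ≤ Jtot * x ^ (δ / 2) :=
      (sum_Jd_le _).trans (le_mul_of_one_le_right hJ.le h6)
    gcongr
    exact h₂ x hx t ht
  rw [e1, abs_mul, abs_of_nonneg (by positivity : 0 ≤ 2 * x)]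
  have hp : x ^ (δ / 2) * x ^ (δ / 2) = x ^ δ := by
    rw [← Real.rpow_add (by linarith), add_halves]
  have hp2 : x ^ (5 / 3 : ℝ) = x * x ^ (2 / 3 : ℝ) := by
    rw [← Real.rpow_one_add' hx0 (by norm_num)]; norm_num
  have hW : 0 ≤ ∑ d ∈ Icc 1 t, √(Jd d) * √(Wc x d) / d :=
    Finset.sum_nonneg fun _ _ => by positivity
  calc _ ≤ 2 * x * (cG * (C₁ * x ^ (δ / 2) *
        ((12 * √Jtot * x ^ (2 / 3 : ℝ) + √(8 / c₁) * (RR x / K)) * (C₂ * x ^ (δ / 2)) +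
        2 * cG / c₁ * (RR x / K) * (Jtot * x ^ (δ / 2))))) := by
        refine mul_le_mul_of_nonneg_left (h3.trans ?_) (by positivity)
        refine mul_le_mul_of_nonneg_left ?_ hc.le
        exact mul_le_mul (h₁ x hx t ht) h4 hW (by positivity)
    _ = 2 * cG * C₁ * (x ^ (δ / 2) * x ^ (δ / 2)) * (12 * √Jtot * C₂ * (x * x ^ (2 / 3 : ℝ)) +
        (√(8 / c₁) * C₂ + 2 * cG / c₁ * Jtot) * (x * RR x / K)) := by ring
    _ = 2 * cG * C₁ * x ^ δ * (12 * √Jtot * C₂ * x ^ (5 / 3 : ℝ) +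
        (√(8 / c₁) * C₂ + 2 * cG / c₁ * Jtot) * (x * RR x / K)) := by rw [hp, hp2]
    _ ≤ 2 * cG * C₁ * x ^ δ * (((12 * √Jtot + √(8 / c₁)) * C₂ + 2 * cG / c₁ * Jtot) *
        (x ^ (5 / 3 : ℝ) + x * RR x / K)) := by
        gcongr
        have a1 : 0 ≤ (√(8 / c₁) * C₂ + 2 * cG / c₁ * Jtot) * x ^ (5 / 3 : ℝ) := by positivity
        have a2 : 0 ≤ 12 * √Jtot * C₂ * (x * RR x / K) := by positivity
        linarith
    _ = _ := by ring

lemma sum_Ioc_div_le {g : ℕ → ℝ} {a B : ℝ} (hg : ∀ d, 0 ≤ g d) (ha : 0 ≤ a) (hB : 0 ≤ B)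
    (h : ∀ D : ℕ, 0 < D → ∑ d ∈ Icc 1 D, g d ≤ (2 * D ^ 2 + a) * B) {K M : ℕ} (hK : 0 < K)
    (hKM : K ≤ M) : ∑ d ∈ Ioc K M, g d / d ≤ B * (4 * M + a / K) := by
  have hle : ∀ D, 0 < D → ∑ d ∈ Ioc K D, g d ≤ (2 * D ^ 2 + a) * B := fun D hD =>
    (Finset.sum_le_sum_of_subset_of_nonneg (fun d hd => by
      simp only [Finset.mem_Ioc, Finset.mem_Icc] at *; omega) fun d _ _ => hg d).trans (h D hD)
  have key : ∑ d ∈ Ioc K M, g d / d ≤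
      (∑ d ∈ Ioc K M, g d) / M + B * (2 * M + a * ((K : ℝ)⁻¹ - (M : ℝ)⁻¹)) := by
    induction M, hKM using Nat.le_induction with
    | base => simp; positivity
    | succ M hM ih =>
      have hM0 : (0 : ℝ) < M := by exact_mod_cast hK.trans_le hM
      rw [← Finset.insert_Ioc_right_eq_Ioc_add_one hM, Finset.sum_insert (by simp),
        Finset.sum_insert (by simp)]
      have h1 := hle M (hK.trans_le hM)
      set S := ∑ d ∈ Ioc K M, g d
      have h2 : S / M - S / (M + 1) ≤ B * (2 + a * ((M : ℝ)⁻¹ - ((M : ℝ) + 1)⁻¹)) := by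
        have e1 : S / M - S / (M + 1) = S * (1 / (M * (M + 1))) := by field_simp; ring
        have e2 : B * (2 + a * ((M : ℝ)⁻¹ - ((M : ℝ) + 1)⁻¹)) =
            (2 * (M * (M + 1)) + a) * B * (1 / (M * (M + 1))) := by field_simp; ring
        rw [e1, e2]
        have : (2 * (M : ℝ) ^ 2 + a) * B ≤ (2 * (M * (M + 1)) + a) * B := by
          gcongr; nlinarith
        gcongr
        exact h1.trans this
      push_cast
      rw [add_div (g (M + 1))]
      linarith
  have hM0 : (0 : ℝ) < M := by exact_mod_cast hK.trans_le hKM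
  have h3 : (∑ d ∈ Ioc K M, g d) / M ≤ B * (2 * M + a * (M : ℝ)⁻¹) := by
    rw [div_le_iff₀ hM0]
    refine (hle M (hK.trans_le hKM)).trans (le_of_eq ?_)
    field_simp
  refine key.trans ((add_le_add_left h3 _).trans (le_of_eq ?_))
  rw [div_eq_mul_inv]; ring

/-- The large sieve bound for the variance. -/
lemma Vthree_le {δ c₁ : ℝ} (hδ : 0 < δ) (hc₁ : 0 < c₁) : ∃ C : ℝ, 0 < C ∧
    ∀ x : ℝ, 1 ≤ x → c₁ * x ≤ RR x → ∀ K M : ℕ, 0 < K → (K : ℝ) ≤ x ^ (1 / 3 : ℝ) → K ≤ M →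
    (M : ℝ) ≤ 3 * x →
    Vthree x M ≤ C * x ^ δ * (K ^ 2 * x ^ (4 / 3 : ℝ) + M * RR x + x * RR x / K) := by
  obtain ⟨C₁, hC₁, h₁⟩ := harm_mul_le hδ
  have hc := cG_pos
  have hJ := Jtot_pos
  refine ⟨C₁ * (144 * Jtot + 8 + (16 * Real.pi + 2 * cG ^ 2 / c₁ * Jtot)), by positivity,
    fun x hx hR K M hK hKx hKM hMx => ?_⟩
  have hx0 : 0 ≤ x := by linarith
  have hRn := RR_nonneg x
  have hK' : (0 : ℝ) < K := by exact_mod_cast hK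
  set g : ℕ → ℝ := fun d => ∑ b ∈ (Icc 1 d).filter (fun b => Nat.gcd b d = 1), ‖fsum x d b‖ ^ 2
    with hg
  have hg0 : ∀ d, 0 ≤ g d := fun d => Finset.sum_nonneg fun _ _ => by positivity
  have h2 := sum_Ioc_div_le (a := 8 * Real.pi * x) hg0 (by positivity) hRn
    (fun D hD => large_sieve hx hD) hK hKM
  have h3 : Vthree x M ≤ harm M * ∑ d ∈ Icc 1 M, Wc x d / d := by
    rw [Vthree_eq, Nat.floor_natCast]
    refine le_trans (le_of_eq ?_) (sum_divisors_div_le M (fun d => Wc x d) (Wc_nonneg x))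
    refine Finset.sum_congr rfl fun q hq => ?_
    rw [Wq_eq_sum_divisors x (Finset.mem_Icc.1 hq).1]
  have h4 : ∑ d ∈ Icc 1 K, Wc x d / d ≤ 144 * Jtot * (K ^ 2 * x ^ (4 / 3 : ℝ)) := by
    have : ∀ d ∈ Icc 1 K, Wc x d / d ≤ 144 * Jtot * K * x ^ (4 / 3 : ℝ) := by
      intro d hd
      rw [Finset.mem_Icc] at hd
      have hd0 : (0 : ℝ) < d := by exact_mod_cast hd.1
      have hdK : (d : ℝ) ≤ K := by exact_mod_cast hd.2
      rw [div_le_iff₀ hd0]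
      calc _ ≤ _ := Wc_le_of_le hx0 le_rfl hd.1 (hdK.trans hKx)
        _ = 144 * Jtot * d * x ^ (4 / 3 : ℝ) * d := by ring
        _ ≤ _ := by gcongr
    refine (Finset.sum_le_sum this).trans (le_of_eq ?_)
    rw [Finset.sum_const, Nat.card_Icc, Nat.add_sub_cancel, nsmul_eq_mul]; ring
  have h5 : ∑ d ∈ Ioc K M, Wc x d / d ≤
      2 * (RR x * (4 * M + 8 * Real.pi * x / K)) + 2 * cG ^ 2 * x ^ 2 / K * Jtot := by
    have : ∀ d ∈ Ioc K M, Wc x d / d ≤ 2 * (g d / d) + 2 * cG ^ 2 * x ^ 2 / K * Jd d := by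
      intro d hd
      rw [Finset.mem_Ioc] at hd
      have hd0 : (0 : ℝ) < d := by exact_mod_cast hK.trans hd.1
      have hdK : (K : ℝ) ≤ d := by exact_mod_cast hd.1.le
      have hJd := Jd_nonneg d
      calc Wc x d / d ≤ (2 * g d + 2 * cG ^ 2 * x ^ 2 * Jd d) / d := by
            gcongr; exact Wc_le_sum_fsum hx0 d
        _ = 2 * (g d / d) + 2 * cG ^ 2 * x ^ 2 / d * Jd d := by ring
        _ ≤ _ := by gcongr
    refine (Finset.sum_le_sum this).trans ?_
    rw [Finset.sum_add_distrib, ← Finset.mul_sum, ← Finset.mul_sum]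
    gcongr
    exact sum_Jd_le _
  have hxR : x ≤ RR x / c₁ := by rw [le_div_iff₀ hc₁]; linarith
  have h6 : 2 * cG ^ 2 * x ^ 2 / K * Jtot ≤ 2 * cG ^ 2 / c₁ * Jtot * (x * RR x / K) := by
    calc 2 * cG ^ 2 * x ^ 2 / K * Jtot = 2 * cG ^ 2 * Jtot * (x * x / K) := by ring
      _ ≤ 2 * cG ^ 2 * Jtot * (x * (RR x / c₁) / K) := by gcongr
      _ = _ := by ring
  have e : ∑ d ∈ Icc 1 M, Wc x d / d =
      ∑ d ∈ Icc 1 K, Wc x d / d + ∑ d ∈ Ioc K M, Wc x d / d := by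
    rw [← Finset.sum_union]
    · congr 1; ext d; simp only [Finset.mem_union, Finset.mem_Icc, Finset.mem_Ioc]; omega
    · rw [Finset.disjoint_left]; intro d; simp only [Finset.mem_Icc, Finset.mem_Ioc]; omega
  have hW : 0 ≤ ∑ d ∈ Icc 1 M, Wc x d / d :=
    Finset.sum_nonneg fun d _ => div_nonneg (Wc_nonneg x d) (by positivity)
  refine h3.trans ((mul_le_mul_of_nonneg_right (h₁ x hx M hMx) hW).trans ?_)
  suffices h : ∑ d ∈ Icc 1 M, Wc x d / d ≤
      (144 * Jtot + 8 + (16 * Real.pi + 2 * cG ^ 2 / c₁ * Jtot)) *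
        (K ^ 2 * x ^ (4 / 3 : ℝ) + M * RR x + x * RR x / K) by
    refine (mul_le_mul_of_nonneg_left h (by positivity)).trans (le_of_eq (by ring))
  rw [e]
  have a1 : 0 ≤ (K : ℝ) ^ 2 * x ^ (4 / 3 : ℝ) := by positivity
  have a2 : 0 ≤ M * RR x := by positivity
  have a3 : 0 ≤ x * RR x / K := by positivity
  have hq : 0 ≤ 16 * Real.pi + 2 * cG ^ 2 / c₁ * Jtot := by positivity
  have e2 : 2 * (RR x * (4 * M + 8 * Real.pi * x / K)) =
      8 * (M * RR x) + 16 * Real.pi * (x * RR x / K) := by ring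
  nlinarith [mul_nonneg hJ.le a2, mul_nonneg hJ.le a3, mul_nonneg hq a1, mul_nonneg hq a2]

lemma Zmain_eq {x : ℝ} (hx : 0 ≤ x) {K t : ℕ} (ht : 0 < t) (hxt : x ≤ t * K) :
    Zmain x K t = t ^ 2 * PhiX (x / t) := by
  have ht' : (0 : ℝ) < t := by exact_mod_cast ht
  have hfl : ⌊x / t⌋₊ ≤ K := by
    have : x / t ≤ K := by rw [div_le_iff₀ ht']; linarith
    exact (Nat.floor_le_floor this).trans_eq (Nat.floor_natCast K)
  rw [Zmain, PhiX, Finset.mul_sum]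
  symm
  refine (Finset.sum_congr rfl fun k hk => ?_).trans
    (Finset.sum_subset (Finset.Icc_subset_Icc_right hfl) fun k hk hk' => ?_)
  · rw [Finset.mem_Icc] at hk
    have h1 : (k : ℝ) ≤ x / t := (Nat.le_floor_iff (by positivity)).1 hk.2
    rw [le_div_iff₀ ht'] at h1
    rw [max_eq_left (by linarith)]
    field_simp
  · rw [Finset.mem_Icc] at hk hk'
    have h1 : x / t < k := (Nat.floor_lt (by positivity)).1 (by omega)
    rw [div_lt_iff₀ ht'] at h1
    rw [max_eq_right (by linarith)]; ring

/-- The part of the second-order terms which does not depend on the modulus. -/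
noncomputable def Tmain (x : ℝ) : ℝ :=
  Ainv * x ^ 2 * Real.log x + ((2 * γ - 3 / 2) * Ainv - 2 * Alog) * x ^ 2

lemma abs_PhiX_add_LX_sub_le {δ : ℝ} (hδ : 0 < δ) (hδ' : δ < 1 / 3) : ∃ C : ℝ, 0 < C ∧
    ∀ x : ℝ, 0 < x → ∀ t : ℕ, 0 < t →
    |t ^ 2 * PhiX (x / t) + x ^ 2 * LX t -
      (Tmain x + Jtot * x * t + aCube * (t : ℝ) ^ (5 / 3 : ℝ) * x ^ (1 / 3 : ℝ))| ≤
      C * (t ^ 2 * (x / t) ^ δ + x ^ 2 * (t : ℝ) ^ (-(1 / 2 : ℝ))) := by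
  obtain ⟨C₁, hC₁, h₁⟩ := PhiX_approx hδ hδ'
  obtain ⟨C₂, hC₂, h₂⟩ := LX_approx
  refine ⟨C₁ + C₂, by positivity, fun x hx t ht => ?_⟩
  have ht' : (0 : ℝ) < t := by exact_mod_cast ht
  have g1 := h₁ (x / t) (by positivity)
  have g2 := h₂ t ht
  have e1 : (t : ℝ) ^ 2 * (x / t) ^ (1 / 3 : ℝ) = (t : ℝ) ^ (5 / 3 : ℝ) * x ^ (1 / 3 : ℝ) := by
    rw [Real.div_rpow hx.le ht'.le, ← Real.rpow_natCast, mul_div_assoc', mul_comm, mul_div_assoc,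
      ← Real.rpow_sub ht', mul_comm]
    norm_num
  have e2 : t ^ 2 * PhiX (x / t) + x ^ 2 * LX t -
      (Tmain x + Jtot * x * t + aCube * (t : ℝ) ^ (5 / 3 : ℝ) * x ^ (1 / 3 : ℝ)) =
      t ^ 2 * (PhiX (x / t) - (Ainv * (x / t) ^ 2 * Real.log (x / t) +
        ((γ - 3 / 2) * Ainv - Alog) * (x / t) ^ 2 + Jtot * (x / t) +
        aCube * (x / t) ^ (1 / 3 : ℝ))) +
      x ^ 2 * (LX t - (Ainv * Real.log t + (γ * Ainv - Alog))) := by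
    rw [mul_assoc aCube, ← e1, Tmain, Real.log_div hx.ne' ht'.ne']
    field_simp
    ring
  rw [e2]
  refine (abs_add_le _ _).trans ?_
  rw [abs_mul, abs_mul, abs_of_nonneg (by positivity : 0 ≤ (t : ℝ) ^ 2),
    abs_of_nonneg (by positivity : 0 ≤ x ^ 2)]
  have a1 := mul_le_mul_of_nonneg_left g1 (by positivity : 0 ≤ (t : ℝ) ^ 2)
  have a2 := mul_le_mul_of_nonneg_left g2 (by positivity : 0 ≤ x ^ 2)
  have b1 : 0 ≤ C₂ * (t ^ 2 * (x / t) ^ δ) := by positivity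
  have b2 : 0 ≤ C₁ * (x ^ 2 * (t : ℝ) ^ (-(1 / 2 : ℝ))) := by positivity
  linarith

/-- The main term of the variance. -/
noncomputable def Umain (x t : ℝ) : ℝ :=
  t * RR x - Aone * t * x + -(cG ^ 2 * aCube) * t ^ (5 / 3 : ℝ) * x ^ (1 / 3 : ℝ)

/-- The common error bound, with a free parameter `K`. -/
noncomputable def Ebd (δ x : ℝ) (K : ℕ) : ℝ :=
  x ^ δ * (K ^ 2 * x ^ (4 / 3 : ℝ) + x * RR x / K + x ^ (5 / 3 : ℝ))

noncomputable def Tzero (x : ℝ) : ℝ := Zs ⌊x⌋₊ 0 - cG ^ 2 * Tmain x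

lemma abs_Vthree_add_Zs_sub_le {δ c₁ : ℝ} (hδ : 0 < δ) (hδ' : δ < 1 / 3) (hc₁ : 0 < c₁) :
    ∃ C : ℝ, 0 < C ∧ ∀ x : ℝ, 1 ≤ x → c₁ * x ≤ RR x → ∀ K t : ℕ, 0 < K →
    (K : ℝ) ≤ x ^ (1 / 3 : ℝ) → (t : ℝ) ≤ 3 * x → x ≤ t * K →
    |Vthree x t + (Zs ⌊x⌋₊ t - cG ^ 2 * Zmain x K t) - (Umain x t + Tzero x)| ≤
      C * (Ebd δ x K + t ^ 2 * (x / t) ^ δ) := by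
  obtain ⟨C₁, hC₁, h₁⟩ := abs_PhiX_add_LX_sub_le hδ hδ'
  obtain ⟨C₂, hC₂, h₂⟩ := abs_Bsum_sub_le hδ hc₁
  have hc := cG_pos
  refine ⟨cG ^ 2 * C₁ + C₂, by positivity, fun x hx hR K t hK hKx htx hxt => ?_⟩
  have hx0 : 0 < x := by linarith
  have hRn := RR_nonneg x
  have hK' : (0 : ℝ) < K := by exact_mod_cast hK
  have ht : 0 < t := by
    rcases Nat.eq_zero_or_pos t with rfl | h
    · simp at hxt; linarith
    · exact h
  have ht' : (0 : ℝ) < t := by exact_mod_cast ht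
  have g1 := h₁ x hx0 t ht
  have g2 := h₂ x hx hR K t hK hKx htx
  have hxd : 1 ≤ x ^ δ := Real.one_le_rpow hx hδ.le
  have g3 : x ^ 2 * (t : ℝ) ^ (-(1 / 2 : ℝ)) ≤ x ^ (5 / 3 : ℝ) := by
    have h1 : x ^ (2 / 3 : ℝ) ≤ t := by
      have h2 : x ≤ t * x ^ (1 / 3 : ℝ) := hxt.trans (by gcongr)
      have h3 : x ^ (2 / 3 : ℝ) * x ^ (1 / 3 : ℝ) = x := by
        rw [← Real.rpow_add hx0]; norm_num
      exact le_of_mul_le_mul_right (h3.le.trans h2) (by positivity)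
    have h4 : (t : ℝ) ^ (-(1 / 2 : ℝ)) ≤ (x ^ (2 / 3 : ℝ)) ^ (-(1 / 2 : ℝ)) :=
      Real.rpow_le_rpow_of_nonpos (by positivity) h1 (by norm_num)
    calc _ ≤ x ^ (2 : ℝ) * (x ^ (2 / 3 : ℝ)) ^ (-(1 / 2 : ℝ)) := by
          rw [Real.rpow_two]; gcongr
      _ = _ := by rw [← Real.rpow_mul hx0.le, ← Real.rpow_add hx0]; norm_num
  have e1 : Vthree x t + (Zs ⌊x⌋₊ t - cG ^ 2 * Zmain x K t) - (Umain x t + Tzero x) =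
      -(cG ^ 2 * (t ^ 2 * PhiX (x / t) + x ^ 2 * LX t -
      (Tmain x + Jtot * x * t + aCube * (t : ℝ) ^ (5 / 3 : ℝ) * x ^ (1 / 3 : ℝ)))) -
      (2 * x * Bsum x t - 2 * cG ^ 2 * x ^ 2 * LX t) := by
    have hA : Aone = cG ^ 2 * Jtot := Aone_eq
    rw [Vthree_natCast, Zmain_eq hx0.le ht hxt, Umain, Tzero, hA]
    ring
  rw [e1]
  refine (abs_sub _ _).trans ?_
  rw [abs_neg, abs_mul, abs_of_nonneg (by positivity : 0 ≤ cG ^ 2)]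
  have a1 := mul_le_mul_of_nonneg_left g1 (by positivity : 0 ≤ cG ^ 2)
  have b0 : 0 ≤ (t : ℝ) ^ 2 * (x / t) ^ δ := by positivity
  have b1 : x ^ 2 * (t : ℝ) ^ (-(1 / 2 : ℝ)) ≤ Ebd δ x K := by
    refine g3.trans ?_
    have : 0 ≤ (K : ℝ) ^ 2 * x ^ (4 / 3 : ℝ) + x * RR x / K := by positivity
    have h5 : 0 ≤ x ^ (5 / 3 : ℝ) := by positivity
    rw [Ebd]; nlinarith
  have b2 : C₂ * x ^ δ * (x ^ (5 / 3 : ℝ) + x * RR x / K) ≤ C₂ * Ebd δ x K := by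
    rw [Ebd, mul_assoc]
    have : 0 ≤ (K : ℝ) ^ 2 * x ^ (4 / 3 : ℝ) := by positivity
    gcongr C₂ * (_ * ?_)
    linarith
  have b3 := mul_le_mul_of_nonneg_left b1 (by positivity : 0 ≤ cG ^ 2 * C₁)
  have b4 := mul_nonneg hC₂.le b0
  linarith

lemma abs_rpow_five_thirds_sub_le {a b M : ℝ} (ha : 0 ≤ a) (hb : 0 ≤ b) (haM : a ≤ M)
    (hbM : b ≤ M) : |a ^ (5 / 3 : ℝ) - b ^ (5 / 3 : ℝ)| ≤ 5 * M ^ (2 / 3 : ℝ) * |a - b| := by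
  wlog hab : b ≤ a generalizing a b
  · rw [abs_sub_comm, abs_sub_comm a]
    exact this hb ha hbM haM (le_of_not_ge hab)
  have key : ∀ c : ℝ, 0 ≤ c → c = (c ^ (1 / 3 : ℝ)) ^ 3 ∧ c ^ (5 / 3 : ℝ) = (c ^ (1 / 3 : ℝ)) ^ 5 ∧
      c ^ (2 / 3 : ℝ) = (c ^ (1 / 3 : ℝ)) ^ 2 := by
    intro c hc
    refine ⟨?_, ?_, ?_⟩ <;> rw [← Real.rpow_natCast, ← Real.rpow_mul hc] <;> norm_num
  have h1 : a ^ (2 / 3 : ℝ) ≤ M ^ (2 / 3 : ℝ) := Real.rpow_le_rpow ha haM (by norm_num)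
  have hpq : b ^ (1 / 3 : ℝ) ≤ a ^ (1 / 3 : ℝ) := Real.rpow_le_rpow hb hab (by norm_num)
  have hq : 0 ≤ b ^ (1 / 3 : ℝ) := by positivity
  obtain ⟨a1, a2, a3⟩ := key a ha
  obtain ⟨b1, b2, -⟩ := key b hb
  rw [abs_of_nonneg (sub_nonneg.2 hab), abs_of_nonneg (sub_nonneg.2
    (Real.rpow_le_rpow hb hab (by norm_num)))]
  have h2 : a ^ (5 / 3 : ℝ) - b ^ (5 / 3 : ℝ) ≤ 5 * a ^ (2 / 3 : ℝ) * (a - b) := by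
    rw [a2, b2, a3]
    conv_rhs => rw [a1, b1]
    rw [← a1]
    generalize a ^ (1 / 3 : ℝ) = p at *
    generalize b ^ (1 / 3 : ℝ) = q at *
    have hp : 0 ≤ p := hq.trans hpq
    rw [a1]
    have e : 5 * p ^ 2 * (p ^ 3 - q ^ 3) - (p ^ 5 - q ^ 5) =
        (p - q) * (4 * p ^ 4 + 4 * p ^ 3 * q + 3 * p ^ 2 * q ^ 2 + p ^ 2 * q ^ 2 - p * q ^ 3 -
          q ^ 4) := by ring
    have h3 : p * q ^ 3 ≤ p * p ^ 3 := by gcongr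
    have h4 : q ^ 4 ≤ p ^ 4 := by gcongr
    have h5 : 0 ≤ p ^ 3 * q := by positivity
    have h6 : 0 ≤ p ^ 2 * q ^ 2 := by positivity
    have h7 : 0 ≤ (p - q) * (4 * p ^ 4 + 4 * p ^ 3 * q + 3 * p ^ 2 * q ^ 2 + p ^ 2 * q ^ 2 -
        p * q ^ 3 - q ^ 4) := by
      refine mul_nonneg (sub_nonneg.2 hpq) ?_
      nlinarith
    linarith
  refine h2.trans ?_
  have : 0 ≤ a - b := sub_nonneg.2 hab
  gcongr

lemma abs_Umain_sub_le {c₁ : ℝ} (hc₁ : 0 < c₁) : ∃ C : ℝ, 0 < C ∧ ∀ x : ℝ, 0 ≤ x →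
    c₁ * x ≤ RR x → ∀ s t : ℝ, 0 ≤ s → 0 ≤ t → s ≤ 3 * x → t ≤ 3 * x →
    |Umain x s - Umain x t| ≤ C * (|s - t| * RR x) := by
  refine ⟨1 + |Aone| / c₁ + |cG ^ 2 * aCube| * 15 / c₁, by positivity,
    fun x hx hR s t hs ht hsx htx => ?_⟩
  have hRn := RR_nonneg x
  have hxR : x ≤ RR x / c₁ := by rw [le_div_iff₀ hc₁]; linarith
  have h1 := abs_rpow_five_thirds_sub_le hs ht hsx htx
  have h2 : (3 * x) ^ (2 / 3 : ℝ) * x ^ (1 / 3 : ℝ) ≤ 3 * x := by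
    calc _ ≤ (3 * x) ^ (2 / 3 : ℝ) * (3 * x) ^ (1 / 3 : ℝ) := by gcongr; linarith
      _ = 3 * x := by
        rw [← Real.rpow_add' (by positivity) (by norm_num)]; norm_num
  have e : Umain x s - Umain x t = (s - t) * RR x - Aone * ((s - t) * x) -
      cG ^ 2 * aCube * ((s ^ (5 / 3 : ℝ) - t ^ (5 / 3 : ℝ)) * x ^ (1 / 3 : ℝ)) := by
    rw [Umain, Umain]; ring
  rw [e]
  refine (abs_sub _ _).trans ((add_le_add_left (abs_sub _ _) _).trans ?_)
  simp only [abs_mul, abs_of_nonneg hRn, abs_of_nonneg hx,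
    abs_of_nonneg (by positivity : 0 ≤ x ^ (1 / 3 : ℝ))]
  have h3 : |s ^ (5 / 3 : ℝ) - t ^ (5 / 3 : ℝ)| * x ^ (1 / 3 : ℝ) ≤
      15 * (|s - t| * (RR x / c₁)) := by
    calc _ ≤ 5 * (3 * x) ^ (2 / 3 : ℝ) * |s - t| * x ^ (1 / 3 : ℝ) := by gcongr
      _ = 5 * |s - t| * ((3 * x) ^ (2 / 3 : ℝ) * x ^ (1 / 3 : ℝ)) := by ring
      _ ≤ 5 * |s - t| * (3 * (RR x / c₁)) := by
        refine mul_le_mul_of_nonneg_left ?_ (by positivity)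
        linarith
      _ = _ := by ring
  calc _ ≤ |s - t| * RR x + |Aone| * (|s - t| * (RR x / c₁)) +
        |cG ^ 2| * |aCube| * (15 * (|s - t| * (RR x / c₁))) := by gcongr
    _ = _ := by ring

lemma Vthree_mono {x Q Q' : ℝ} (h : Q ≤ Q') : Vthree x Q ≤ Vthree x Q' := by
  rw [Vthree_eq, Vthree_eq]
  exact Finset.sum_le_sum_of_subset_of_nonneg
    (Finset.Icc_subset_Icc_right (Nat.floor_le_floor h))
    fun q _ _ => div_nonneg (Wq_nonneg x q) (by positivity)

lemma Vthree_nonneg (x Q : ℝ) : 0 ≤ Vthree x Q := by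
  rw [Vthree_eq]
  exact Finset.sum_nonneg fun q _ => div_nonneg (Wq_nonneg x q) (by positivity)

lemma Ebd_nonneg {δ x : ℝ} (hx : 0 ≤ x) (K : ℕ) : 0 ≤ Ebd δ x K := by
  have := RR_nonneg x
  rw [Ebd]; positivity

/-- `t² (x/t)^δ` is monotone in `t`. -/
lemma sq_mul_rpow_mono {δ x s t : ℝ} (hδ : δ ≤ 2) (hx : 0 ≤ x) (hs : 0 < s) (hst : s ≤ t) :
    s ^ 2 * (x / s) ^ δ ≤ t ^ 2 * (x / t) ^ δ := by
  have h : ∀ u : ℝ, 0 < u → u ^ 2 * (x / u) ^ δ = u ^ (2 - δ) * x ^ δ := by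
    intro u hu
    rw [Real.div_rpow hx hu.le, Real.rpow_sub hu, Real.rpow_two]; ring
  rw [h s hs, h t (hs.trans_le hst)]
  have : s ^ (2 - δ) ≤ t ^ (2 - δ) := Real.rpow_le_rpow hs.le hst (by linarith)
  gcongr

lemma sq_mul_rpow_two_mul_le {δ x s t : ℝ} (hδ0 : 0 ≤ δ) (hδ : δ ≤ 2) (hx : 0 ≤ x) (hs : 0 < s)
    (hst : s ≤ 2 * t) : s ^ 2 * (x / s) ^ δ ≤ 4 * (t ^ 2 * (x / t) ^ δ) := by
  have ht : 0 < t := by linarith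
  refine (sq_mul_rpow_mono hδ hx hs hst).trans ?_
  have : (x / (2 * t)) ^ δ ≤ (x / t) ^ δ := by gcongr; linarith
  calc _ ≤ (2 * t) ^ 2 * (x / t) ^ δ := by gcongr
    _ = _ := by ring

/-- The hypotheses on the parameters `K`, `η` used for the averaging argument. -/
structure AvgParam (x : ℝ) (K η : ℕ) : Prop where
  two_le : 2 ≤ K
  le_rpow : (K : ℝ) ≤ x ^ (1 / 3 : ℝ)
  le_mul : x ≤ η * K
  mul_le : (η : ℝ) * K ≤ 2 * x

lemma mul_RR_div_le_Ebd {δ x : ℝ} (hx : 1 ≤ x) (K : ℕ) :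
    x ^ δ * (x * RR x / K) ≤ Ebd δ x K := by
  rw [Ebd]
  gcongr _ * ?_
  have : 0 ≤ (K : ℝ) ^ 2 * x ^ (4 / 3 : ℝ) := by positivity
  have : 0 ≤ x ^ (5 / 3 : ℝ) := by positivity
  linarith

lemma AvgParam.pos {x : ℝ} {K η : ℕ} (h : AvgParam x K η) : (0 : ℝ) < K := by
  exact_mod_cast (zero_lt_two.trans_le h.two_le)

lemma AvgParam.le_div {x : ℝ} {K η : ℕ} (h : AvgParam x K η) : (η : ℝ) ≤ 2 * x / K := by
  rw [le_div_iff₀ h.pos]; exact h.mul_le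

lemma AvgParam.mul_RR_le {δ x : ℝ} {K η : ℕ} (h : AvgParam x K η) (hx : 1 ≤ x) (hδ : 0 ≤ δ) :
    η * RR x ≤ 2 * Ebd δ x K := by
  have hRn := RR_nonneg x
  have hK := h.pos
  calc (η : ℝ) * RR x ≤ 2 * x / K * RR x := by gcongr; exact h.le_div
    _ = 2 * (1 * (x * RR x / K)) := by ring
    _ ≤ 2 * (x ^ δ * (x * RR x / K)) := by gcongr; exact Real.one_le_rpow hx hδ
    _ ≤ _ := by gcongr; exact mul_RR_div_le_Ebd hx K

lemma AvgParam.le_self {x : ℝ} {K η : ℕ} (h : AvgParam x K η) : (η : ℝ) ≤ x := by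
  have h2 : (2 : ℝ) ≤ K := by exact_mod_cast h.two_le
  have := h.mul_le
  nlinarith [Nat.cast_nonneg (α := ℝ) η]

lemma AvgParam.one_le {x : ℝ} {K η : ℕ} (h : AvgParam x K η) (hx : 1 ≤ x) : (1 : ℝ) ≤ η := by
  have : η ≠ 0 := by
    rintro rfl
    have := h.le_mul
    simp at this; linarith
  exact_mod_cast Nat.one_le_iff_ne_zero.2 this

lemma AvgParam.le {x : ℝ} {K η : ℕ} (h : AvgParam x K η) (hx : 1 ≤ x) : K ≤ η := by
  have h1 : (K : ℝ) * K ≤ η * K := by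
    calc (K : ℝ) * K ≤ x ^ (1 / 3 : ℝ) * x ^ (1 / 3 : ℝ) := by gcongr <;> exact h.le_rpow
      _ = x ^ (2 / 3 : ℝ) := by rw [← Real.rpow_add (by linarith)]; norm_num
      _ ≤ x ^ (1 : ℝ) := Real.rpow_le_rpow_of_exponent_le hx (by norm_num)
      _ ≤ _ := by rw [Real.rpow_one]; exact h.le_mul
  exact_mod_cast le_of_mul_le_mul_right h1 h.pos

lemma abs_sum_Vthree_sub_le {δ c₁ : ℝ} (hδ : 0 < δ) (hδ' : δ < 1 / 3) (hc₁ : 0 < c₁) :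
    ∃ C : ℝ, 0 < C ∧ ∀ x : ℝ, 1 ≤ x → c₁ * x ≤ RR x → ∀ K η t₀ : ℕ, AvgParam x K η → η ≤ t₀ →
    (t₀ : ℝ) + η ≤ 3 * x →
    |∑ j ∈ range η, Vthree x (t₀ + j : ℕ) - η * (Umain x t₀ + Tzero x)| ≤
      C * η * (Ebd δ x K + t₀ ^ 2 * (x / t₀) ^ δ) := by
  obtain ⟨C₁, hC₁, h₁⟩ := abs_Vthree_add_Zs_sub_le hδ hδ' hc₁
  obtain ⟨C₂, hC₂, h₂⟩ := abs_sum_Zs_sub_le hδ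
  obtain ⟨C₃, hC₃, h₃⟩ := abs_Umain_sub_le hc₁
  refine ⟨4 * C₁ + C₂ + 2 * C₃, by positivity, fun x hx hR K η t₀ hp hη htx => ?_⟩
  have hx0 : 0 < x := by linarith
  have hRn := RR_nonneg x
  have hK : 0 < K := by have := hp.two_le; omega
  have hK' : (0 : ℝ) < K := by exact_mod_cast hK
  have hη0 : (0 : ℝ) < η := by
    have h := hx0.trans_le hp.le_mul
    exact pos_of_mul_pos_left h hK'.le
  have hηt : (η : ℝ) ≤ t₀ := by exact_mod_cast hη
  have hE := Ebd_nonneg (δ := δ) hx0.le K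
  have hxd : 1 ≤ x ^ δ := Real.one_le_rpow hx hδ.le
  have hF : 0 ≤ (t₀ : ℝ) ^ 2 * (x / t₀) ^ δ := by positivity
  set F := (t₀ : ℝ) ^ 2 * (x / t₀) ^ δ with hFdef
  have g1 : ∀ j ∈ range η, |Vthree x (t₀ + j : ℕ) +
      (Zs ⌊x⌋₊ (t₀ + j) - cG ^ 2 * Zmain x K (t₀ + j)) -
      (Umain x (t₀ + j : ℕ) + Tzero x)| ≤ 4 * C₁ * (Ebd δ x K + F) := by
    intro j hj
    have hj : (j : ℝ) ≤ η := by exact_mod_cast (Finset.mem_range.1 hj).le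
    have hj0 : (0 : ℝ) ≤ j := Nat.cast_nonneg j
    refine (h₁ x hx hR K (t₀ + j) hK hp.le_rpow (by push_cast; linarith)
      (hp.le_mul.trans (by push_cast; gcongr; linarith))).trans ?_
    have := sq_mul_rpow_two_mul_le (δ := δ) (x := x) (s := (t₀ + j : ℕ)) (t := t₀) hδ.le
      (by linarith) hx0.le (by push_cast; linarith) (by push_cast; linarith)
    rw [← hFdef] at this
    nlinarith
  have g2 : ∀ j ∈ range η, |Umain x (t₀ + j : ℕ) - Umain x t₀| ≤ 2 * C₃ * Ebd δ x K := by
    intro j hj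
    have hj : (j : ℝ) ≤ η := by exact_mod_cast (Finset.mem_range.1 hj).le
    have hj0 : (0 : ℝ) ≤ j := Nat.cast_nonneg j
    refine (h₃ x hx0.le hR _ _ (by positivity) (by positivity) (by push_cast; linarith)
      (by linarith)).trans ?_
    have e : ((t₀ + j : ℕ) : ℝ) - t₀ = j := by push_cast; ring
    rw [e, abs_of_nonneg hj0, mul_comm 2 C₃, mul_assoc]
    refine mul_le_mul_of_nonneg_left ?_ hC₃.le
    exact (mul_le_mul_of_nonneg_right hj hRn).trans (hp.mul_RR_le hx hδ.le)
  have g3 : |∑ j ∈ range η, (Zs ⌊x⌋₊ (t₀ + j) - cG ^ 2 * Zmain x K (t₀ + j))| ≤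
      C₂ * η * Ebd δ x K := by
    refine (h₂ x hx K η t₀ hK hp.le_rpow hp.le_mul hη).trans ?_
    gcongr
    rw [Ebd, Real.rpow_add hx0]
    have a1 : 0 ≤ (K : ℝ) ^ 2 * x ^ (4 / 3 : ℝ) := by positivity
    have a2 : 0 ≤ x ^ δ * (x * RR x / K) := by positivity
    nlinarith
  have e : ∑ j ∈ range η, Vthree x (t₀ + j : ℕ) - η * (Umain x t₀ + Tzero x) =
      ∑ j ∈ range η, (Vthree x (t₀ + j : ℕ) + (Zs ⌊x⌋₊ (t₀ + j) - cG ^ 2 * Zmain x K (t₀ + j)) -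
        (Umain x (t₀ + j : ℕ) + Tzero x)) -
      ∑ j ∈ range η, (Zs ⌊x⌋₊ (t₀ + j) - cG ^ 2 * Zmain x K (t₀ + j)) +
      ∑ j ∈ range η, (Umain x (t₀ + j : ℕ) - Umain x t₀) := by
    have : (η : ℝ) * (Umain x t₀ + Tzero x) = ∑ j ∈ range η, (Umain x t₀ + Tzero x) := by
      rw [Finset.sum_const, Finset.card_range, nsmul_eq_mul]
    rw [this, ← Finset.sum_sub_distrib, ← Finset.sum_sub_distrib, ← Finset.sum_add_distrib]
    exact Finset.sum_congr rfl fun j _ => by ring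
  rw [e]
  have k1 := (Finset.abs_sum_le_sum_abs _ _).trans (Finset.sum_le_sum g1)
  have k2 := (Finset.abs_sum_le_sum_abs _ _).trans (Finset.sum_le_sum g2)
  rw [Finset.sum_const, Finset.card_range, nsmul_eq_mul] at k1 k2
  refine (abs_add_le _ _).trans ((add_le_add_left (abs_sub _ _) _).trans
    ((add_le_add (add_le_add k1 g3) k2).trans ?_))
  have : 0 ≤ (C₂ + 2 * C₃) * η * F := by positivity
  linarith

lemma AvgParam.sq_mul_rpow_le {δ c₁ x : ℝ} {K η : ℕ} (h : AvgParam x K η) (hx : 1 ≤ x)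
    (hδ : 0 ≤ δ) (hc₁ : 0 < c₁) (hR : c₁ * x ≤ RR x) :
    (η : ℝ) ^ 2 * (x / η) ^ δ ≤ 4 / c₁ * Ebd δ x K := by
  have hη := h.one_le hx
  have hK := h.pos
  have hK1 : (1 : ℝ) ≤ K := by exact_mod_cast (one_le_two.trans h.two_le)
  have hRn := RR_nonneg x
  have hx0 : 0 < x := by linarith
  have hxR : x ≤ RR x / c₁ := by rw [le_div_iff₀ hc₁]; linarith
  have h1 : x / η ≤ x := div_le_self hx0.le hη
  have h2 : x ^ 2 / K ^ 2 ≤ x * (RR x / c₁) / K := by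
    calc x ^ 2 / (K : ℝ) ^ 2 ≤ x ^ 2 / K := by
          gcongr; nlinarith
      _ = x * x / K := by ring
      _ ≤ _ := by gcongr
  calc (η : ℝ) ^ 2 * (x / η) ^ δ ≤ (2 * x / K) ^ 2 * x ^ δ := by
        gcongr; exact h.le_div
    _ = 4 * (x ^ δ * (x ^ 2 / K ^ 2)) := by ring
    _ ≤ 4 * (x ^ δ * (x * (RR x / c₁) / K)) := by gcongr
    _ = 4 / c₁ * (x ^ δ * (x * RR x / K)) := by ring
    _ ≤ _ := by gcongr; exact mul_RR_div_le_Ebd hx K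

lemma Vthree_two_mul_le {δ c₁ : ℝ} (hδ : 0 < δ) (hc₁ : 0 < c₁) : ∃ C : ℝ, 0 < C ∧
    ∀ x : ℝ, 1 ≤ x → c₁ * x ≤ RR x → ∀ K η : ℕ, AvgParam x K η →
    Vthree x (2 * η : ℕ) ≤ C * Ebd δ x K := by
  obtain ⟨C, hC, h⟩ := Vthree_le hδ hc₁
  refine ⟨5 * C, by positivity, fun x hx hR K η hp => ?_⟩
  have hRn := RR_nonneg x
  have hK := hp.pos
  have hη := hp.le_self
  have hKη := hp.le hx
  refine (h x hx hR K (2 * η) (by exact_mod_cast hK) hp.le_rpow (by omega)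
    (by push_cast; linarith)).trans ?_
  have h1 : ((2 * η : ℕ) : ℝ) * RR x ≤ 4 * (x * RR x / K) := by
    push_cast
    calc 2 * (η : ℝ) * RR x ≤ 2 * (2 * x / K) * RR x := by gcongr; exact hp.le_div
      _ = _ := by ring
  have a1 : 0 ≤ (K : ℝ) ^ 2 * x ^ (4 / 3 : ℝ) := by positivity
  have a2 : 0 ≤ x ^ (5 / 3 : ℝ) := by positivity
  calc _ ≤ C * x ^ δ * (5 * (K ^ 2 * x ^ (4 / 3 : ℝ) + x * RR x / K + x ^ (5 / 3 : ℝ))) := by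
        gcongr; linarith
    _ = _ := by rw [Ebd]; ring

lemma Umain_zero (x : ℝ) : Umain x 0 = 0 := by
  rw [Umain, Real.zero_rpow (by norm_num)]; ring

lemma abs_Umain_le {δ c₁ : ℝ} (hδ : 0 < δ) (hc₁ : 0 < c₁) : ∃ C : ℝ, 0 < C ∧
    ∀ x : ℝ, 1 ≤ x → c₁ * x ≤ RR x → ∀ K η : ℕ, AvgParam x K η → ∀ t : ℝ, 0 ≤ t → t ≤ 2 * η →
    |Umain x t| ≤ C * Ebd δ x K := by
  obtain ⟨C, hC, h⟩ := abs_Umain_sub_le hc₁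
  refine ⟨C * 4, by positivity, fun x hx hR K η hp t ht ht' => ?_⟩
  have hη := hp.le_self
  have h1 := h x (by linarith) hR t 0 ht le_rfl (by linarith) (by linarith)
  rw [Umain_zero, sub_zero, sub_zero, abs_of_nonneg ht] at h1
  refine h1.trans ?_
  rw [mul_assoc]
  refine mul_le_mul_of_nonneg_left ?_ hC.le
  calc t * RR x ≤ 2 * η * RR x := by have := RR_nonneg x; gcongr
    _ = 2 * (η * RR x) := by ring
    _ ≤ _ := by have := hp.mul_RR_le hx hδ.le; linarith

lemma abs_Tzero_le {δ c₁ : ℝ} (hδ : 0 < δ) (hδ' : δ < 1 / 3) (hc₁ : 0 < c₁) : ∃ C : ℝ, 0 < C ∧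
    ∀ x : ℝ, 1 ≤ x → c₁ * x ≤ RR x → ∀ K η : ℕ, AvgParam x K η →
    |Tzero x| ≤ C * Ebd δ x K := by
  obtain ⟨C₁, hC₁, h₁⟩ := abs_sum_Vthree_sub_le hδ hδ' hc₁
  obtain ⟨C₂, hC₂, h₂⟩ := Vthree_two_mul_le hδ hc₁
  obtain ⟨C₃, hC₃, h₃⟩ := abs_Umain_le hδ hc₁
  refine ⟨C₁ * (1 + 4 / c₁) + C₂ + C₃, by positivity, fun x hx hR K η hp => ?_⟩
  have hη := hp.le_self
  have hη1 := hp.one_le hx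
  have hη0 : (0 : ℝ) < η := by linarith
  have g1 := h₁ x hx hR K η η hp le_rfl (by linarith)
  have g2 := h₂ x hx hR K η hp
  have g3 := h₃ x hx hR K η hp η hη0.le (by linarith)
  have g4 := hp.sq_mul_rpow_le hx hδ.le hc₁ hR
  have hE := Ebd_nonneg (δ := δ) (by linarith : 0 ≤ x) K
  have g5 : 0 ≤ ∑ j ∈ range η, Vthree x (η + j : ℕ) :=
    Finset.sum_nonneg fun _ _ => Vthree_nonneg _ _
  have g6 : ∑ j ∈ range η, Vthree x (η + j : ℕ) ≤ η * (C₂ * Ebd δ x K) := by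
    have : ∀ j ∈ range η, Vthree x (η + j : ℕ) ≤ C₂ * Ebd δ x K := by
      intro j hj
      refine (Vthree_mono ?_).trans g2
      have := Finset.mem_range.1 hj
      exact_mod_cast (by omega : η + j ≤ 2 * η)
    refine (Finset.sum_le_sum this).trans_eq ?_
    rw [Finset.sum_const, Finset.card_range, nsmul_eq_mul]
  have g7 : C₁ * η * (Ebd δ x K + (η : ℝ) ^ 2 * (x / η) ^ δ) ≤
      η * (C₁ * (1 + 4 / c₁) * Ebd δ x K) := by
    calc _ ≤ C₁ * η * (Ebd δ x K + 4 / c₁ * Ebd δ x K) := by gcongr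
      _ = _ := by ring
  have g8 : |η * (Umain x η + Tzero x)| ≤ η * ((C₁ * (1 + 4 / c₁) + C₂) * Ebd δ x K) := by
    rw [abs_le] at g1 ⊢
    have a0 : 0 ≤ η * (C₂ * Ebd δ x K) := by positivity
    constructor <;> linarith [g1.1, g1.2]
  rw [abs_mul, abs_of_nonneg hη0.le] at g8
  have g9 := le_of_mul_le_mul_left g8 hη0
  have : |Tzero x| ≤ |Umain x η + Tzero x| + |Umain x η| := by
    have := abs_sub (Umain x η + Tzero x) (Umain x η)
    rwa [add_sub_cancel_left] at this
  linarith

/-- The asymptotic formula at integers, with a free parameter `K`. -/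
lemma abs_Vthree_sub_Umain_le {δ c₁ : ℝ} (hδ : 0 < δ) (hδ' : δ < 1 / 3) (hc₁ : 0 < c₁) :
    ∃ C : ℝ, 0 < C ∧ ∀ x : ℝ, 1 ≤ x → c₁ * x ≤ RR x → ∀ K η : ℕ, AvgParam x K η →
    ∀ t : ℕ, 0 < t → (t : ℝ) ≤ x →
    |Vthree x t - Umain x t| ≤ C * (Ebd δ x K + t ^ 2 * (x / t) ^ δ) := by
  obtain ⟨C₁, hC₁, h₁⟩ := abs_sum_Vthree_sub_le hδ hδ' hc₁
  obtain ⟨C₂, hC₂, h₂⟩ := Vthree_two_mul_le hδ hc₁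
  obtain ⟨C₃, hC₃, h₃⟩ := abs_Umain_le hδ hc₁
  obtain ⟨C₄, hC₄, h₄⟩ := abs_Tzero_le hδ hδ' hc₁
  obtain ⟨C₅, hC₅, h₅⟩ := abs_Umain_sub_le hc₁
  refine ⟨C₁ + C₂ + C₃ + C₄ + 2 * C₅, by positivity, fun x hx hR K η hp t ht htx => ?_⟩
  have hη := hp.le_self
  have hη1 := hp.one_le hx
  have hη0 : (0 : ℝ) < η := by linarith
  have ht' : (0 : ℝ) < t := by exact_mod_cast ht
  have hx0 : 0 < x := by linarith
  have hE := Ebd_nonneg (δ := δ) hx0.le K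
  have hF : 0 ≤ (t : ℝ) ^ 2 * (x / t) ^ δ := by positivity
  have hV := Vthree_nonneg x t
  have p1 := mul_nonneg hC₁.le hE
  have p2 := mul_nonneg hC₂.le hE
  have p3 := mul_nonneg hC₃.le hE
  have p4 := mul_nonneg hC₄.le hE
  have p5 := mul_nonneg hC₅.le hE
  have q1 := mul_nonneg hC₁.le hF
  have q2 := mul_nonneg hC₂.le hF
  have q3 := mul_nonneg hC₃.le hF
  have q4 := mul_nonneg hC₄.le hF
  have q5 := mul_nonneg hC₅.le hF
  rcases le_or_gt t (2 * η) with hcase | hcase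
  · have htη : (t : ℝ) ≤ (2 * η : ℕ) := by exact_mod_cast hcase
    have g1 := (Vthree_mono htη).trans (h₂ x hx hR K η hp)
    have g2 := h₃ x hx hR K η hp t ht'.le (by push_cast at htη; exact htη)
    rw [abs_le] at g2 ⊢
    constructor <;> linarith [g2.1, g2.2]
  · have htη : (2 * η : ℝ) ≤ t := by exact_mod_cast hcase.le
    have g0 := abs_le.1 (h₄ x hx hR K η hp)
    have g1 := abs_le.1 (h₁ x hx hR K η t hp (by omega) (by linarith))
    have e : ((t - η : ℕ) : ℝ) = t - η := by rw [Nat.cast_sub (by omega)]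
    have g2 := abs_le.1 (h₁ x hx hR K η (t - η) hp (by omega) (by rw [e]; linarith))
    have g3 : ((t - η : ℕ) : ℝ) ^ 2 * (x / (t - η : ℕ)) ^ δ ≤ (t : ℝ) ^ 2 * (x / t) ^ δ :=
      sq_mul_rpow_mono (by linarith) hx0.le (by rw [e]; linarith) (by rw [e]; linarith)
    have g4 : |Umain x (t - η : ℕ) - Umain x t| ≤ C₅ * (2 * Ebd δ x K) := by
      refine (h₅ x hx0.le hR _ _ (by rw [e]; linarith) ht'.le (by rw [e]; linarith)
        (by linarith)).trans ?_
      have : |((t - η : ℕ) : ℝ) - t| = η := by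
        rw [e, sub_sub_cancel_left, abs_neg, abs_of_pos hη0]
      rw [this]
      exact mul_le_mul_of_nonneg_left (hp.mul_RR_le hx hδ.le) hC₅.le
    have g4 := abs_le.1 g4
    have k1 : (η : ℝ) * Vthree x t ≤ ∑ j ∈ range η, Vthree x (t + j : ℕ) := by
      have : (η : ℝ) * Vthree x t = ∑ j ∈ range η, Vthree x t := by
        rw [Finset.sum_const, Finset.card_range, nsmul_eq_mul]
      rw [this]
      exact Finset.sum_le_sum fun j _ =>
        Vthree_mono (by push_cast; linarith [Nat.cast_nonneg (α := ℝ) j])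
    have k2 : ∑ j ∈ range η, Vthree x (t - η + j : ℕ) ≤ (η : ℝ) * Vthree x t := by
      have : (η : ℝ) * Vthree x t = ∑ j ∈ range η, Vthree x t := by
        rw [Finset.sum_const, Finset.card_range, nsmul_eq_mul]
      rw [this]
      refine Finset.sum_le_sum fun j hj => Vthree_mono ?_
      have := Finset.mem_range.1 hj
      exact_mod_cast (by omega : t - η + j ≤ t)
    set F := (t : ℝ) ^ 2 * (x / t) ^ δ with hFdef
    have m1 : (η : ℝ) * Vthree x t ≤ η * (Umain x t + Tzero x + C₁ * (Ebd δ x K + F)) := by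
      linarith [g1.2]
    have m2 : (η : ℝ) * (Umain x (t - η : ℕ) + Tzero x - C₁ * (Ebd δ x K + F)) ≤
        η * Vthree x t := by
      have : C₁ * η * (Ebd δ x K + ((t - η : ℕ) : ℝ) ^ 2 * (x / (t - η : ℕ)) ^ δ) ≤
          C₁ * η * (Ebd δ x K + F) := by gcongr
      linarith [g2.1]
    have m3 := le_of_mul_le_mul_left m1 hη0
    have m4 := le_of_mul_le_mul_left m2 hη0
    rw [abs_le]
    constructor <;> linarith [g0.1, g0.2, g4.1, g4.2]

lemma le_of_rpow_le_RR {c₁ x : ℝ} (hc₁ : 0 < c₁) (hx : (8 / c₁) ^ (3 / 2 : ℝ) ≤ x)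
    (hx0 : 0 < x) (hR : c₁ * x ≤ RR x) : 8 ≤ RR x * x ^ (-(1 / 3) : ℝ) := by
  have h1 : 8 / c₁ ≤ x ^ (2 / 3 : ℝ) := by
    have := Real.rpow_le_rpow (by positivity) hx (by norm_num : (0 : ℝ) ≤ 2 / 3)
    rwa [← Real.rpow_mul (by positivity), show (3 / 2 : ℝ) * (2 / 3) = 1 by norm_num,
      Real.rpow_one] at this
  calc (8 : ℝ) = c₁ * (8 / c₁) := by field_simp
    _ ≤ c₁ * x ^ (2 / 3 : ℝ) := by gcongr
    _ = c₁ * x * x ^ (-(1 / 3) : ℝ) := by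
      rw [mul_assoc, ← Real.rpow_one_add' hx0.le (by norm_num)]; norm_num
    _ ≤ _ := by gcongr

lemma exists_avgParam {x m : ℝ} (hx : 1 ≤ x) (hm : 8 ≤ m) (hmx : m ≤ x) :
    ∃ K η : ℕ, AvgParam x K η ∧ (K : ℝ) ≤ m ^ (1 / 3 : ℝ) ∧ m ^ (1 / 3 : ℝ) ≤ 2 * K := by
  set κ := m ^ (1 / 3 : ℝ) with hκ
  have hκ2 : 2 ≤ κ := by
    have := Real.rpow_le_rpow (by norm_num) hm (by norm_num : (0 : ℝ) ≤ 1 / 3)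
    rwa [show (8 : ℝ) = 2 ^ (3 : ℝ) by norm_num, ← Real.rpow_mul (by norm_num),
      show (3 : ℝ) * (1 / 3) = 1 by norm_num, Real.rpow_one] at this
  have hκx : κ ≤ x ^ (1 / 3 : ℝ) := Real.rpow_le_rpow (by linarith) hmx (by norm_num)
  have hK2 : 2 ≤ ⌊κ⌋₊ := Nat.le_floor (by exact_mod_cast hκ2)
  have hKκ : (⌊κ⌋₊ : ℝ) ≤ κ := Nat.floor_le (by linarith)
  have hK2' : (2 : ℝ) ≤ ⌊κ⌋₊ := by exact_mod_cast hK2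
  have hκK := Nat.lt_floor_add_one κ
  have hK0 : (0 : ℝ) < ⌊κ⌋₊ := by linarith
  have hKx : (⌊κ⌋₊ : ℝ) ≤ x := by
    refine (hKκ.trans hκx).trans ?_
    calc x ^ (1 / 3 : ℝ) ≤ x ^ (1 : ℝ) := Real.rpow_le_rpow_of_exponent_le hx (by norm_num)
      _ = x := Real.rpow_one x
  refine ⟨⌊κ⌋₊, ⌈x / ⌊κ⌋₊⌉₊, ⟨hK2, hKκ.trans hκx, ?_, ?_⟩, hKκ, by linarith⟩
  · rw [← div_le_iff₀ hK0]; exact Nat.le_ceil _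
  · have := (Nat.ceil_lt_add_one (a := x / ⌊κ⌋₊) (by positivity)).le
    calc (⌈x / (⌊κ⌋₊ : ℝ)⌉₊ : ℝ) * ⌊κ⌋₊ ≤ (x / ⌊κ⌋₊ + 1) * ⌊κ⌋₊ := by gcongr
      _ = x + ⌊κ⌋₊ := by field_simp
      _ ≤ 2 * x := by linarith

/-- The choice `K ≍ min (R^(1/3) x^(-1/9), x^(1/3))` balances the terms of `Ebd`. -/
lemma exists_avgParam_Ebd_le {δ c₁ : ℝ} (hδ : 0 < δ) (hc₁ : 0 < c₁) :
    ∃ C x₁ : ℝ, 0 < C ∧ 1 ≤ x₁ ∧ ∀ x : ℝ, x₁ ≤ x → c₁ * x ≤ RR x →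
      ∃ K η : ℕ, AvgParam x K η ∧
        Ebd δ x K ≤ C * (x ^ (10 / 9 + 2 * δ) * RR x ^ (2 / 3 : ℝ)) := by
  obtain ⟨C₀, hC₀, h₀⟩ := RR_le hδ
  refine ⟨1 + 2 * (1 + C₀ ^ (1 / 3 : ℝ)) + (1 / c₁) ^ (2 / 3 : ℝ),
    max 8 ((8 / c₁) ^ (3 / 2 : ℝ)), by positivity, by simp, fun x hx hR => ?_⟩
  have hx8 : 8 ≤ x := (le_max_left _ _).trans hx
  have hx1 : 1 ≤ x := by linarith
  have hx0 : 0 < x := by linarith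
  have hR0 : 0 < RR x := (by positivity : 0 < c₁ * x).trans_le hR
  have hm8 := le_of_rpow_le_RR hc₁ ((le_max_right _ _).trans hx) hx0 hR
  set R := RR x with hRdef
  set P := x ^ (10 / 9 : ℝ) * R ^ (2 / 3 : ℝ) with hP
  have hP0 : 0 < P := by positivity
  have hxδ : 1 ≤ x ^ δ := Real.one_le_rpow hx1 hδ.le
  obtain ⟨K, η, hp, hK₁, hK₂⟩ := exists_avgParam hx1 (le_min hm8 hx8) (min_le_right _ x)
  refine ⟨K, η, hp, ?_⟩
  have hK0 := hp.pos
  have hm' : (R * x ^ (-(1 / 3) : ℝ)) ^ (1 / 3 : ℝ) = R ^ (1 / 3 : ℝ) * x ^ (-(1 / 9) : ℝ) := by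
    rw [Real.mul_rpow hR0.le (by positivity), ← Real.rpow_mul hx0.le]; norm_num
  have hRR : R ^ (2 / 3 : ℝ) * R ^ (1 / 3 : ℝ) = R := by
    rw [← Real.rpow_add hR0]; norm_num
  have b1 : (K : ℝ) ^ 2 * x ^ (4 / 3 : ℝ) ≤ P := by
    have : (K : ℝ) ≤ R ^ (1 / 3 : ℝ) * x ^ (-(1 / 9) : ℝ) := by
      rw [← hm']
      exact hK₁.trans (Real.rpow_le_rpow (by positivity) (min_le_left _ _) (by norm_num))
    calc (K : ℝ) ^ 2 * x ^ (4 / 3 : ℝ)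
        ≤ (R ^ (1 / 3 : ℝ) * x ^ (-(1 / 9) : ℝ)) ^ 2 * x ^ (4 / 3 : ℝ) := by gcongr
      _ = x ^ (-(1 / 9) + -(1 / 9) + 4 / 3 : ℝ) * R ^ (1 / 3 + 1 / 3 : ℝ) := by
        rw [Real.rpow_add hx0, Real.rpow_add hx0, Real.rpow_add hR0]; ring
      _ = P := by rw [hP]; norm_num
  have b2 : x * R / K ≤ 2 * (P + C₀ ^ (1 / 3 : ℝ) * x ^ δ * P) := by
    have e1 : x * R / K ≤ 2 * (x * R / (min (R * x ^ (-(1 / 3) : ℝ)) x) ^ (1 / 3 : ℝ)) := by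
      have hκ : 0 < (min (R * x ^ (-(1 / 3) : ℝ)) x) ^ (1 / 3 : ℝ) := by
        have : 0 < min (R * x ^ (-(1 / 3) : ℝ)) x := lt_min (by positivity) hx0
        positivity
      rw [← mul_div_assoc, div_le_div_iff₀ hK0 hκ]
      calc _ ≤ x * R * (2 * K) := by gcongr
        _ = _ := by ring
    refine e1.trans ?_
    gcongr 2 * ?_
    rcases min_choice (R * x ^ (-(1 / 3) : ℝ)) x with h | h <;> rw [h]
    · rw [hm', div_le_iff₀ (by positivity)]
      have : x * R = P * (R ^ (1 / 3 : ℝ) * x ^ (-(1 / 9) : ℝ)) := by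
        calc x * R = x ^ (10 / 9 + -(1 / 9) : ℝ) * (R ^ (2 / 3 : ℝ) * R ^ (1 / 3 : ℝ)) := by
              rw [hRR]; norm_num
          _ = _ := by rw [Real.rpow_add hx0, hP]; ring
      rw [this]
      gcongr
      have : 0 ≤ C₀ ^ (1 / 3 : ℝ) * x ^ δ * P := by positivity
      linarith
    · have f1 : R ^ (1 / 3 : ℝ) ≤ C₀ ^ (1 / 3 : ℝ) * (x ^ (4 / 9 : ℝ) * x ^ δ) := by
        have := Real.rpow_le_rpow hR0.le (h₀ x hx1) (by norm_num : (0 : ℝ) ≤ 1 / 3)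
        rw [Real.mul_rpow hC₀.le (by positivity), ← Real.rpow_mul hx0.le] at this
        refine this.trans ?_
        rw [← Real.rpow_add hx0]
        gcongr
        linarith
      rw [div_le_iff₀ (by positivity)]
      calc x * R = x * R ^ (2 / 3 : ℝ) * R ^ (1 / 3 : ℝ) := by rw [mul_assoc, hRR]
        _ ≤ x * R ^ (2 / 3 : ℝ) * (C₀ ^ (1 / 3 : ℝ) * (x ^ (4 / 9 : ℝ) * x ^ δ)) := by gcongr
        _ = C₀ ^ (1 / 3 : ℝ) * x ^ δ * R ^ (2 / 3 : ℝ) * x ^ (1 + 4 / 9 : ℝ) := by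
          rw [Real.rpow_add hx0, Real.rpow_one]; ring
        _ = C₀ ^ (1 / 3 : ℝ) * x ^ δ * R ^ (2 / 3 : ℝ) * x ^ (10 / 9 + 1 / 3 : ℝ) := by norm_num
        _ = C₀ ^ (1 / 3 : ℝ) * x ^ δ * P * x ^ (1 / 3 : ℝ) := by
          rw [Real.rpow_add hx0, hP]; ring
        _ ≤ _ := by gcongr; linarith
  have b3 : x ^ (5 / 3 : ℝ) ≤ (1 / c₁) ^ (2 / 3 : ℝ) * P := by
    calc x ^ (5 / 3 : ℝ) ≤ x ^ (10 / 9 + 2 / 3 : ℝ) :=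
          Real.rpow_le_rpow_of_exponent_le hx1 (by norm_num)
      _ = x ^ (10 / 9 : ℝ) * x ^ (2 / 3 : ℝ) := Real.rpow_add hx0 _ _
      _ ≤ x ^ (10 / 9 : ℝ) * (1 / c₁ * R) ^ (2 / 3 : ℝ) := by
        gcongr
        rw [one_div_mul_eq_div, le_div_iff₀ hc₁]; linarith
      _ = _ := by rw [Real.mul_rpow (by positivity) hR0.le, hP]; ring
  have hxP : x ^ (10 / 9 + 2 * δ) * R ^ (2 / 3 : ℝ) = x ^ δ * (x ^ δ * P) := by
    rw [show 10 / 9 + 2 * δ = δ + δ + 10 / 9 by ring, Real.rpow_add hx0, Real.rpow_add hx0, hP]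
    ring
  rw [hxP, Ebd, mul_left_comm]
  gcongr
  have hPx : P ≤ x ^ δ * P := le_mul_of_one_le_left hP0.le hxδ
  have b3' : (1 / c₁) ^ (2 / 3 : ℝ) * P ≤ (1 / c₁) ^ (2 / 3 : ℝ) * (x ^ δ * P) := by gcongr
  linarith

lemma abs_Umain_le_of_le {x₁ : ℝ} : ∃ B : ℝ, ∀ x Q : ℝ, 1 ≤ x → x ≤ x₁ → 0 ≤ Q → Q ≤ x₁ →
    |Umain x Q| ≤ B := by
  obtain ⟨C, hC, h⟩ := RR_le one_pos
  refine ⟨x₁ * (C * x₁ ^ (4 / 3 + 1 : ℝ)) + |Aone| * x₁ * x₁ +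
    |cG ^ 2 * aCube| * x₁ ^ (5 / 3 : ℝ) * x₁ ^ (1 / 3 : ℝ), fun x Q hx hx₁ hQ hQ₁ => ?_⟩
  have hx0 : 0 ≤ x := by linarith
  have hx₁0 : 0 ≤ x₁ := by linarith
  have hRn := RR_nonneg x
  have hR : RR x ≤ C * x₁ ^ (4 / 3 + 1 : ℝ) := (h x hx).trans (by gcongr)
  rw [Umain]
  refine (abs_add_le _ _).trans (add_le_add ((abs_sub _ _).trans (add_le_add ?_ ?_)) ?_)
  · rw [abs_of_nonneg (by positivity)]
    gcongr
  · rw [abs_mul, abs_mul, abs_of_nonneg hQ, abs_of_nonneg hx0]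
    gcongr
  · rw [abs_mul, abs_mul, abs_neg, abs_of_nonneg (by positivity : 0 ≤ Q ^ (5 / 3 : ℝ)),
      abs_of_nonneg (by positivity : 0 ≤ x ^ (1 / 3 : ℝ))]
    gcongr

lemma Vthree_le_of_le {x₁ : ℝ} : ∃ B : ℝ, ∀ x Q : ℝ, 1 ≤ x → x ≤ x₁ → Q ≤ x₁ →
    Vthree x Q ≤ B := by
  refine ⟨∑ q ∈ Icc 1 ⌊x₁⌋₊, 9 * Jtot * q ^ 2 * (x₁ ^ (1 / 3 : ℝ) + q) ^ 4 / q,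
    fun x Q hx hx₁ hQ₁ => (Vthree_mono hQ₁).trans ?_⟩
  rw [Vthree_eq]
  refine Finset.sum_le_sum fun q hq => ?_
  gcongr
  refine (Wq_le_lattice (by have := Finset.mem_Icc.1 hq; omega) (by linarith)).trans ?_
  have := Hq_le_Jtot q
  have := Hq_nonneg q
  have := Jtot_pos
  gcongr

lemma Vthree_floor (x Q : ℝ) : Vthree x ⌊Q⌋₊ = Vthree x Q := by
  rw [Vthree_eq, Vthree_eq, Nat.floor_natCast]

lemma abs_Vthree_sub_Umain_le_of_one_le {ε : ℝ} (hε : 0 < ε) : ∃ C x₁ : ℝ, 0 < C ∧ 1 ≤ x₁ ∧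
    ∀ x Q : ℝ, x₁ ≤ x → 1 ≤ Q → Q ≤ x → |Vthree x Q - Umain x Q| ≤
      C * (x ^ (10 / 9 + ε) * RR x ^ (2 / 3 : ℝ) + Q ^ 2 * (x / Q) ^ ε) := by
  obtain ⟨c₁, x₀, hc₁, hx₀, hlow⟩ := le_RR
  set δ := min (ε / 2) (1 / 4) with hδdef
  have hδ : 0 < δ := lt_min (by positivity) (by norm_num)
  have hδ' : δ < 1 / 3 := (min_le_right _ _).trans_lt (by norm_num)
  have hδε : 2 * δ ≤ ε := by have := min_le_left (ε / 2) (1 / 4 : ℝ); linarith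
  obtain ⟨C₁, hC₁, h₁⟩ := abs_Vthree_sub_Umain_le hδ hδ' hc₁
  obtain ⟨C₂, hC₂, h₂⟩ := abs_Umain_sub_le hc₁
  obtain ⟨C₃, x₁, hC₃, hx₁, h₃⟩ := exists_avgParam_Ebd_le hδ hc₁
  refine ⟨(C₁ + 2 * C₂) * C₃ + C₁, max x₀ x₁, by positivity, hx₀.trans (le_max_left _ _),
    fun x Q hx hQ hQx => ?_⟩
  have hxx₀ := (le_max_left _ _).trans hx
  have hx1 : 1 ≤ x := hx₀.trans hxx₀
  have hx0 : 0 < x := by linarith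
  have hQ0 : 0 < Q := by linarith
  have hR := hlow x hxx₀
  have hRn := RR_nonneg x
  obtain ⟨K, η, hp, hE⟩ := h₃ x ((le_max_right _ _).trans hx) hR
  have hE0 := Ebd_nonneg (δ := δ) hx0.le K
  have ht : 0 < ⌊Q⌋₊ := Nat.floor_pos.2 hQ
  have ht' : (0 : ℝ) < ⌊Q⌋₊ := by exact_mod_cast ht
  have htQ : (⌊Q⌋₊ : ℝ) ≤ Q := Nat.floor_le hQ0.le
  have g1 := h₁ x hx1 hR K η hp ⌊Q⌋₊ ht (htQ.trans hQx)
  have g2 := h₂ x hx0.le hR ⌊Q⌋₊ Q ht'.le hQ0.le (by linarith) (by linarith)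
  have g3 : |(⌊Q⌋₊ : ℝ) - Q| * RR x ≤ 2 * Ebd δ x K := by
    refine le_trans ?_ (hp.mul_RR_le hx1 hδ.le)
    gcongr
    refine le_trans ?_ (hp.one_le hx1)
    rw [abs_le]; constructor <;> linarith [Nat.lt_floor_add_one Q]
  have g4 : (⌊Q⌋₊ : ℝ) ^ 2 * (x / ⌊Q⌋₊) ^ δ ≤ Q ^ 2 * (x / Q) ^ ε := by
    refine (sq_mul_rpow_mono (by linarith) hx0.le ht' htQ).trans ?_
    gcongr
    · rw [le_div_iff₀ hQ0]; linarith
    · linarith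
  have g5 : x ^ (10 / 9 + 2 * δ) * RR x ^ (2 / 3 : ℝ) ≤ x ^ (10 / 9 + ε) * RR x ^ (2 / 3 : ℝ) := by
    gcongr
  rw [Vthree_floor] at g1
  set F := Q ^ 2 * (x / Q) ^ ε with hF
  have hF0 : 0 ≤ F := by positivity
  set M := x ^ (10 / 9 + ε) * RR x ^ (2 / 3 : ℝ) with hM
  have hM0 : 0 ≤ M := by positivity
  have hEM : Ebd δ x K ≤ C₃ * M := hE.trans (by gcongr)
  calc |Vthree x Q - Umain x Q|
      ≤ |Vthree x Q - Umain x ⌊Q⌋₊| + |Umain x ⌊Q⌋₊ - Umain x Q| := abs_sub_le _ _ _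
    _ ≤ C₁ * (C₃ * M + F) + C₂ * (2 * (C₃ * M)) := by
      refine add_le_add (g1.trans ?_) (g2.trans ?_)
      · gcongr
      · exact mul_le_mul_of_nonneg_left (g3.trans (by gcongr)) hC₂.le
    _ ≤ _ := by
      have : 0 ≤ (C₁ + 2 * C₂) * C₃ * F := by positivity
      have : 0 ≤ C₁ * M := by positivity
      linarith

lemma exists_abs_Vthree_sub_Umain_le {ε : ℝ} (hε : 0 < ε) : ∃ C : ℝ, 0 < C ∧
    ∀ x Q : ℝ, 1 ≤ x → 1 ≤ Q → Q ≤ x → |Vthree x Q - Umain x Q| ≤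
      C * (x ^ (10 / 9 + ε) * RR x ^ (2 / 3 : ℝ) + Q ^ 2 * (x / Q) ^ ε) := by
  obtain ⟨C, x₁, hC, hx₁, h⟩ := abs_Vthree_sub_Umain_le_of_one_le hε
  obtain ⟨B₁, hB₁⟩ := Vthree_le_of_le (x₁ := x₁)
  obtain ⟨B₂, hB₂⟩ := abs_Umain_le_of_le (x₁ := x₁)
  refine ⟨max C (B₁ + B₂), lt_max_of_lt_left hC, fun x Q hx hQ hQx => ?_⟩
  have hQ0 : 0 < Q := by linarith
  have hRn := RR_nonneg x
  have hM : 0 ≤ x ^ (10 / 9 + ε) * RR x ^ (2 / 3 : ℝ) := by positivity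
  have hF : 1 ≤ Q ^ 2 * (x / Q) ^ ε :=
    one_le_mul_of_one_le_of_one_le (one_le_pow₀ hQ)
      (Real.one_le_rpow ((one_le_div hQ0).2 hQx) hε.le)
  rcases le_total x₁ x with hx' | hx'
  · exact (h x Q hx' hQ hQx).trans (by gcongr; exact le_max_left _ _)
  · have k1 := hB₁ x Q hx hx' (hQx.trans hx')
    have k2 := hB₂ x Q hx hx' hQ0.le (hQx.trans hx')
    have k3 := abs_sub (Vthree x Q) (Umain x Q)
    rw [abs_of_nonneg (Vthree_nonneg x Q)] at k3
    have k4 : B₁ + B₂ ≤ max C (B₁ + B₂) := le_max_right _ _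
    have k5 : (0 : ℝ) ≤ max C (B₁ + B₂) := hC.le.trans (le_max_left _ _)
    exact (k3.trans ((add_le_add k1 k2).trans k4)).trans (le_mul_of_one_le_right k5 (by linarith))

end ThreeCubes

/-- Ding: asymptotic formula for the variance of sums of three positive cubes in
arithmetic progressions. -/
theorem ding_three_cubes_variance :
    ∃ A₂ : ℝ, ∀ ε : ℝ, 0 < ε → ∃ C : ℝ, 0 < C ∧
      ∀ x Q : ℝ, 2 ≤ x → 1 ≤ Q → Q ≤ x → ∃ E : ℝ,
        Vthree x Q = Q * (∑ n ∈ Finset.Icc 1 ⌊x⌋₊, (rthree n : ℝ) ^ 2) -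
            Aone * Q * x + A₂ * Q ^ ((5 : ℝ) / 3) * x ^ ((1 : ℝ) / 3) + E ∧
        |E| ≤ C * (x ^ ((10 : ℝ) / 9 + ε) *
            (∑ n ∈ Finset.Icc 1 ⌊x⌋₊, (rthree n : ℝ) ^ 2) ^ ((2 : ℝ) / 3) +
          Q ^ 2 * (x / Q) ^ ε) := by
  refine ⟨-(ThreeCubes.cG ^ 2 * ThreeCubes.aCube), fun ε hε => ?_⟩
  obtain ⟨C, hC, h⟩ := ThreeCubes.exists_abs_Vthree_sub_Umain_le hε
  refine ⟨C, hC, fun x Q hx hQ hQx =>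
    ⟨Vthree x Q - ThreeCubes.Umain x Q, ?_, h x Q (by linarith) hQ hQx⟩⟩
  rw [ThreeCubes.Umain, ThreeCubes.RR]
  ring
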